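/- arXiv:1304.5048 — 2 statements merged into one kernel-verified Lean document; each statement's English description precedes it below -/
import Mathlib

section
/- Let q>0 and let 𝐅 be a distribution on ℂ belonging to Λ'_{q,l} for some integer l≥0; set F = ω^{-1}𝐅. Suppose that the infinite matrix 𝔓(F) and, for every sequence of points z_j∈ℂ, the infinite matrix 𝔎(F) have rank at most N. Then 𝐅 is a finite linear combination of Dirac δ-distributions at finitely many points and their derivatives: 𝐅 = Σ_{j=1}^{N₀} 𝓛_j δ_{z_j}, where N₀ ≤ N, z_1,…,z_{N₀} ∈ ℂ, and each 𝓛_j is a constant-coefficient differential operator. -/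
open MeasureTheory Filter Complex Metric

noncomputable section

/-- The Gaussian weight `ω(z) = π⁻¹ exp (-|z|²)`. -/
def omegaW (z : ℂ) : ℝ := Real.pi⁻¹ * Real.exp (-‖z‖ ^ 2)

/-- Membership in the weighted space `Λ_{q,l}`: `C^l`-smooth functions whose
derivatives up to order `l` are `o(exp (q|z|²))` at infinity. -/
def MemLambda (q : ℝ) (l : ℕ) (ψ : ℂ → ℂ) : Prop :=
  ContDiff ℝ (l : ℕ∞) ψ ∧
    ∀ n : ℕ, n ≤ l →
      Tendsto (fun z : ℂ => ‖iteratedFDeriv ℝ n ψ z‖ * Real.exp (-q * ‖z‖ ^ 2))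
        (cocompact ℂ) (nhds 0)

/-- The norm of `Λ_{q,l}`. -/
def lambdaNorm (q : ℝ) (l : ℕ) (ψ : ℂ → ℂ) : ℝ :=
  sSup {r : ℝ | ∃ n ≤ l, ∃ z : ℂ, r = ‖iteratedFDeriv ℝ n ψ z‖ * Real.exp (-q * ‖z‖ ^ 2)}

/-- Distributions on `ℂ`, encoded by their pairing against test functions
(with respect to Lebesgue measure). -/
abbrev Dst : Type := (ℂ → ℂ) → ℂ

/-- Membership in the dual space `Λ'_{q,l}`. -/
def MemLambdaDual (q : ℝ) (l : ℕ) (T : Dst) : Prop :=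
  (∀ ψ φ, MemLambda q l ψ → MemLambda q l φ → T (ψ + φ) = T ψ + T φ) ∧
  (∀ (c : ℂ) (ψ), MemLambda q l ψ → T (c • ψ) = c * T ψ) ∧
  (∃ C : ℝ, ∀ ψ, MemLambda q l ψ → ‖T ψ‖ ≤ C * lambdaNorm q l ψ)

/-- The dual norm on `Λ'_{q,l}`. -/
def lambdaDualNorm (q : ℝ) (l : ℕ) (T : Dst) : ℝ :=
  sInf {C : ℝ | 0 ≤ C ∧ ∀ ψ, MemLambda q l ψ → ‖T ψ‖ ≤ C * lambdaNorm q l ψ}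

/-- `∂̄ = (∂/∂x + i ∂/∂y)/2` of a function. -/
def dbarFun (ψ : ℂ → ℂ) : ℂ → ℂ := fun z =>
  (fderiv ℝ ψ z 1 + Complex.I * fderiv ℝ ψ z Complex.I) / 2

/-- Membership in `𝔇_q`: smooth functions all of whose derivatives are
`o(exp (q|z|²))`. -/
def MemDq (q : ℝ) (ψ : ℂ → ℂ) : Prop :=
  ContDiff ℝ (⊤ : ℕ∞) ψ ∧
    ∀ n : ℕ,
      Tendsto (fun z : ℂ => ‖iteratedFDeriv ℝ n ψ z‖ * Real.exp (-q * ‖z‖ ^ 2))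
        (cocompact ℂ) (nhds 0)

/-- Membership in the dual space `𝔇'_q`; every such distribution has finite
order, i.e. is bounded by some `Λ_{q,l}`-norm. -/
def MemDqDual (q : ℝ) (T : Dst) : Prop :=
  (∀ ψ φ, MemDq q ψ → MemDq q φ → T (ψ + φ) = T ψ + T φ) ∧
  (∀ (c : ℂ) (ψ), MemDq q ψ → T (c • ψ) = c * T ψ) ∧
  (∃ (l : ℕ) (C : ℝ), ∀ ψ, MemDq q ψ → ‖T ψ‖ ≤ C * lambdaNorm q l ψ)

/-- Membership in the Fock space `𝓑`: entire and square integrable against `ω dλ`. -/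
def MemFock (u : ℂ → ℂ) : Prop :=
  Differentiable ℂ u ∧ Integrable (fun z : ℂ => ‖u z‖ ^ 2 * omegaW z)

/-- The Fock norm. -/
def fockNorm (u : ℂ → ℂ) : ℝ := Real.sqrt (∫ z : ℂ, ‖u z‖ ^ 2 * omegaW z)

/-- The Fock (weighted `L²`) inner product `(u,v) = ∫ u v̄ ω dλ`. -/
def fockInner (u v : ℂ → ℂ) : ℂ := ∫ z : ℂ, u z * (starRingEnd ℂ) (v z) * (omegaW z : ℂ)

/-- The reproducing kernel `κ_z(w) = exp (w z̄)`. -/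
def repKer (z : ℂ) : ℂ → ℂ := fun w => Complex.exp (w * (starRingEnd ℂ) z)

/-- The Toeplitz sesquilinear form `𝐭_F(u,v) = ⟨ωF, u v̄⟩`, expressed through the
distribution `T = 𝐅 = ωF`. -/
def toeplitzForm (T : Dst) (u v : ℂ → ℂ) : ℂ := T fun z => u z * (starRingEnd ℂ) (v z)

/-- An infinite matrix has rank at most `N` iff every finite submatrix does. -/
def InfRankLE (A : ℕ → ℕ → ℂ) (N : ℕ) : Prop :=
  ∀ (m : ℕ) (r c : Fin m → ℕ), (Matrix.of fun i j : Fin m => A (r i) (c j)).rank ≤ N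

/-- The matrix `𝔓(F)` with entries `𝐭_F(z^k, z^{k'})`. -/
def matP (T : Dst) : ℕ → ℕ → ℂ :=
  fun k k' => toeplitzForm T (fun z => z ^ k) (fun z => z ^ k')

/-- The matrix `𝔎(F)` attached to a sequence of points, with entries
`𝐭_F(κ_{z_k}, κ_{z_{k'}})`. -/
def matK (T : Dst) (zs : ℕ → ℂ) : ℕ → ℕ → ℂ :=
  fun k k' => toeplitzForm T (repKer (zs k)) (repKer (zs k'))

/-- The scaling `S_t ψ (z) = t ψ(tz)`. -/
def scaleS (t : ℝ) (ψ : ℂ → ℂ) : ℂ → ℂ := fun z => (t : ℂ) * ψ ((t : ℂ) * z)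

/-- The scaling `W_t` on distributions, `⟨W_t 𝐅, ψ⟩ = ⟨𝐅, S_{t⁻¹} ψ⟩`. -/
def scaleW (t : ℝ) (T : Dst) : Dst := fun ψ => T (scaleS t⁻¹ ψ)

/-- The partial derivative `∂/∂x`. -/
def pd1 (ψ : ℂ → ℂ) : ℂ → ℂ := fun z => fderiv ℝ ψ z 1

/-- The partial derivative `∂/∂y`. -/
def pd2 (ψ : ℂ → ℂ) : ℂ → ℂ := fun z => fderiv ℝ ψ z Complex.I

/-- The mixed partial derivative `D₁^a D₂^b`. -/
def partialD (a b : ℕ) (ψ : ℂ → ℂ) : ℂ → ℂ := pd1^[a] (pd2^[b] ψ)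

/-- Smooth functions all of whose derivatives grow slower than every Gaussian. -/
structure SubGaussian (u : ℂ → ℂ) : Prop where
  smooth : ContDiff ℝ (⊤ : ℕ∞) u
  bound : ∀ (n : ℕ) (ε : ℝ), 0 < ε → ∃ C : ℝ, 0 ≤ C ∧ ∀ m ≤ n, ∀ z,
    ‖iteratedFDeriv ℝ m u z‖ ≤ C * Real.exp (ε * ‖z‖ ^ 2)

/-- Weighted bound on the derivatives up to order `l`. -/
def WBound (q : ℝ) (l : ℕ) (ψ : ℂ → ℂ) (K : ℝ) : Prop :=
  ∀ n ≤ l, ∀ z, ‖iteratedFDeriv ℝ n ψ z‖ ≤ K * Real.exp (q * ‖z‖ ^ 2)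

/-- Linear functionals on `Λ_{q,l}` that are bounded in terms of weighted bounds. -/
structure WFunctional (q : ℝ) (l : ℕ) (S : Dst) : Prop where
  map_add : ∀ ψ φ, MemLambda q l ψ → MemLambda q l φ → S (ψ + φ) = S ψ + S φ
  map_smul : ∀ (c : ℂ) (ψ), MemLambda q l ψ → S (c • ψ) = c * S ψ
  bound : ∃ C : ℝ, 0 ≤ C ∧ ∀ ψ K, MemLambda q l ψ → WBound q l ψ K → ‖S ψ‖ ≤ C * K

theorem MemLambdaDual.wFunctional {q : ℝ} {l : ℕ} {T : Dst} (hT : MemLambdaDual q l T) :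
    WFunctional q l T := by
  obtain ⟨h1, h2, C, hC⟩ := hT
  refine ⟨h1, h2, |C|, abs_nonneg _, fun ψ K hψ hK => ?_⟩
  have hle : lambdaNorm q l ψ ≤ K := by
    refine csSup_le ⟨_, 0, Nat.zero_le _, 0, rfl⟩ ?_
    rintro r ⟨n, hn, z, rfl⟩
    have := hK n hn z
    rw [neg_mul, Real.exp_neg, ← div_eq_mul_inv, div_le_iff₀ (Real.exp_pos _)]
    exact this
  have h0 : 0 ≤ lambdaNorm q l ψ := by
    refine Real.sSup_nonneg ?_
    rintro r ⟨n, hn, z, rfl⟩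
    positivity
  calc ‖T ψ‖ ≤ C * lambdaNorm q l ψ := hC ψ hψ
    _ ≤ |C| * lambdaNorm q l ψ := mul_le_mul_of_nonneg_right (le_abs_self _) h0
    _ ≤ |C| * K := mul_le_mul_of_nonneg_left hle (abs_nonneg _)

theorem contDiff_nat_of_top {ψ : ℂ → ℂ} (h : ContDiff ℝ (⊤ : ℕ∞) ψ) (n : ℕ) :
    ContDiff ℝ (n : ℕ∞) ψ :=
  h.of_le (by exact_mod_cast le_top)

theorem MemLambda.add {q : ℝ} {l : ℕ} {ψ φ : ℂ → ℂ} (hψ : MemLambda q l ψ)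
    (hφ : MemLambda q l φ) : MemLambda q l (ψ + φ) := by
  refine ⟨hψ.1.add hφ.1, fun n hn => ?_⟩
  have h := (hψ.2 n hn).add (hφ.2 n hn)
  rw [add_zero] at h
  refine squeeze_zero (fun z => by positivity) (fun z => ?_) h
  have h1 : ContDiff ℝ n ψ := hψ.1.of_le (by exact_mod_cast hn)
  have h2 : ContDiff ℝ n φ := hφ.1.of_le (by exact_mod_cast hn)
  rw [iteratedFDeriv_add_apply h1.contDiffAt h2.contDiffAt, ← add_mul]
  gcongr
  exact norm_add_le _ _

theorem MemLambda.const_smul {q : ℝ} {l : ℕ} {ψ : ℂ → ℂ} (c : ℂ) (hψ : MemLambda q l ψ) :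
    MemLambda q l (c • ψ) := by
  refine ⟨contDiff_const.smul hψ.1, fun n hn => ?_⟩
  have h := (hψ.2 n hn).const_mul ‖c‖
  rw [mul_zero] at h
  refine h.congr fun z => ?_
  have h1 : ContDiff ℝ n ψ := hψ.1.of_le (by exact_mod_cast hn)
  rw [iteratedFDeriv_const_smul_apply h1.contDiffAt, norm_smul, mul_assoc]

theorem tendsto_exp_neg_mul_sq_cocompact {δ : ℝ} (hδ : 0 < δ) :
    Tendsto (fun z : ℂ => Real.exp (-δ * ‖z‖ ^ 2)) (cocompact ℂ) (nhds 0) := by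
  refine Real.tendsto_exp_atBot.comp ?_
  have h1 : Tendsto (fun z : ℂ => ‖z‖ ^ 2) (cocompact ℂ) atTop :=
    (tendsto_pow_atTop two_ne_zero).comp (tendsto_norm_cocompact_atTop (E := ℂ))
  exact h1.const_mul_atTop_of_neg (by linarith)

theorem memLambda_of_wBound {q q' : ℝ} (hq : q' < q) {l : ℕ} {ψ : ℂ → ℂ} {K : ℝ}
    (hψ : ContDiff ℝ (l : ℕ∞) ψ) (h : WBound q' l ψ K) : MemLambda q l ψ := by
  refine ⟨hψ, fun n hn => ?_⟩
  have h0 := (tendsto_exp_neg_mul_sq_cocompact (sub_pos.2 hq)).const_mul K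
  rw [mul_zero] at h0
  refine squeeze_zero (fun z => by positivity) (fun z => ?_) h0
  calc ‖iteratedFDeriv ℝ n ψ z‖ * Real.exp (-q * ‖z‖ ^ 2)
      ≤ (K * Real.exp (q' * ‖z‖ ^ 2)) * Real.exp (-q * ‖z‖ ^ 2) := by
        gcongr; exact h n hn z
    _ = K * Real.exp (-(q - q') * ‖z‖ ^ 2) := by
        rw [mul_assoc, ← Real.exp_add]; ring_nf

theorem SubGaussian.wBound {u : ℂ → ℂ} (hu : SubGaussian u) {q : ℝ} (hq : 0 < q) (l : ℕ) :
    ∃ K, WBound q l u K := by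
  obtain ⟨C, _, hC⟩ := hu.bound l q hq
  exact ⟨C, hC⟩

theorem SubGaussian.memLambda {u : ℂ → ℂ} (hu : SubGaussian u) {q : ℝ} (hq : 0 < q) (l : ℕ) :
    MemLambda q l u := by
  obtain ⟨K, hK⟩ := hu.wBound (half_pos hq) l
  exact memLambda_of_wBound (half_lt_self hq) (contDiff_nat_of_top hu.smooth l) hK

/-- Leibniz estimate for the derivatives of a product. -/
theorem norm_iteratedFDeriv_mul_le_two_pow {n : ℕ} {u v : ℂ → ℂ} (hu : ContDiff ℝ n u)
    (hv : ContDiff ℝ n v) (z : ℂ) {A B : ℝ} (hA : 0 ≤ A)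
    (h1 : ∀ m ≤ n, ‖iteratedFDeriv ℝ m u z‖ ≤ A)
    (h2 : ∀ m ≤ n, ‖iteratedFDeriv ℝ m v z‖ ≤ B) :
    ‖iteratedFDeriv ℝ n (fun w => u w * v w) z‖ ≤ 2 ^ n * (A * B) := by
  refine (norm_iteratedFDeriv_mul_le hu hv z le_rfl).trans ?_
  have : ∀ i ∈ Finset.range (n + 1), (n.choose i : ℝ) * ‖iteratedFDeriv ℝ i u z‖ *
      ‖iteratedFDeriv ℝ (n - i) v z‖ ≤ n.choose i * (A * B) := by
    intro i hi
    rw [mul_assoc]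
    gcongr
    · exact h1 i (Finset.mem_range_succ_iff.1 hi)
    · exact h2 _ (Nat.sub_le _ _)
  refine (Finset.sum_le_sum this).trans ?_
  rw [← Finset.sum_mul]
  have h := Nat.sum_range_choose n
  have h' : (∑ i ∈ Finset.range (n + 1), (n.choose i : ℝ)) = 2 ^ n := by exact_mod_cast h
  rw [h']

theorem SubGaussian.mul {u v : ℂ → ℂ} (hu : SubGaussian u) (hv : SubGaussian v) :
    SubGaussian (fun z => u z * v z) := by
  refine ⟨hu.smooth.mul hv.smooth, fun n ε hε => ?_⟩
  obtain ⟨A, hA, hA'⟩ := hu.bound n (ε / 2) (half_pos hε)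
  obtain ⟨B, hB, hB'⟩ := hv.bound n (ε / 2) (half_pos hε)
  refine ⟨2 ^ n * (A * B), by positivity, fun m hm z => ?_⟩
  have := norm_iteratedFDeriv_mul_le_two_pow (n := m)
    (contDiff_nat_of_top hu.smooth m) (contDiff_nat_of_top hv.smooth m) z (by positivity)
    (fun k hk => hA' k (hk.trans hm) z) (fun k hk => hB' k (hk.trans hm) z)
  refine this.trans ?_
  have h2 : Real.exp (ε * ‖z‖ ^ 2) = Real.exp (ε / 2 * ‖z‖ ^ 2) * Real.exp (ε / 2 * ‖z‖ ^ 2) := by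
    rw [← Real.exp_add]; ring_nf
  rw [h2]
  have h3 : (2 : ℝ) ^ m ≤ 2 ^ n := pow_le_pow_right₀ (by norm_num) hm
  calc _ ≤ (2 : ℝ) ^ n * (A * Real.exp (ε / 2 * ‖z‖ ^ 2) * (B * Real.exp (ε / 2 * ‖z‖ ^ 2))) := by
        gcongr
    _ = _ := by ring

theorem SubGaussian.add {u v : ℂ → ℂ} (hu : SubGaussian u) (hv : SubGaussian v) :
    SubGaussian (fun z => u z + v z) := by
  refine ⟨hu.smooth.add hv.smooth, fun n ε hε => ?_⟩
  obtain ⟨A, hA, hA'⟩ := hu.bound n ε hε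
  obtain ⟨B, hB, hB'⟩ := hv.bound n ε hε
  refine ⟨A + B, by positivity, fun m hm z => ?_⟩
  have h1 := (contDiff_nat_of_top hu.smooth m).contDiffAt (x := z)
  have h2 := (contDiff_nat_of_top hv.smooth m).contDiffAt (x := z)
  have := iteratedFDeriv_add_apply h1 h2
  change ‖iteratedFDeriv ℝ m (u + v) z‖ ≤ _
  rw [this, add_mul]
  exact (norm_add_le _ _).trans (add_le_add (hA' m hm z) (hB' m hm z))

theorem SubGaussian.of_hasCompactSupport {u : ℂ → ℂ} (hu : ContDiff ℝ (⊤ : ℕ∞) u)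
    (hc : HasCompactSupport u) : SubGaussian u := by
  refine ⟨hu, fun n ε hε => ?_⟩
  have : ∀ m : ℕ, ∃ C : ℝ, ∀ z, ‖iteratedFDeriv ℝ m u z‖ ≤ C := fun m =>
    (hu.continuous_iteratedFDeriv (by exact_mod_cast le_top)).bounded_above_of_compact_support
      (hc.iteratedFDeriv m)
  choose C hC using this
  have hC0 : ∀ m, 0 ≤ C m := fun m => (norm_nonneg _).trans (hC m 0)
  refine ⟨∑ m ∈ Finset.range (n + 1), C m, Finset.sum_nonneg fun m _ => hC0 m,
    fun m hm z => ?_⟩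
  have h1 : C m ≤ ∑ m ∈ Finset.range (n + 1), C m :=
    Finset.single_le_sum (f := C) (fun i _ => hC0 i) (Finset.mem_range_succ_iff.2 hm)
  have h2 : 1 ≤ Real.exp (ε * ‖z‖ ^ 2) := Real.one_le_exp (by positivity)
  calc ‖iteratedFDeriv ℝ m u z‖ ≤ C m * 1 := by rw [mul_one]; exact hC m z
    _ ≤ _ := by gcongr; exact (hC0 m).trans h1

theorem SubGaussian.const (c : ℂ) : SubGaussian (fun _ => c) := by
  refine ⟨contDiff_const, fun n ε hε => ⟨‖c‖, norm_nonneg _, fun m _ z => ?_⟩⟩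
  have h2 : 1 ≤ Real.exp (ε * ‖z‖ ^ 2) := Real.one_le_exp (by positivity)
  rcases Nat.eq_zero_or_pos m with rfl | hm
  · rw [norm_iteratedFDeriv_zero]
    exact le_mul_of_one_le_right (norm_nonneg _) h2
  · rw [iteratedFDeriv_const_of_ne hm.ne']
    simp only [Pi.zero_apply, norm_zero]
    positivity

theorem WFunctional.mul_left {q : ℝ} (hq : 0 < q) {l : ℕ} {S : Dst} (hS : WFunctional q l S)
    {u : ℂ → ℂ} (hu : SubGaussian u) : WFunctional (q / 2) l (fun ψ => S (fun z => u z * ψ z)) := by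
  obtain ⟨C, hC0, hC⟩ := hS.bound
  have key : ∃ A : ℝ, 0 ≤ A ∧ ∀ ψ, ContDiff ℝ (l : ℕ∞) ψ → ∀ n ≤ l, ∀ z B,
      (∀ m ≤ n, ‖iteratedFDeriv ℝ m ψ z‖ ≤ B) →
      ‖iteratedFDeriv ℝ n (fun w => u w * ψ w) z‖ ≤ A * Real.exp (q / 2 * ‖z‖ ^ 2) * B := by
    obtain ⟨A, hA, hA'⟩ := hu.bound l (q / 2) (half_pos hq)
    refine ⟨2 ^ l * A, by positivity, fun ψ hψ n hn z B hB => ?_⟩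
    have hB0 : 0 ≤ B := (norm_nonneg _).trans (hB 0 (Nat.zero_le _))
    refine (norm_iteratedFDeriv_mul_le_two_pow (n := n) (contDiff_nat_of_top hu.smooth n)
      (hψ.of_le (by exact_mod_cast hn)) z (by positivity)
      (fun k hk => hA' k (hk.trans hn) z) hB).trans ?_
    have h3 : (2 : ℝ) ^ n ≤ 2 ^ l := pow_le_pow_right₀ (by norm_num) hn
    calc _ ≤ (2 : ℝ) ^ l * (A * Real.exp (q / 2 * ‖z‖ ^ 2) * B) := by gcongr
      _ = _ := by ring
  obtain ⟨A, hA, hA'⟩ := key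
  have hmem : ∀ ψ, MemLambda (q / 2) l ψ → MemLambda q l (fun z => u z * ψ z) := by
    intro ψ hψ
    refine ⟨(contDiff_nat_of_top hu.smooth l).mul hψ.1, fun n hn => ?_⟩
    have hlim : Tendsto (fun z : ℂ => A * ∑ m ∈ Finset.range (n + 1),
        ‖iteratedFDeriv ℝ m ψ z‖ * Real.exp (-(q / 2) * ‖z‖ ^ 2)) (cocompact ℂ) (nhds 0) := by
      have := (tendsto_finsetSum (Finset.range (n + 1)) fun m hm =>
        hψ.2 m ((Finset.mem_range_succ_iff.1 hm).trans hn)).const_mul A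
      simpa using this
    refine squeeze_zero (fun z => by positivity) (fun z => ?_) hlim
    have := hA' ψ hψ.1 n hn z (∑ m ∈ Finset.range (n + 1), ‖iteratedFDeriv ℝ m ψ z‖)
      (fun m hm => Finset.single_le_sum (f := fun m => ‖iteratedFDeriv ℝ m ψ z‖)
        (fun i _ => norm_nonneg _) (Finset.mem_range_succ_iff.2 hm))
    rw [← Finset.sum_mul]
    have he : Real.exp (-(q / 2) * ‖z‖ ^ 2) =
        Real.exp (q / 2 * ‖z‖ ^ 2) * Real.exp (-q * ‖z‖ ^ 2) := by
      rw [← Real.exp_add]; ring_nf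
    rw [he]
    calc _ ≤ _ := mul_le_mul_of_nonneg_right this (Real.exp_pos _).le
      _ = _ := by ring
  refine ⟨fun ψ φ hψ hφ => ?_, fun c ψ hψ => ?_, C * A, by positivity, fun ψ K hψ hK => ?_⟩
  · rw [← hS.map_add _ _ (hmem ψ hψ) (hmem φ hφ)]
    congr 1; ext z; simp [mul_add]
  · rw [← hS.map_smul _ _ (hmem ψ hψ)]
    congr 1; ext z; simp [mul_left_comm]
  · rw [mul_assoc]
    refine hC _ _ (hmem ψ hψ) fun n hn z => ?_
    refine (hA' ψ hψ.1 n hn z _ fun m hm => hK m (hm.trans hn) z).trans (le_of_eq ?_)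
    have : Real.exp (q * ‖z‖ ^ 2) = Real.exp (q / 2 * ‖z‖ ^ 2) * Real.exp (q / 2 * ‖z‖ ^ 2) := by
      rw [← Real.exp_add]; ring_nf
    rw [this]; ring

theorem WFunctional.map_sum {q : ℝ} {l : ℕ} {S : Dst} (hS : WFunctional q l S) {ι : Type*}
    (s : Finset ι) (f : ι → ℂ → ℂ) (hf : ∀ i ∈ s, MemLambda q l (f i)) :
    MemLambda q l (∑ i ∈ s, f i) ∧ S (∑ i ∈ s, f i) = ∑ i ∈ s, S (f i) := by
  classical
  induction s using Finset.induction_on with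
  | empty =>
    have h0 : MemLambda q l 0 := by
      refine ⟨contDiff_const, fun n _ => ?_⟩
      have : iteratedFDeriv ℝ n (0 : ℂ → ℂ) = 0 := iteratedFDeriv_fun_zero
      simp [this]
    refine ⟨by simpa using h0, ?_⟩
    have := hS.map_smul 0 0 h0
    simpa using this
  | insert a s ha ih =>
    obtain ⟨h1, h2⟩ := ih fun i hi => hf i (Finset.mem_insert_of_mem hi)
    have h3 := hf a (Finset.mem_insert_self _ _)
    rw [Finset.sum_insert ha, Finset.sum_insert ha]
    exact ⟨h3.add h1, by rw [hS.map_add _ _ h3 h1, h2]⟩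

theorem norm_iteratedFDeriv_comp_real_linear_le {g : ℂ → ℂ} (hg : ContDiff ℂ (⊤ : ℕ∞) g)
    (L : ℂ →L[ℝ] ℂ) (n : ℕ) (w : ℂ) :
    ‖iteratedFDeriv ℝ n (fun w => g (L w)) w‖ ≤ ‖iteratedDeriv n g (L w)‖ * ‖L‖ ^ n := by
  have hgR : ContDiff ℝ (⊤ : ℕ∞) g := hg.restrict_scalars ℝ
  have h1 := L.iteratedFDeriv_comp_right (i := n) hgR w (by exact_mod_cast le_top)
  have h2 : ContDiffAt ℂ n g (L w) := (hg.of_le (by exact_mod_cast le_top)).contDiffAt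
  have h3 := h2.restrictScalars_iteratedFDeriv (𝕜 := ℝ)
  change ‖iteratedFDeriv ℝ n (g ∘ L) w‖ ≤ _
  rw [h1]
  refine (ContinuousMultilinearMap.norm_compContinuousLinearMap_le _ _).trans ?_
  rw [← h3, Function.comp_apply, ContinuousMultilinearMap.norm_restrictScalars,
    norm_iteratedFDeriv_eq_norm_iteratedDeriv]
  simp

theorem mul_le_sq_add {c x ε : ℝ} (hε : 0 < ε) : c * x ≤ ε * x ^ 2 + c ^ 2 / (4 * ε) := by
  have : ε * x ^ 2 + c ^ 2 / (4 * ε) - c * x = (2 * ε * x - c) ^ 2 / (4 * ε) := by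
    field_simp; ring
  have h2 : 0 ≤ (2 * ε * x - c) ^ 2 / (4 * ε) := by positivity
  linarith

/-- Weighted bounds for the composition of an entire function of exponential type with a real
linear map, uniform in the size of the derivatives. -/
theorem exists_wBound_comp_real_linear (L : ℂ →L[ℝ] ℂ) (l : ℕ) (τ : ℝ) {q : ℝ} (hq : 0 < q)
    (hτ : 0 ≤ τ) :
    ∃ C : ℝ, 0 ≤ C ∧ ∀ (g : ℂ → ℂ) (A : ℝ), ContDiff ℂ (⊤ : ℕ∞) g → 0 ≤ A →
      (∀ n ≤ l, ∀ x, ‖iteratedDeriv n g x‖ ≤ A * Real.exp (τ * ‖x‖)) →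
      WBound q l (fun w => g (L w)) (C * A) := by
  refine ⟨(1 + ‖L‖) ^ l * Real.exp ((τ * ‖L‖) ^ 2 / (4 * q)), by positivity,
    fun g A hg hA h n hn w => ?_⟩
  refine (norm_iteratedFDeriv_comp_real_linear_le hg L n w).trans ?_
  have h1 : ‖L‖ ^ n ≤ (1 + ‖L‖) ^ l :=
    (pow_le_pow_left₀ (norm_nonneg _) (by linarith) n).trans
      (pow_le_pow_right₀ (by linarith [norm_nonneg L]) hn)
  have h2 : τ * ‖L w‖ ≤ q * ‖w‖ ^ 2 + (τ * ‖L‖) ^ 2 / (4 * q) :=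
    calc τ * ‖L w‖ ≤ τ * (‖L‖ * ‖w‖) := by gcongr; exact L.le_opNorm w
      _ = (τ * ‖L‖) * ‖w‖ := by ring
      _ ≤ _ := mul_le_sq_add hq
  calc _ ≤ (A * Real.exp (q * ‖w‖ ^ 2 + (τ * ‖L‖) ^ 2 / (4 * q))) * (1 + ‖L‖) ^ l := by
        gcongr
        exact (h n hn _).trans (by gcongr)
    _ = _ := by rw [Real.exp_add]; ring

theorem SubGaussian.comp_real_linear {g : ℂ → ℂ} (hg : ContDiff ℂ (⊤ : ℕ∞) g) {τ : ℝ}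
    (hτ : 0 ≤ τ) (hA : ∀ l : ℕ, ∃ A : ℝ, 0 ≤ A ∧
      ∀ n ≤ l, ∀ x, ‖iteratedDeriv n g x‖ ≤ A * Real.exp (τ * ‖x‖))
    (L : ℂ →L[ℝ] ℂ) : SubGaussian (fun w => g (L w)) := by
  refine ⟨(hg.restrict_scalars ℝ).comp L.contDiff, fun n ε hε => ?_⟩
  obtain ⟨C, hC, h⟩ := exists_wBound_comp_real_linear L n τ hε hτ
  obtain ⟨A, hA0, hA'⟩ := hA n
  exact ⟨C * A, by positivity, h g A hg hA0 hA'⟩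

theorem iteratedDeriv_const_mul_cexp (c h : ℂ) (n : ℕ) :
    iteratedDeriv n (fun x : ℂ => c * cexp (h * x)) = fun x => c * (h ^ n * cexp (h * x)) := by
  funext x
  rw [iteratedDeriv_const_mul_field, iteratedDeriv_cexp_const_mul]

theorem subGaussian_cexp (L : ℂ →L[ℝ] ℂ) : SubGaussian (fun w => cexp (L w)) := by
  refine SubGaussian.comp_real_linear (g := cexp) (τ := 1) Complex.contDiff_exp
    zero_le_one (fun l => ⟨1, zero_le_one, fun n _ x => ?_⟩) L
  rw [iteratedDeriv_eq_iterate, Complex.iter_deriv_exp, one_mul, one_mul]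
  exact Complex.norm_exp_le_exp_norm x

theorem subGaussian_linear (L : ℂ →L[ℝ] ℂ) : SubGaussian (fun w => L w) := by
  refine SubGaussian.comp_real_linear (g := fun x => x) (τ := 1) contDiff_id
    zero_le_one (fun l => ⟨1, zero_le_one, fun n _ x => ?_⟩) L
  rw [one_mul, one_mul]
  rcases n with _ | n
  · simpa using (by linarith [Real.add_one_le_exp ‖x‖] : ‖x‖ ≤ Real.exp ‖x‖)
  · rw [iteratedDeriv_succ']
    have : deriv (fun x : ℂ => x) = fun _ => 1 := by funext y; simp
    rw [this, iteratedDeriv_const]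
    have := Real.one_le_exp (norm_nonneg x)
    split_ifs
    · simp [this]
    · simp [(Real.exp_pos _).le]

/-- The second-order remainder of `exp (h x)`. -/
def expRem (h x : ℂ) : ℂ := cexp (h * x) - 1 - h * x

theorem contDiff_expRem (h : ℂ) : ContDiff ℂ (⊤ : ℕ∞) (expRem h) := by
  unfold expRem; fun_prop

theorem deriv_expRem (h : ℂ) : deriv (expRem h) = fun x => h * cexp (h * x) - h := by
  funext x
  have h1 : HasDerivAt (fun x : ℂ => h * x) h x := by
    simpa using (hasDerivAt_id x).const_mul h
  have := ((h1.cexp).sub_const 1).sub h1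
  rw [show expRem h = fun x => cexp (h * x) - 1 - h * x from rfl]
  exact (this.deriv).trans (by ring)

theorem norm_iteratedDeriv_expRem_le {h : ℂ} (hh : ‖h‖ ≤ 1) (n : ℕ) (x : ℂ) :
    ‖iteratedDeriv n (expRem h) x‖ ≤ ‖h‖ ^ 2 * 2 * Real.exp (2 * ‖x‖) := by
  have hx : ‖h * x‖ ≤ ‖x‖ := by
    rw [norm_mul]; exact mul_le_of_le_one_left (norm_nonneg _) hh
  have he : Real.exp ‖h * x‖ ≤ Real.exp ‖x‖ := Real.exp_le_exp.2 hx
  have h2e : Real.exp (2 * ‖x‖) = Real.exp ‖x‖ * Real.exp ‖x‖ := by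
    rw [← Real.exp_add]; ring_nf
  have hq := Real.quadratic_le_exp_of_nonneg (norm_nonneg x)
  have hx0 := norm_nonneg x
  have hexp := Real.exp_pos ‖x‖
  rw [h2e]
  rcases n with _ | _ | n
  · have := Complex.norm_exp_sub_sum_le_norm_mul_exp (h * x) 2
    simp only [Finset.sum_range_succ, Finset.sum_range_zero, zero_add, pow_zero, pow_one,
      Nat.factorial, Nat.cast_one, div_one, Nat.mul_one] at this
    rw [iteratedDeriv_zero, expRem, sub_sub]
    refine this.trans ?_
    rw [norm_mul, mul_pow, mul_assoc, mul_assoc]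
    refine mul_le_mul_of_nonneg_left ?_ (by positivity)
    rw [← mul_assoc]
    rw [norm_mul] at he
    refine mul_le_mul (by nlinarith) he (Real.exp_pos _).le (by positivity)
  · have := Complex.norm_exp_sub_sum_le_norm_mul_exp (h * x) 1
    simp only [Finset.sum_range_succ, Finset.sum_range_zero, zero_add, pow_zero, pow_one,
      Nat.factorial, Nat.cast_one, div_one] at this
    rw [zero_add, iteratedDeriv_one, deriv_expRem]
    have h3 : h * cexp (h * x) - h = h * (cexp (h * x) - 1) := by ring
    simp only [h3]
    rw [norm_mul]
    calc ‖h‖ * ‖cexp (h * x) - 1‖ ≤ ‖h‖ * (‖h * x‖ * Real.exp ‖h * x‖) := by gcongr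
      _ = ‖h‖ ^ 2 * (‖x‖ * Real.exp ‖h * x‖) := by rw [norm_mul]; ring
      _ ≤ ‖h‖ ^ 2 * (2 * Real.exp ‖x‖ * Real.exp ‖x‖) := by
          refine mul_le_mul_of_nonneg_left ?_ (by positivity)
          exact mul_le_mul (by nlinarith) he (Real.exp_pos _).le (by positivity)
      _ = _ := by ring
  · rw [iteratedDeriv_succ', deriv_expRem, iteratedDeriv_succ']
    have : deriv (fun x => h * cexp (h * x) - h) = fun x => h ^ 2 * cexp (h * x) := by
      funext y
      have h1 : HasDerivAt (fun x : ℂ => h * x) h y := by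
        simpa using (hasDerivAt_id y).const_mul h
      exact ((h1.cexp.const_mul h).sub_const h).deriv.trans (by ring)
    rw [this, iteratedDeriv_const_mul_cexp, norm_mul, norm_mul, norm_pow, norm_pow]
    calc ‖h‖ ^ 2 * (‖h‖ ^ n * ‖cexp (h * x)‖) ≤ ‖h‖ ^ 2 * (1 * Real.exp ‖h * x‖) := by
          gcongr
          · exact pow_le_one₀ (norm_nonneg _) hh
          · exact Complex.norm_exp_le_exp_norm _
      _ ≤ ‖h‖ ^ 2 * (1 * Real.exp ‖x‖) := by gcongr
      _ ≤ _ := by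
        rw [mul_assoc]
        refine mul_le_mul_of_nonneg_left ?_ (by positivity)
        have h1 : 1 ≤ Real.exp ‖x‖ := Real.one_le_exp hx0
        nlinarith

theorem WFunctional.hasDerivAt_exp {q : ℝ} (hq : 0 < q) {l : ℕ} {S : Dst}
    (hS : WFunctional q l S) {u : ℂ → ℂ} (hu : SubGaussian u) (L : ℂ →L[ℝ] ℂ) (t : ℂ) :
    HasDerivAt (fun t : ℂ => S (fun w => u w * cexp (t * L w)))
      (S (fun w => u w * L w * cexp (t * L w))) t := by
  have hexp : ∀ s : ℂ, SubGaussian (fun w => cexp (s * L w)) := fun s => by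
    simpa using subGaussian_cexp (s • L)
  set S' : Dst := fun ψ => S (fun w => (u w * cexp (t * L w)) * ψ w) with hS'
  have hW : WFunctional (q / 2) l S' := hS.mul_left hq (hu.mul (hexp t))
  have hq2 := half_pos hq
  obtain ⟨C, hC0, hC⟩ := hW.bound
  obtain ⟨A, hA0, hA⟩ := exists_wBound_comp_real_linear L l 2 hq2 zero_le_two
  have key : ∀ h : ℂ, S (fun w => u w * cexp ((t + h) * L w)) - S (fun w => u w * cexp (t * L w))
      - h * S (fun w => u w * L w * cexp (t * L w)) = S' (fun w => expRem h (L w)) := by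
    intro h
    have e1 : S (fun w => u w * cexp ((t + h) * L w)) = S' (fun w => cexp (h * L w)) := by
      rw [hS']; congr 1; ext w; rw [add_mul, Complex.exp_add]; ring
    have e2 : S (fun w => u w * cexp (t * L w)) = S' (fun _ => 1) := by
      rw [hS']; simp
    have e3 : S (fun w => u w * L w * cexp (t * L w)) = S' (fun w => L w) := by
      rw [hS']; congr 1; ext w; ring
    have m1 := (hexp h).memLambda hq2 l
    have m2 := (SubGaussian.const 1).memLambda hq2 l
    have m3 := (subGaussian_linear L).memLambda hq2 l
    have e4 : (fun w => expRem h (L w)) =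
        (fun w => cexp (h * L w)) + ((-1 : ℂ) • (fun _ => (1 : ℂ)) + (-h) • fun w => L w) := by
      ext w; simp [expRem]; ring
    rw [e1, e2, e3, e4, hW.map_add _ _ m1 ((m2.const_smul _).add (m3.const_smul _)),
      hW.map_add _ _ (m2.const_smul _) (m3.const_smul _), hW.map_smul _ _ m2,
      hW.map_smul _ _ m3]
    ring
  rw [hasDerivAt_iff_isLittleO_nhds_zero]
  have hO : (fun h : ℂ => S (fun w => u w * cexp ((t + h) * L w)) -
      S (fun w => u w * cexp (t * L w)) - h • S (fun w => u w * L w * cexp (t * L w)))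
      =O[nhds 0] fun h => h ^ 2 := by
    refine Asymptotics.IsBigO.of_bound (C * (A * 2)) ?_
    filter_upwards [Metric.closedBall_mem_nhds (0 : ℂ) one_pos] with h hh
    rw [mem_closedBall_zero_iff] at hh
    rw [smul_eq_mul, key h, norm_pow]
    have hB := hA (expRem h) (‖h‖ ^ 2 * 2) (contDiff_expRem h) (by positivity)
      (fun n _ x => norm_iteratedDeriv_expRem_le hh n x)
    have hm : MemLambda (q / 2) l (fun w => expRem h (L w)) := by
      have e4 : (fun w => expRem h (L w)) =
          (fun w => cexp (h * L w)) + ((-1 : ℂ) • (fun _ => (1 : ℂ)) + (-h) • fun w => L w) := by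
        ext w; simp [expRem]; ring
      rw [e4]
      exact ((hexp h).memLambda hq2 l).add ((((SubGaussian.const 1).memLambda hq2 l).const_smul
        _).add (((subGaussian_linear L).memLambda hq2 l).const_smul _))
    refine (hC _ _ hm hB).trans (le_of_eq (by ring))
  refine hO.trans_isLittleO ?_
  exact (Asymptotics.isLittleO_pow_id one_lt_two).congr' (by simp) (by simp)

/-- Space of values of the `i.1`-th iterated derivative at the point `i.2`. -/
abbrev JetFiber (l : ℕ) (i : Fin (l + 1) × ℂ) : Type :=
  ContinuousMultilinearMap ℝ (fun _ : Fin i.1 => ℂ) ℂ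

/-- Bounded families of weighted derivatives. -/
abbrev JetSpace (l : ℕ) : Type := lp (JetFiber l) ⊤

/-- The family of Gaussian-weighted derivatives of a function up to order `l`. -/
def wJet (q : ℝ) (l : ℕ) (ψ : ℂ → ℂ) (i : Fin (l + 1) × ℂ) : JetFiber l i :=
  Real.exp (-q * ‖i.2‖ ^ 2) • iteratedFDeriv ℝ i.1 ψ i.2

theorem norm_wJet_apply_le {q : ℝ} {l : ℕ} {ψ : ℂ → ℂ} {K : ℝ} (h : WBound q l ψ K)
    (i : Fin (l + 1) × ℂ) : ‖wJet q l ψ i‖ ≤ K := by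
  have h1 := h i.1 (Nat.lt_succ_iff.1 i.1.2) i.2
  rw [wJet, norm_smul, Real.norm_eq_abs, abs_of_pos (Real.exp_pos _), neg_mul, Real.exp_neg,
    inv_mul_le_iff₀ (Real.exp_pos _), mul_comm]
  exact h1

theorem wBound_of_norm_wJet_apply_le {q : ℝ} {l : ℕ} {ψ : ℂ → ℂ} {K : ℝ}
    (h : ∀ i, ‖wJet q l ψ i‖ ≤ K) : WBound q l ψ K := by
  intro n hn z
  have := h (⟨n, Nat.lt_succ_iff.2 hn⟩, z)
  rw [wJet, norm_smul, Real.norm_eq_abs, abs_of_pos (Real.exp_pos _), neg_mul, Real.exp_neg,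
    inv_mul_le_iff₀ (Real.exp_pos _), mul_comm] at this
  exact this

theorem eq_of_wJet_eq {q : ℝ} {l : ℕ} {ψ φ : ℂ → ℂ} (h : ∀ i, wJet q l ψ i = wJet q l φ i) :
    ψ = φ := by
  funext z
  have : Real.exp (-q * ‖z‖ ^ 2) • iteratedFDeriv ℝ 0 ψ z =
    Real.exp (-q * ‖z‖ ^ 2) • iteratedFDeriv ℝ 0 φ z := h (⟨0, Nat.succ_pos _⟩, z)
  have h2 := smul_right_injective _ (Real.exp_pos (-q * ‖z‖ ^ 2)).ne' this
  have h3 := congrArg (fun f => f ![]) h2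
  simpa [iteratedFDeriv_zero_apply] using h3

theorem wJet_add {q : ℝ} {l : ℕ} {ψ φ : ℂ → ℂ} (hψ : MemLambda q l ψ) (hφ : MemLambda q l φ)
    (i : Fin (l + 1) × ℂ) : wJet q l (ψ + φ) i = wJet q l ψ i + wJet q l φ i := by
  have hi : (i.1 : ℕ) ≤ l := Nat.lt_succ_iff.1 i.1.2
  have h1 : ContDiff ℝ (i.1 : ℕ) ψ := hψ.1.of_le (by exact_mod_cast hi)
  have h2 : ContDiff ℝ (i.1 : ℕ) φ := hφ.1.of_le (by exact_mod_cast hi)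
  rw [wJet, iteratedFDeriv_add_apply h1.contDiffAt h2.contDiffAt, smul_add]
  rfl

theorem wJet_const_smul {q : ℝ} {l : ℕ} {ψ : ℂ → ℂ} (c : ℂ) (hψ : MemLambda q l ψ)
    (i : Fin (l + 1) × ℂ) : wJet q l (c • ψ) i = c • wJet q l ψ i := by
  have hi : (i.1 : ℕ) ≤ l := Nat.lt_succ_iff.1 i.1.2
  have h1 : ContDiff ℝ (i.1 : ℕ) ψ := hψ.1.of_le (by exact_mod_cast hi)
  rw [wJet, iteratedFDeriv_const_smul_apply h1.contDiffAt, smul_comm]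
  rfl

/-- Bounded functionals on `Λ_{q,l}` factor through the space of bounded jets. -/
theorem WFunctional.exists_extension {q : ℝ} {l : ℕ} {S : Dst} (hS : WFunctional q l S) :
    ∃ F : StrongDual ℂ (JetSpace l), ∀ ψ, MemLambda q l ψ → ∀ x : JetSpace l,
      (∀ i, x i = wJet q l ψ i) → F x = S ψ := by
  obtain ⟨C, hC0, hC⟩ := hS.bound
  let p : Submodule ℂ (JetSpace l) :=
    { carrier := {x | ∃ ψ, MemLambda q l ψ ∧ ∀ i, x i = wJet q l ψ i}
      add_mem' := by
        rintro x y ⟨ψ, hψ, hx⟩ ⟨φ, hφ, hy⟩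
        exact ⟨ψ + φ, hψ.add hφ, fun i => by rw [wJet_add hψ hφ, ← hx, ← hy]; rfl⟩
      zero_mem' := by
        have h0 : MemLambda q l 0 := by simpa using (hS.map_sum (ι := ℕ) ∅ 0 (by simp)).1
        refine ⟨0, h0, fun i => ?_⟩
        have := wJet_const_smul 0 h0 i
        rw [zero_smul] at this
        exact (this.trans (zero_smul ℂ (wJet q l 0 i))).symm
      smul_mem' := by
        rintro c x ⟨ψ, hψ, hx⟩
        exact ⟨c • ψ, hψ.const_smul c, fun i => by rw [wJet_const_smul c hψ, ← hx]; rfl⟩ }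
  have hp : ∀ x : p, ∃ ψ, MemLambda q l ψ ∧ ∀ i, (x : JetSpace l) i = wJet q l ψ i :=
    fun x => x.2
  choose r hr hr' using hp
  let f₀ : p →ₗ[ℂ] ℂ :=
    { toFun := fun x => S (r x)
      map_add' := fun x y => by
        rw [← hS.map_add _ _ (hr x) (hr y)]
        congr 1
        refine eq_of_wJet_eq (q := q) (l := l) fun i => ?_
        rw [← hr', wJet_add (hr x) (hr y), ← hr', ← hr']; rfl
      map_smul' := fun c x => by
        rw [RingHom.id_apply, smul_eq_mul, ← hS.map_smul _ _ (hr x)]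
        congr 1
        refine eq_of_wJet_eq (q := q) (l := l) fun i => ?_
        rw [← hr', wJet_const_smul c (hr x), ← hr']; rfl }
  let f : StrongDual ℂ p := f₀.mkContinuous C fun x => by
    refine hC _ _ (hr x) (wBound_of_norm_wJet_apply_le fun i => ?_)
    rw [← hr']
    exact lp.norm_apply_le_norm ENNReal.top_ne_zero (x : JetSpace l) i
  obtain ⟨F, hF, -⟩ := exists_extension_norm_eq p f
  refine ⟨F, fun ψ hψ x hx => ?_⟩
  have hxp : x ∈ p := ⟨ψ, hψ, hx⟩
  have h1 := hF ⟨x, hxp⟩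
  rw [h1]
  change S (r ⟨x, hxp⟩) = S ψ
  congr 1
  refine eq_of_wJet_eq (q := q) (l := l) fun i => ?_
  rw [← hr', ← hx]

/-- The phase of the Fourier character with frequency `v`. -/
def fourierPhase (v : ℂ) : ℂ →L[ℝ] ℂ :=
  (-(2 * Real.pi * I) : ℂ) • ofRealCLM.comp (innerSL ℝ v : ℂ →L[ℝ] ℝ)

theorem fourierPhase_apply (v w : ℂ) :
    fourierPhase v w = -(2 * Real.pi * I) * ((inner ℝ v w : ℝ) : ℂ) :=
  rfl

theorem norm_fourierPhase_le (v : ℂ) : ‖fourierPhase v‖ ≤ 2 * Real.pi * ‖v‖ := by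
  refine ContinuousLinearMap.opNorm_le_bound _ (by positivity) fun w => ?_
  rw [fourierPhase_apply, norm_mul, norm_neg, norm_mul, norm_mul, norm_I, Complex.norm_real,
    Complex.norm_real, Complex.norm_ofNat, mul_one, Real.norm_of_nonneg Real.pi_pos.le,
    mul_assoc (2 * Real.pi)]
  exact mul_le_mul_of_nonneg_left (norm_inner_le_norm (𝕜 := ℝ) v w) (by positivity)

theorem fourierPhase_sub (v v' : ℂ) : fourierPhase (v - v') = fourierPhase v - fourierPhase v' := by
  ext w; simp [fourierPhase_apply, inner_sub_left]; ring

theorem norm_cexp_fourierPhase (v w : ℂ) : ‖cexp (fourierPhase v w)‖ = 1 := by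
  have : fourierPhase v w = ((-(2 * Real.pi * inner ℝ v w) : ℝ) : ℂ) * I := by
    rw [fourierPhase_apply]; push_cast; ring
  rw [this, Complex.norm_exp_ofReal_mul_I]

theorem norm_iteratedFDeriv_cexp_fourierPhase_le (v : ℂ) (n : ℕ) (w : ℂ) :
    ‖iteratedFDeriv ℝ n (fun w => cexp (fourierPhase v w)) w‖ ≤ (2 * Real.pi * ‖v‖) ^ n := by
  refine (norm_iteratedFDeriv_comp_real_linear_le Complex.contDiff_exp _ n w).trans ?_
  rw [iteratedDeriv_eq_iterate, Complex.iter_deriv_exp, norm_cexp_fourierPhase, one_mul]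
  exact pow_le_pow_left₀ (norm_nonneg _) (norm_fourierPhase_le v) n

theorem wBound_cexp_fourierPhase {q : ℝ} (hq : 0 < q) (l : ℕ) (v : ℂ) :
    WBound q l (fun w => cexp (fourierPhase v w)) ((1 + 2 * Real.pi * ‖v‖) ^ l) := by
  intro n hn z
  have h0 : 0 ≤ 2 * Real.pi * ‖v‖ := by positivity
  calc _ ≤ _ := norm_iteratedFDeriv_cexp_fourierPhase_le v n z
    _ ≤ (1 + 2 * Real.pi * ‖v‖) ^ n := pow_le_pow_left₀ h0 (by linarith) n
    _ ≤ (1 + 2 * Real.pi * ‖v‖) ^ l := pow_le_pow_right₀ (by linarith) hn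
    _ ≤ _ := le_mul_of_one_le_right (by positivity) (Real.one_le_exp (by positivity))

/-- The jet of the Fourier character with frequency `v`. -/
def fourierJet {q : ℝ} (hq : 0 < q) (l : ℕ) (v : ℂ) : JetSpace l :=
  ⟨wJet q l (fun w => cexp (fourierPhase v w)), memℓp_infty ⟨(1 + 2 * Real.pi * ‖v‖) ^ l, by
    rintro _ ⟨i, rfl⟩
    exact norm_wJet_apply_le (wBound_cexp_fourierPhase hq l v) i⟩⟩

theorem norm_fourierJet_le {q : ℝ} (hq : 0 < q) (l : ℕ) (v : ℂ) :
    ‖fourierJet hq l v‖ ≤ (1 + 2 * Real.pi * ‖v‖) ^ l :=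
  lp.norm_le_of_forall_le (by positivity) fun i =>
    norm_wJet_apply_le (wBound_cexp_fourierPhase hq l v) i

theorem norm_iteratedDeriv_cexp_sub_one_le (M : ℂ →L[ℝ] ℂ) (hM : ‖M‖ ≤ 1) (n : ℕ) (w : ℂ) :
    ‖iteratedFDeriv ℝ n (fun w => cexp (M w) - 1) w‖ ≤ ‖M‖ * Real.exp (2 * ‖w‖) := by
  have hMw : ‖M w‖ ≤ ‖M‖ * ‖w‖ := M.le_opNorm w
  have hMw1 : ‖M w‖ ≤ ‖w‖ := hMw.trans (mul_le_of_le_one_left (norm_nonneg _) hM)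
  have h2e : Real.exp (2 * ‖w‖) = Real.exp ‖w‖ * Real.exp ‖w‖ := by
    rw [← Real.exp_add]; ring_nf
  have hw1 : 1 ≤ Real.exp ‖w‖ := Real.one_le_exp (norm_nonneg _)
  have hw2 : ‖w‖ ≤ Real.exp ‖w‖ := by linarith [Real.add_one_le_exp ‖w‖]
  have hM0 := norm_nonneg M
  rw [h2e]
  refine (norm_iteratedFDeriv_comp_real_linear_le (g := fun x => cexp x - 1)
    (Complex.contDiff_exp.sub contDiff_const) M n w).trans ?_
  rcases n with _ | n
  · have := Complex.norm_exp_sub_sum_le_norm_mul_exp (M w) 1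
    simp only [Finset.sum_range_succ, Finset.sum_range_zero, zero_add, pow_zero, pow_one,
      Nat.factorial, Nat.cast_one, div_one] at this
    rw [iteratedDeriv_zero, pow_zero, mul_one]
    calc _ ≤ _ := this
      _ ≤ (‖M‖ * ‖w‖) * Real.exp ‖w‖ := by gcongr
      _ ≤ (‖M‖ * Real.exp ‖w‖) * Real.exp ‖w‖ := by gcongr
      _ = _ := by ring
  · rw [iteratedDeriv_succ']
    have : deriv (fun x => cexp x - 1) = cexp := by
      funext x; exact ((Complex.hasDerivAt_exp x).sub_const 1).deriv
    rw [this, iteratedDeriv_eq_iterate, Complex.iter_deriv_exp]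
    have h1 : ‖cexp (M w)‖ ≤ Real.exp ‖w‖ :=
      (Complex.norm_exp_le_exp_norm _).trans (Real.exp_le_exp.2 hMw1)
    have h3 : ‖M‖ ^ (n + 1) ≤ ‖M‖ := by
      rw [pow_succ]; exact mul_le_of_le_one_left hM0 (pow_le_one₀ hM0 hM)
    calc _ ≤ Real.exp ‖w‖ * ‖M‖ := by gcongr
      _ ≤ ‖M‖ * (Real.exp ‖w‖ * Real.exp ‖w‖) := by
        rw [mul_comm]; gcongr; nlinarith

theorem continuous_fourierJet {q : ℝ} (hq : 0 < q) (l : ℕ) : Continuous (fourierJet hq l) := by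
  rw [continuous_iff_continuousAt]
  intro v
  have hq2 := half_pos hq
  set A : ℝ := (1 + 2 * Real.pi * ‖v‖) ^ l with hA
  have hA0 : 0 ≤ A := by positivity
  set B : ℝ := Real.exp (2 ^ 2 / (4 * (q))) with hB
  have key : ∀ v' : ℂ, 2 * Real.pi * ‖v' - v‖ ≤ 1 →
      ‖fourierJet hq l v' - fourierJet hq l v‖ ≤ 2 ^ l * A * B * (2 * Real.pi * ‖v' - v‖) := by
    intro v' hv'
    set M := fourierPhase (v' - v) with hM
    have hMle : ‖M‖ ≤ 2 * Real.pi * ‖v' - v‖ := norm_fourierPhase_le _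
    have hWB : WBound q l (fun w => cexp (fourierPhase v w) * (cexp (M w) - 1))
        (2 ^ l * A * B * (2 * Real.pi * ‖v' - v‖)) := by
      intro n hn w
      have hsm1 : ContDiff ℝ n (fun w => cexp (fourierPhase v w)) :=
        contDiff_nat_of_top (subGaussian_cexp _).smooth n
      have hsm2 : ContDiff ℝ n (fun w => cexp (M w) - 1) :=
        (contDiff_nat_of_top (subGaussian_cexp _).smooth n).sub contDiff_const
      have h0 : 0 ≤ 2 * Real.pi * ‖v‖ := by positivity
      refine (norm_iteratedFDeriv_mul_le_two_pow hsm1 hsm2 w hA0 (fun m hm => ?_) (fun m hm =>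
        norm_iteratedDeriv_cexp_sub_one_le M (hMle.trans hv') m w)).trans ?_
      · calc _ ≤ _ := norm_iteratedFDeriv_cexp_fourierPhase_le v m w
          _ ≤ (1 + 2 * Real.pi * ‖v‖) ^ m := pow_le_pow_left₀ h0 (by linarith) m
          _ ≤ (1 + 2 * Real.pi * ‖v‖) ^ l := pow_le_pow_right₀ (by linarith) (hm.trans hn)
      · have h3 : (2 : ℝ) ^ n ≤ 2 ^ l := pow_le_pow_right₀ (by norm_num) hn
        have h4 : Real.exp (2 * ‖w‖) ≤ Real.exp (q * ‖w‖ ^ 2) * B := by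
          rw [hB, ← Real.exp_add]
          exact Real.exp_le_exp.2 (mul_le_sq_add hq)
        calc _ ≤ (2 : ℝ) ^ l * (A * ((2 * Real.pi * ‖v' - v‖) * (Real.exp (q * ‖w‖ ^ 2) * B))) := by
              gcongr
          _ = _ := by ring
    refine lp.norm_le_of_forall_le (by positivity) fun i => ?_
    have e : (fourierJet hq l v' - fourierJet hq l v) i =
        wJet q l (fun w => cexp (fourierPhase v w) * (cexp (M w) - 1)) i := by
      have m1 := (subGaussian_cexp (fourierPhase v)).memLambda hq l
      have m2 := (subGaussian_cexp (fourierPhase v')).memLambda hq l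
      have e1 : (fun w => cexp (fourierPhase v w) * (cexp (M w) - 1)) =
          (fun w => cexp (fourierPhase v' w)) + (-1 : ℂ) • fun w => cexp (fourierPhase v w) := by
        ext w
        have : fourierPhase v' w = fourierPhase v w + M w := by
          rw [hM, fourierPhase_sub]; simp
        simp only [Pi.add_apply, Pi.smul_apply, smul_eq_mul]
        rw [this, Complex.exp_add]; ring
      rw [e1, wJet_add m2 (m1.const_smul _), wJet_const_smul _ m1]
      exact (sub_eq_add_neg _ _).trans (congrArg _ (neg_one_smul ℂ _).symm)
    rw [e]
    exact norm_wJet_apply_le hWB i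
  rw [ContinuousAt, tendsto_iff_norm_sub_tendsto_zero]
  have hlim : Tendsto (fun v' : ℂ => 2 ^ l * A * B * (2 * Real.pi * ‖v' - v‖)) (nhds v)
      (nhds 0) := by
    have : Continuous (fun v' : ℂ => 2 ^ l * A * B * (2 * Real.pi * ‖v' - v‖)) := by fun_prop
    simpa using this.tendsto v
  have hsmall : ∀ᶠ v' in nhds v, 2 * Real.pi * ‖v' - v‖ < 1 := by
    have : Continuous (fun v' : ℂ => 2 * Real.pi * ‖v' - v‖) := by fun_prop
    exact (this.tendsto v).eventually_lt_const (by simp)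
  exact squeeze_zero' (Eventually.of_forall fun _ => norm_nonneg _)
    (hsmall.mono fun v' h => key v' h.le) hlim

theorem iteratedFDeriv_cexp_comp_apply (L : ℂ →L[ℝ] ℂ) (n : ℕ) (w : ℂ) (m : Fin n → ℂ) :
    iteratedFDeriv ℝ n (fun w => cexp (L w)) w m = cexp (L w) * ∏ i, L (m i) := by
  have hgR : ContDiff ℝ (⊤ : ℕ∞) cexp := Complex.contDiff_exp
  have h1 := L.iteratedFDeriv_comp_right (i := n) hgR w (by exact_mod_cast le_top)
  have h2 : ContDiffAt ℂ n cexp (L w) := Complex.contDiff_exp.contDiffAt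
  have h3 := h2.restrictScalars_iteratedFDeriv (𝕜 := ℝ)
  change iteratedFDeriv ℝ n (cexp ∘ L) w m = _
  rw [h1, ← h3]
  simp only [Function.comp_apply, ContinuousMultilinearMap.compContinuousLinearMap_apply,
    ContinuousMultilinearMap.coe_restrictScalars]
  rw [iteratedFDeriv_apply_eq_iteratedDeriv_mul_prod, iteratedDeriv_eq_iterate,
    Complex.iter_deriv_exp, smul_eq_mul, mul_comm]

open scoped FourierTransform

/-- A bounded functional on `Λ_{q,l}` annihilating all characters annihilates test functions. -/
theorem WFunctional.eq_zero_of_cexp {q : ℝ} (hq : 0 < q) {l : ℕ} {S : Dst}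
    (hS : WFunctional q l S) (h : ∀ L : ℂ →L[ℝ] ℂ, S (fun w => cexp (L w)) = 0) {φ : ℂ → ℂ}
    (hφ : ContDiff ℝ (⊤ : ℕ∞) φ) (hc : HasCompactSupport φ) : S φ = 0 := by
  obtain ⟨F, hF⟩ := hS.exists_extension
  set f : SchwartzMap ℂ ℂ := hc.toSchwartzMap hφ with hf
  set g : SchwartzMap ℂ ℂ := 𝓕⁻ f with hg
  have hfg : 𝓕 (g : ℂ → ℂ) = φ := by
    rw [← SchwartzMap.fourier_coe, hg, FourierTransform.fourier_fourierInv_eq]; rfl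
  have hint : Integrable (fun v : ℂ => g v • fourierJet hq l v) := by
    have hI : Integrable (fun v : ℂ => 2 ^ (l - 1) * (‖v‖ ^ 0 * ‖g v‖ +
        (2 * Real.pi) ^ l * (‖v‖ ^ l * ‖g v‖))) :=
      ((g.integrable_pow_mul volume 0).add
        ((g.integrable_pow_mul volume l).const_mul _)).const_mul _
    refine hI.mono' (g.continuous.smul (continuous_fourierJet hq l)).aestronglyMeasurable
      (Eventually.of_forall fun v => ?_)
    rw [norm_smul]
    have h1 := norm_fourierJet_le hq l v
    have h2 : (1 + 2 * Real.pi * ‖v‖) ^ l ≤ 2 ^ (l - 1) * (1 ^ l + (2 * Real.pi * ‖v‖) ^ l) :=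
      add_pow_le zero_le_one (by positivity) l
    calc _ ≤ ‖g v‖ * (2 ^ (l - 1) * (1 ^ l + (2 * Real.pi * ‖v‖) ^ l)) := by
          gcongr; exact h1.trans h2
      _ = _ := by rw [mul_pow, one_pow, pow_zero]; ring
  have hzero : F (∫ v : ℂ, g v • fourierJet hq l v) = 0 := by
    rw [← F.integral_comp_comm hint]
    refine integral_eq_zero_of_ae (Eventually.of_forall fun v => ?_)
    have : F (fourierJet hq l v) = 0 := by
      rw [hF _ ((subGaussian_cexp (fourierPhase v)).memLambda hq l) _ fun i => rfl, h]
    simp [this]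
  rw [← hzero]
  refine (hF φ ((SubGaussian.of_hasCompactSupport hφ hc).memLambda hq l) _ fun i => ?_).symm
  have : Fact ((1 : ENNReal) ≤ ⊤) := ⟨le_top⟩
  have e1 := (lp.evalCLM ℂ (JetFiber l) ⊤ i).integral_comp_comm hint
  have e2 : (lp.evalCLM ℂ (JetFiber l) ⊤ i) (∫ v : ℂ, g v • fourierJet hq l v) =
    (∫ v : ℂ, g v • fourierJet hq l v : JetSpace l) i := rfl
  rw [← e2, ← e1, wJet, ← hfg, Real.iteratedFDeriv_fourier (N := ⊤)
    (fun n _ => g.integrable_pow_mul volume n) g.continuous.aestronglyMeasurable le_top,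
    Real.fourier_eq, ← integral_smul]
  refine integral_congr_ae (Eventually.of_forall fun v => ?_)
  ext m
  change (g v • (Real.exp (-q * ‖i.2‖ ^ 2) •
    iteratedFDeriv ℝ i.1 (fun w => cexp (fourierPhase v w)) i.2)) m = _
  rw [_root_.smul_apply, _root_.smul_apply,
    iteratedFDeriv_cexp_comp_apply (fourierPhase v)]
  simp only [_root_.smul_apply, VectorFourier.fourierPowSMulRight_apply,
    Circle.smul_def, Real.fourierChar_apply, fourierPhase_apply,
    smul_eq_mul, Complex.real_smul, Finset.prod_mul_distrib,
    Finset.prod_const, Finset.card_univ, Fintype.card_fin]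
  push_cast
  have : cexp (-(2 * Real.pi * I) * ((inner ℝ v i.2 : ℝ) : ℂ)) =
    cexp (2 * Real.pi * -((inner ℝ v i.2 : ℝ) : ℂ) * I) := by congr 1; ring
  have e3 : ∀ i, innerSL ℝ v (m i) = inner ℝ v (m i) := fun _ => rfl
  simp only [this, e3]
  ring

/-- Vanishing of all derivatives up to order `l` at a point. -/
def FlatAt (l : ℕ) (z : ℂ) (ψ : ℂ → ℂ) : Prop :=
  ∀ n ≤ l, iteratedFDeriv ℝ n ψ z = 0

theorem FlatAt.mul_left {l : ℕ} {z : ℂ} {u ψ : ℂ → ℂ} (h : FlatAt l z ψ)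
    (hu : ContDiff ℝ (l : ℕ∞) u) (hψ : ContDiff ℝ (l : ℕ∞) ψ) :
    FlatAt l z (fun w => u w * ψ w) := by
  intro n hn
  have hu' : ContDiff ℝ n u := hu.of_le (by exact_mod_cast hn)
  have hψ' : ContDiff ℝ n ψ := hψ.of_le (by exact_mod_cast hn)
  have := norm_iteratedFDeriv_mul_le hu' hψ' z le_rfl
  refine norm_le_zero_iff.1 (this.trans (Finset.sum_nonpos fun i _ => ?_))
  rw [h (n - i) ((Nat.sub_le _ _).trans hn), norm_zero, mul_zero]

theorem FlatAt.of_eventuallyEq_zero {l : ℕ} {z : ℂ} {ψ : ℂ → ℂ} (h : ψ =ᶠ[nhds z] 0) :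
    FlatAt l z ψ := by
  intro n _
  rw [(h.iteratedFDeriv ℝ n).eq_of_nhds]
  exact congrFun iteratedFDeriv_fun_zero z

/-- A smooth cutoff function with scale-invariant derivative bounds. -/
theorem exists_cutoff (l : ℕ) : ∃ χ : ℂ → ℂ, ContDiff ℝ (⊤ : ℕ∞) χ ∧
    (∀ w, ‖w‖ ≤ 1 → χ w = 1) ∧ (∀ w, 2 ≤ ‖w‖ → χ w = 0) ∧
    ∃ C : ℝ, 0 ≤ C ∧ ∀ n ≤ l, ∀ (t : ℝ) (z w : ℂ),
      ‖iteratedFDeriv ℝ n (fun w => χ (t • (w - z))) w‖ ≤ C * |t| ^ n := by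
  let b : ContDiffBump (0 : ℂ) := ⟨1, 2, one_pos, one_lt_two⟩
  have hsm : ContDiff ℝ (⊤ : ℕ∞) (fun w => (b w : ℂ)) := ofRealCLM.contDiff.comp b.contDiff
  have hzero : ∀ w, 2 ≤ ‖w‖ → (b w : ℂ) = 0 := fun w hw => by
    rw [b.zero_of_le_dist (by simpa using hw), ofReal_zero]
  have hc : HasCompactSupport (fun w => (b w : ℂ)) :=
    b.hasCompactSupport.comp_left (g := ((↑) : ℝ → ℂ)) ofReal_zero
  refine ⟨_, hsm, fun w hw => ?_, hzero, ?_⟩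
  · rw [b.one_of_mem_closedBall (by simpa using hw), ofReal_one]
  have : ∀ n : ℕ, ∃ C, ∀ z, ‖iteratedFDeriv ℝ n (fun w => (b w : ℂ)) z‖ ≤ C := fun n =>
    (hsm.continuous_iteratedFDeriv (by exact_mod_cast le_top)).bounded_above_of_compact_support
      (hc.iteratedFDeriv n)
  choose C hC using this
  have hC0 : ∀ n, 0 ≤ C n := fun n => (norm_nonneg _).trans (hC n 0)
  refine ⟨∑ n ∈ Finset.range (l + 1), C n, Finset.sum_nonneg fun n _ => hC0 n,
    fun n hn t z w => ?_⟩
  have e := iteratedFDeriv_comp_add_right (𝕜 := ℝ) (f := fun w => (b (t • w) : ℂ)) n (-z) w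
  simp only [← sub_eq_add_neg] at e
  have e' := iteratedFDeriv_comp_const_smul (i := n) t (contDiff_nat_of_top hsm n)
  rw [e, e', norm_smul, norm_pow, Real.norm_eq_abs, mul_comm]
  gcongr
  exact (hC n _).trans (Finset.single_le_sum (fun n _ => hC0 n)
    (Finset.mem_range.2 (Nat.lt_succ_iff.2 hn)))

theorem WFunctional.eq_zero_of_approx {q : ℝ} {l : ℕ} {S : Dst} (hS : WFunctional q l S)
    {ψ : ℂ → ℂ} (hψ : MemLambda q l ψ)
    (h : ∀ δ > 0, ∃ φ, MemLambda q l φ ∧ S φ = 0 ∧ WBound q l (ψ - φ) δ) : S ψ = 0 := by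
  obtain ⟨C, hC0, hC⟩ := hS.bound
  refine norm_le_zero_iff.1 (le_of_forall_pos_le_add fun δ hδ => ?_)
  obtain ⟨φ, hφ, h0, hb⟩ := h (δ / (C + 1)) (by positivity)
  have hsub : MemLambda q l (ψ - φ) := by
    have := hψ.add (hφ.const_smul (-1))
    rwa [neg_one_smul, ← sub_eq_add_neg] at this
  have e : S ψ = S (ψ - φ) := by
    conv_lhs => rw [← sub_add_cancel ψ φ]
    rw [hS.map_add _ _ hsub hφ, h0, add_zero]
  rw [e, zero_add]
  refine (hC _ _ hsub hb).trans ?_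
  rw [← mul_div_assoc, div_le_iff₀ (by positivity)]
  nlinarith

/-- Taylor estimate at a point where a function is flat. -/
theorem FlatAt.exists_norm_le {l : ℕ} {z : ℂ} {φ : ℂ → ℂ} (h : FlatAt l z φ)
    (hφ : ContDiff ℝ (⊤ : ℕ∞) φ) (hc : HasCompactSupport φ) :
    ∃ C : ℝ, 0 ≤ C ∧ ∀ m ≤ l, ∀ w,
      ‖iteratedFDeriv ℝ m φ w‖ ≤ C * ‖w - z‖ ^ (l + 1 - m) := by
  obtain ⟨C, hC⟩ := (hφ.continuous_iteratedFDeriv (m := (l + 1 : ℕ))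
    (by exact_mod_cast le_top)).bounded_above_of_compact_support (hc.iteratedFDeriv (l + 1))
  have hC0 : 0 ≤ C := (norm_nonneg _).trans (hC 0)
  have key : ∀ k ≤ l + 1, ∀ w, ‖iteratedFDeriv ℝ (l + 1 - k) φ w‖ ≤ C * ‖w - z‖ ^ k := by
    intro k
    induction k with
    | zero => intro _ w; simpa using hC w
    | succ k ih =>
      intro hk w
      have e : l + 1 - k = (l + 1 - (k + 1)) + 1 := by omega
      have hd : Differentiable ℝ (iteratedFDeriv ℝ (l + 1 - (k + 1)) φ) :=
        hφ.differentiable_iteratedFDeriv (WithTop.coe_lt_coe.2 (ENat.natCast_lt_top _))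
      have := (convex_closedBall z ‖w - z‖).norm_image_sub_le_of_norm_fderiv_le (𝕜 := ℝ)
        (f := iteratedFDeriv ℝ (l + 1 - (k + 1)) φ) (C := C * ‖w - z‖ ^ k) (x := z) (y := w)
        (fun x _ => hd x) (fun x hx => by
          rw [norm_fderiv_iteratedFDeriv, ← e]
          refine (ih (by omega) x).trans ?_
          gcongr
          simpa [dist_eq_norm] using hx)
        (mem_closedBall_self (norm_nonneg _)) (by simp [dist_eq_norm])
      rw [h _ (by omega), sub_zero] at this
      rwa [pow_succ, ← mul_assoc]
  refine ⟨C, hC0, fun m hm w => ?_⟩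
  have := key (l + 1 - m) (by omega) w
  rwa [show l + 1 - (l + 1 - m) = m by omega] at this

/-- Vanishing on test functions that are flat on `F` and vanish near `G`. -/
def KillsFlat (l : ℕ) (S : Dst) (F G : Finset ℂ) : Prop :=
  ∀ φ : ℂ → ℂ, ContDiff ℝ (⊤ : ℕ∞) φ → HasCompactSupport φ → (∀ z ∈ F, FlatAt l z φ) →
    (∀ z ∈ G, φ =ᶠ[nhds z] 0) → S φ = 0

theorem WFunctional.killsFlat_insert {q : ℝ} (hq : 0 < q) {l : ℕ} {S : Dst}
    (hS : WFunctional q l S) {z : ℂ} {F G : Finset ℂ} (h : KillsFlat l S F (insert z G)) :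
    KillsFlat l S (insert z F) G := by
  intro φ hφ hc hF hG
  obtain ⟨χ, hχ, h1, h0, A, hA0, hA⟩ := exists_cutoff l
  obtain ⟨B, hB0, hB⟩ := (hF z (Finset.mem_insert_self _ _)).exists_norm_le hφ hc
  refine hS.eq_zero_of_approx ((SubGaussian.of_hasCompactSupport hφ hc).memLambda hq l)
    fun δ hδ => ?_
  set D : ℝ := 2 ^ l * (A * (B * 2 ^ (l + 1))) with hD
  have hD0 : 0 ≤ D := by positivity
  obtain ⟨ε, hε0, hε1, hεδ⟩ : ∃ ε : ℝ, 0 < ε ∧ ε ≤ 1 ∧ D * ε ≤ δ := by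
    refine ⟨min 1 (δ / (D + 1)), by positivity, min_le_left _ _, ?_⟩
    calc D * min 1 (δ / (D + 1)) ≤ D * (δ / (D + 1)) := by gcongr; exact min_le_right _ _
      _ ≤ δ := by rw [← mul_div_assoc, div_le_iff₀ (by positivity)]; nlinarith
  set η : ℂ → ℂ := fun w => χ (ε⁻¹ • (w - z)) with hη
  have hηs : ContDiff ℝ (⊤ : ℕ∞) η := hχ.comp (by fun_prop)
  have hηs' : ContDiff ℝ (⊤ : ℕ∞) (fun w => 1 - η w) := contDiff_const.sub hηs
  set φ' : ℂ → ℂ := fun w => (1 - η w) * φ w with hφ'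
  have hφ's : ContDiff ℝ (⊤ : ℕ∞) φ' := hηs'.mul hφ
  have hφ'c : HasCompactSupport φ' := hc.mul_left
  refine ⟨φ', (SubGaussian.of_hasCompactSupport hφ's hφ'c).memLambda hq l,
    h φ' hφ's hφ'c (fun x hx => ?_) (fun x hx => ?_), ?_⟩
  · exact (hF x (Finset.mem_insert_of_mem hx)).mul_left (contDiff_nat_of_top hηs' l)
      (contDiff_nat_of_top hφ l)
  · rcases Finset.mem_insert.1 hx with rfl | hx
    · filter_upwards [ball_mem_nhds x hε0] with w hw
      have : ‖ε⁻¹ • (w - x)‖ ≤ 1 := by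
        rw [norm_smul, norm_inv, Real.norm_of_nonneg hε0.le, inv_mul_le_iff₀ hε0, mul_one,
          ← dist_eq_norm]
        exact (mem_ball.1 hw).le
      change (1 - χ (ε⁻¹ • (w - x))) * φ w = 0
      rw [h1 _ this, sub_self, zero_mul]
    · filter_upwards [hG x hx] with w hw
      simp [hφ', hw]
  · have e : φ - φ' = fun w => η w * φ w := by
      funext w; simp only [Pi.sub_apply, hφ']; ring
    rw [e]
    intro n hn w
    have hexp : 1 ≤ Real.exp (q * ‖w‖ ^ 2) := Real.one_le_exp (by positivity)
    refine le_trans ?_ (le_mul_of_one_le_right hδ.le hexp)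
    rcases lt_or_ge (2 * ε) ‖w - z‖ with hw | hw
    · have : (fun w => η w * φ w) =ᶠ[nhds w] 0 := by
        have : ∀ᶠ x in nhds w, 2 * ε < ‖x - z‖ :=
          (continuous_norm.comp (continuous_id.sub continuous_const)).continuousAt.eventually_const_lt
            hw
        filter_upwards [this] with x hx
        have : 2 ≤ ‖ε⁻¹ • (x - z)‖ := by
          rw [norm_smul, norm_inv, Real.norm_of_nonneg hε0.le, ← div_eq_inv_mul,
            le_div_iff₀ hε0]
          exact hx.le
        change χ (ε⁻¹ • (x - z)) * φ x = 0
        rw [h0 _ this, zero_mul]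
      rw [FlatAt.of_eventuallyEq_zero this n le_rfl, norm_zero]
      exact hδ.le
    · refine (norm_iteratedFDeriv_mul_le (contDiff_nat_of_top hηs n) (contDiff_nat_of_top hφ n) w
        le_rfl).trans (le_trans ?_ hεδ)
      calc _ ≤ ∑ i ∈ Finset.range (n + 1), (n.choose i : ℝ) * (A * (B * 2 ^ (l + 1)) * ε) := by
            refine Finset.sum_le_sum fun i hi => ?_
            have hi' : i ≤ n := Nat.lt_succ_iff.1 (Finset.mem_range.1 hi)
            have t1 := hA i (hi'.trans hn) ε⁻¹ z w
            have t2 := hB (n - i) ((Nat.sub_le _ _).trans hn) w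
            rw [abs_of_pos (inv_pos.2 hε0)] at t1
            have e1 : l + 1 - (n - i) = i + (l - n) + 1 := by omega
            have t3 : ‖w - z‖ ^ (l + 1 - (n - i)) ≤ 2 ^ (l + 1) * (ε ^ i * ε) := by
              calc ‖w - z‖ ^ (l + 1 - (n - i)) ≤ (2 * ε) ^ (l + 1 - (n - i)) := by gcongr
                _ = 2 ^ (l + 1 - (n - i)) * (ε ^ i * ε * ε ^ (l - n)) := by
                  rw [mul_pow, e1]; ring
                _ ≤ 2 ^ (l + 1) * (ε ^ i * ε * 1) := by
                  gcongr
                  · norm_num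
                  · omega
                  · exact pow_le_one₀ hε0.le hε1
                _ = _ := by ring
            refine (mul_assoc _ _ _).trans_le (mul_le_mul_of_nonneg_left ?_ (Nat.cast_nonneg _))
            calc _ ≤ (A * ε⁻¹ ^ i) * (B * (2 ^ (l + 1) * (ε ^ i * ε))) := by
                  gcongr
                  exact t2.trans (by gcongr)
              _ = A * (B * 2 ^ (l + 1)) * ε * (ε⁻¹ ^ i * ε ^ i) := by ring
              _ = _ := by rw [← mul_pow, inv_mul_cancel₀ hε0.ne', one_pow, mul_one]
        _ = 2 ^ n * (A * (B * 2 ^ (l + 1)) * ε) := by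
            rw [← Finset.sum_mul]
            congr 1
            exact_mod_cast Nat.sum_range_choose n
        _ ≤ 2 ^ l * (A * (B * 2 ^ (l + 1)) * ε) := by
            gcongr
            norm_num
        _ = D * ε := by rw [hD]; ring

theorem WFunctional.killsFlat {q : ℝ} (hq : 0 < q) {l : ℕ} {S : Dst}
    (hS : WFunctional q l S) (F : Finset ℂ) : ∀ G : Finset ℂ,
    KillsFlat l S ∅ (F ∪ G) → KillsFlat l S F G := by
  induction F using Finset.induction_on with
  | empty => intro G h; simpa using h
  | insert z F _ ih =>
    intro G h
    refine hS.killsFlat_insert hq (ih _ ?_)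
    rwa [Finset.union_insert, ← Finset.insert_union]

theorem WFunctional.eq_zero_of_forall_hasCompactSupport {q : ℝ} (hq : 0 < q) {l : ℕ} {S : Dst}
    (hS : WFunctional q l S) {F : Finset ℂ} (h : KillsFlat l S F ∅) {ψ : ℂ → ℂ}
    (hψ : ContDiff ℝ (⊤ : ℕ∞) ψ) (hψ' : MemLambda q l ψ) (hF : ∀ z ∈ F, FlatAt l z ψ) :
    S ψ = 0 := by
  obtain ⟨χ, hχ, h1, h0, A, hA0, hA⟩ := exists_cutoff l
  refine hS.eq_zero_of_approx hψ' fun δ hδ => ?_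
  set D : ℝ := 2 ^ l * (1 + A) with hD
  have hD0 : 0 < D := by positivity
  have hev : ∀ᶠ w in cocompact ℂ, ∀ n ∈ Finset.range (l + 1),
      ‖iteratedFDeriv ℝ n ψ w‖ * Real.exp (-q * ‖w‖ ^ 2) < δ / D := by
    rw [Filter.eventually_all_finset]
    intro n hn
    exact (hψ'.2 n (Nat.lt_succ_iff.1 (Finset.mem_range.1 hn))).eventually_lt_const (by positivity)
  obtain ⟨R, hR1, hR⟩ : ∃ R : ℝ, 1 ≤ R ∧ ∀ w : ℂ, R ≤ ‖w‖ → ∀ n ∈ Finset.range (l + 1),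
      ‖iteratedFDeriv ℝ n ψ w‖ * Real.exp (-q * ‖w‖ ^ 2) < δ / D := by
    obtain ⟨R, hR⟩ := (hasBasis_cocompact.eventually_iff.1 hev).imp fun K hK => hK
    obtain ⟨r, hr⟩ := hR.1.isBounded.subset_closedBall 0
    refine ⟨max 1 (r + 1), le_max_left _ _, fun w hw => hR.2 fun hwR => ?_⟩
    have := hr hwR
    rw [mem_closedBall, dist_zero_right] at this
    linarith [le_max_right 1 (r + 1)]
  have hR0 : 0 < R := by linarith
  set η : ℂ → ℂ := fun w => χ (R⁻¹ • (w - 0)) with hη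
  have hηs : ContDiff ℝ (⊤ : ℕ∞) η := hχ.comp (by fun_prop)
  have hηs' : ContDiff ℝ (⊤ : ℕ∞) (fun w => 1 - η w) := contDiff_const.sub hηs
  set φ : ℂ → ℂ := fun w => η w * ψ w with hφ
  have hφs : ContDiff ℝ (⊤ : ℕ∞) φ := hηs.mul hψ
  have hφc : HasCompactSupport φ := by
    refine HasCompactSupport.intro (isCompact_closedBall (0 : ℂ) (2 * R)) fun w hw => ?_
    have : 2 ≤ ‖R⁻¹ • (w - 0)‖ := by
      rw [sub_zero, norm_smul, norm_inv, Real.norm_of_nonneg hR0.le, ← div_eq_inv_mul,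
        le_div_iff₀ hR0]
      rw [mem_closedBall, dist_zero_right, not_le] at hw
      exact hw.le
    change χ (R⁻¹ • (w - 0)) * ψ w = 0
    rw [h0 _ this, zero_mul]
  refine ⟨φ, (SubGaussian.of_hasCompactSupport hφs hφc).memLambda hq l,
    h φ hφs hφc (fun z hz => (hF z hz).mul_left (contDiff_nat_of_top hηs l)
      (contDiff_nat_of_top hψ l)) (by simp), ?_⟩
  have e : ψ - φ = fun w => (1 - η w) * ψ w := by
    funext w; simp only [Pi.sub_apply, hφ]; ring
  rw [e]
  intro n hn w
  rcases lt_or_ge ‖w‖ R with hw | hw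
  · have : (fun w => (1 - η w) * ψ w) =ᶠ[nhds w] 0 := by
      filter_upwards [continuous_norm.continuousAt.eventually_lt_const hw] with x hx
      have : ‖R⁻¹ • (x - 0)‖ ≤ 1 := by
        rw [sub_zero, norm_smul, norm_inv, Real.norm_of_nonneg hR0.le, inv_mul_le_iff₀ hR0,
          mul_one]
        exact hx.le
      change (1 - χ (R⁻¹ • (x - 0))) * ψ x = 0
      rw [h1 _ this, sub_self, zero_mul]
    rw [FlatAt.of_eventuallyEq_zero this n le_rfl, norm_zero]
    positivity
  · have hb : ∀ m ≤ n, ‖iteratedFDeriv ℝ m (fun w => 1 - η w) w‖ ≤ 1 + A := by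
      intro m hm
      have c1 : ContDiffAt ℝ m (fun _ : ℂ => (1 : ℂ)) w := contDiffAt_const
      have := iteratedFDeriv_sub_apply c1 (contDiff_nat_of_top hηs m).contDiffAt
      have e2 : ((fun _ : ℂ => (1 : ℂ)) - η) = fun w => 1 - η w := rfl
      rw [e2] at this
      rw [this]
      refine (norm_sub_le _ _).trans (add_le_add ?_ ?_)
      · rcases Nat.eq_zero_or_pos m with rfl | hm
        · simp
        · rw [iteratedFDeriv_const_of_ne hm.ne']; simp
      · refine (hA m (hm.trans hn) R⁻¹ 0 w).trans (mul_le_of_le_one_right hA0 ?_)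
        rw [abs_of_pos (inv_pos.2 hR0)]
        exact pow_le_one₀ (by positivity) (inv_le_one_of_one_le₀ hR1)
    have hψb : ∀ m ≤ n, ‖iteratedFDeriv ℝ m ψ w‖ ≤ δ / D * Real.exp (q * ‖w‖ ^ 2) := by
      intro m hm
      have := (hR w hw m (Finset.mem_range.2 (by omega))).le
      rwa [neg_mul, Real.exp_neg, ← div_eq_mul_inv, div_le_iff₀ (Real.exp_pos _)] at this
    refine (norm_iteratedFDeriv_mul_le_two_pow (contDiff_nat_of_top hηs' n)
      (contDiff_nat_of_top hψ n) w (by positivity) hb hψb).trans ?_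
    calc _ ≤ (2 : ℝ) ^ l * ((1 + A) * (δ / D * Real.exp (q * ‖w‖ ^ 2))) := by
          gcongr; norm_num
      _ = D * (δ / D) * Real.exp (q * ‖w‖ ^ 2) := by rw [hD]; ring
      _ = δ * Real.exp (q * ‖w‖ ^ 2) := by rw [mul_div_cancel₀ _ hD0.ne']

/-- A functional annihilated by multiplication with a polynomial only depends on the jets at the
roots of the polynomial. -/
theorem WFunctional.eq_zero_of_flatAt {q : ℝ} (hq : 0 < q) {l : ℕ} {S : Dst}
    (hS : WFunctional q l S) {p : Polynomial ℂ} (hp : p ≠ 0)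
    (hps : SubGaussian fun w => p.eval w)
    (h : ∀ L : ℂ →L[ℝ] ℂ, S (fun w => p.eval w * cexp (L w)) = 0) {ψ : ℂ → ℂ}
    (hψ : ContDiff ℝ (⊤ : ℕ∞) ψ) (hψ' : MemLambda q l ψ)
    (hF : ∀ z, p.IsRoot z → FlatAt l z ψ) : S ψ = 0 := by
  classical
  refine hS.eq_zero_of_forall_hasCompactSupport hq (F := p.roots.toFinset)
    (hS.killsFlat hq _ ∅ ?_) hψ hψ' fun z hz => hF z (by simpa [hp] using hz)
  intro φ hφ hc _ hG
  rw [Finset.union_empty] at hG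
  have hv : ContDiff ℝ (⊤ : ℕ∞) (fun w => φ w / p.eval w) := by
    rw [contDiff_iff_contDiffAt]
    intro z
    by_cases hz : p.eval z = 0
    · have : (fun w => φ w / p.eval w) =ᶠ[nhds z] fun _ => 0 := by
        filter_upwards [hG z (by simpa [hp] using hz)] with w hw
        simp [hw]
      exact contDiffAt_const.congr_of_eventuallyEq this
    · simp_rw [div_eq_mul_inv]
      exact hφ.contDiffAt.mul (hps.smooth.contDiffAt.inv hz)
  have hvc : HasCompactSupport (fun w => φ w / p.eval w) := by
    simp_rw [div_eq_mul_inv]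
    exact hc.mul_right
  have := (hS.mul_left hq hps).eq_zero_of_cexp (half_pos hq) h hv hvc
  rw [← this]
  congr 1
  funext w
  by_cases hw : p.eval w = 0
  · have := (hG w (by simpa [hp] using hw)).eq_of_nhds
    simp [this, hw]
  · rw [mul_div_cancel₀ _ hw]

theorem contDiff_pd1 {ψ : ℂ → ℂ} (h : ContDiff ℝ (⊤ : ℕ∞) ψ) : ContDiff ℝ (⊤ : ℕ∞) (pd1 ψ) :=
  (h.fderiv_right (m := (⊤ : ℕ∞)) (by simp)).clm_apply contDiff_const

theorem contDiff_pd2 {ψ : ℂ → ℂ} (h : ContDiff ℝ (⊤ : ℕ∞) ψ) : ContDiff ℝ (⊤ : ℕ∞) (pd2 ψ) :=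
  (h.fderiv_right (m := (⊤ : ℕ∞)) (by simp)).clm_apply contDiff_const

theorem contDiff_iterate_pd2 {ψ : ℂ → ℂ} (h : ContDiff ℝ (⊤ : ℕ∞) ψ) (b : ℕ) :
    ContDiff ℝ (⊤ : ℕ∞) (pd2^[b] ψ) := by
  induction b generalizing ψ with
  | zero => exact h
  | succ b ih => exact ih (contDiff_pd2 h)

theorem contDiff_partialD {ψ : ℂ → ℂ} (h : ContDiff ℝ (⊤ : ℕ∞) ψ) (a b : ℕ) :
    ContDiff ℝ (⊤ : ℕ∞) (partialD a b ψ) := by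
  have : ∀ φ, ContDiff ℝ (⊤ : ℕ∞) φ → ContDiff ℝ (⊤ : ℕ∞) (pd1^[a] φ) := by
    induction a with
    | zero => exact fun φ h => h
    | succ a ih => exact fun φ h => ih _ (contDiff_pd1 h)
  exact this _ (contDiff_iterate_pd2 h b)

theorem pd2_pd1_comm {ψ : ℂ → ℂ} (h : ContDiff ℝ (⊤ : ℕ∞) ψ) : pd2 (pd1 ψ) = pd1 (pd2 ψ) := by
  funext z
  have hd : Differentiable ℝ (fderiv ℝ ψ) :=
    (h.fderiv_right (m := (⊤ : ℕ∞)) (by simp)).differentiable (by simp)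
  have hs := second_derivative_symmetric (f := ψ) (f' := fderiv ℝ ψ) (x := z)
    (fun y => (h.differentiable (by simp) y).hasFDerivAt) (hd z).hasFDerivAt 1 Complex.I
  have key : ∀ v w : ℂ, fderiv ℝ (fun z => fderiv ℝ ψ z v) z w = fderiv ℝ (fderiv ℝ ψ) z w v := by
    intro v w
    rw [fderiv_clm_apply (hd z) (differentiableAt_const v)]
    simp
  change fderiv ℝ (fun z => fderiv ℝ ψ z 1) z Complex.I
    = fderiv ℝ (fun z => fderiv ℝ ψ z Complex.I) z 1
  rw [key, key, hs]

theorem iterate_pd2_pd1_comm {ψ : ℂ → ℂ} (h : ContDiff ℝ (⊤ : ℕ∞) ψ) (b : ℕ) :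
    pd2^[b] (pd1 ψ) = pd1 (pd2^[b] ψ) := by
  induction b generalizing ψ with
  | zero => rfl
  | succ b ih =>
    rw [Function.iterate_succ_apply, pd2_pd1_comm h, ih (contDiff_pd2 h),
      Function.iterate_succ_apply]

theorem fderiv_eq_pd {ψ : ℂ → ℂ} :
    fderiv ℝ ψ = fun w => ContinuousLinearMap.smulRightL ℝ ℂ ℂ reCLM (pd1 ψ w) +
      ContinuousLinearMap.smulRightL ℝ ℂ ℂ imCLM (pd2 ψ w) := by
  funext w
  ext v
  have hv : v = v.re • (1 : ℂ) + v.im • Complex.I := by simp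
  conv_lhs => rw [hv, map_add, map_smul, map_smul]
  simp [pd1, pd2]

theorem iteratedFDeriv_eq_zero_of_partialD {n : ℕ} {ψ : ℂ → ℂ} (h : ContDiff ℝ (⊤ : ℕ∞) ψ)
    {z : ℂ} (h0 : ∀ a b, a + b = n → partialD a b ψ z = 0) : iteratedFDeriv ℝ n ψ z = 0 := by
  induction n generalizing ψ with
  | zero =>
    ext m
    simpa [partialD] using h0 0 0 rfl
  | succ n ih =>
    have h1 : iteratedFDeriv ℝ n (pd1 ψ) z = 0 := ih (contDiff_pd1 h) fun a b hab => by
      rw [partialD, iterate_pd2_pd1_comm h]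
      exact h0 (a + 1) b (by omega)
    have h2 : iteratedFDeriv ℝ n (pd2 ψ) z = 0 := ih (contDiff_pd2 h) fun a b hab =>
      h0 a (b + 1) (by omega)
    rw [← norm_eq_zero, ← norm_iteratedFDeriv_fderiv, fderiv_eq_pd, norm_eq_zero]
    have key : ∀ (Λ : ℂ →L[ℝ] ℂ →L[ℝ] ℂ) {φ : ℂ → ℂ}, ContDiff ℝ (⊤ : ℕ∞) φ →
        iteratedFDeriv ℝ n φ z = 0 → iteratedFDeriv ℝ n (fun w => Λ (φ w)) z = 0 := by
      intro Λ φ hφ hz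
      have := Λ.iteratedFDeriv_comp_left (contDiff_nat_of_top hφ n).contDiffAt (x := z) le_rfl
      rw [Function.comp_def] at this
      rw [this, hz]
      ext
      simp
    have hc1 := (ContinuousLinearMap.smulRightL ℝ ℂ ℂ reCLM).contDiff.comp
      (contDiff_nat_of_top (contDiff_pd1 h) n)
    have hc2 := (ContinuousLinearMap.smulRightL ℝ ℂ ℂ imCLM).contDiff.comp
      (contDiff_nat_of_top (contDiff_pd2 h) n)
    have := iteratedFDeriv_add_apply hc1.contDiffAt hc2.contDiffAt (x := z)
    refine this.trans ?_
    rw [Function.comp_def, Function.comp_def, key _ (contDiff_pd1 h) h1,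
      key _ (contDiff_pd2 h) h2, add_zero]

theorem pd1_add {ψ φ : ℂ → ℂ} (hψ : ContDiff ℝ (⊤ : ℕ∞) ψ) (hφ : ContDiff ℝ (⊤ : ℕ∞) φ) :
    pd1 (ψ + φ) = pd1 ψ + pd1 φ := by
  funext z
  simp [pd1, fderiv_add (hψ.differentiable (by simp) z) (hφ.differentiable (by simp) z)]

theorem pd2_add {ψ φ : ℂ → ℂ} (hψ : ContDiff ℝ (⊤ : ℕ∞) ψ) (hφ : ContDiff ℝ (⊤ : ℕ∞) φ) :
    pd2 (ψ + φ) = pd2 ψ + pd2 φ := by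
  funext z
  simp [pd2, fderiv_add (hψ.differentiable (by simp) z) (hφ.differentiable (by simp) z)]

theorem pd1_const_smul (c : ℂ) {ψ : ℂ → ℂ} (hψ : ContDiff ℝ (⊤ : ℕ∞) ψ) :
    pd1 (c • ψ) = c • pd1 ψ := by
  funext z
  simp [pd1, fderiv_const_smul (hψ.differentiable (by simp) z) c]

theorem pd2_const_smul (c : ℂ) {ψ : ℂ → ℂ} (hψ : ContDiff ℝ (⊤ : ℕ∞) ψ) :
    pd2 (c • ψ) = c • pd2 ψ := by
  funext z
  simp [pd2, fderiv_const_smul (hψ.differentiable (by simp) z) c]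

theorem partialD_add {ψ φ : ℂ → ℂ} (hψ : ContDiff ℝ (⊤ : ℕ∞) ψ) (hφ : ContDiff ℝ (⊤ : ℕ∞) φ)
    (a b : ℕ) : partialD a b (ψ + φ) = partialD a b ψ + partialD a b φ := by
  have h2 : pd2^[b] (ψ + φ) = pd2^[b] ψ + pd2^[b] φ := by
    induction b generalizing ψ φ with
    | zero => rfl
    | succ b ih =>
      simp only [Function.iterate_succ_apply]
      rw [pd2_add hψ hφ, ih (contDiff_pd2 hψ) (contDiff_pd2 hφ)]
  rw [partialD, h2, partialD, partialD]
  induction a with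
  | zero => rfl
  | succ a ih =>
    simp only [Function.iterate_succ_apply']
    rw [ih]
    exact pd1_add (contDiff_partialD hψ a b) (contDiff_partialD hφ a b)

theorem partialD_const_smul (c : ℂ) {ψ : ℂ → ℂ} (hψ : ContDiff ℝ (⊤ : ℕ∞) ψ)
    (a b : ℕ) : partialD a b (c • ψ) = c • partialD a b ψ := by
  have h2 : pd2^[b] (c • ψ) = c • pd2^[b] ψ := by
    induction b generalizing ψ with
    | zero => rfl
    | succ b ih =>
      simp only [Function.iterate_succ_apply]
      rw [pd2_const_smul c hψ, ih (contDiff_pd2 hψ)]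
  rw [partialD, h2, partialD]
  induction a with
  | zero => rfl
  | succ a ih =>
    simp only [Function.iterate_succ_apply']
    rw [ih]
    exact pd1_const_smul c (contDiff_partialD hψ a b)

theorem MemDq.memLambda {q : ℝ} {ψ : ℂ → ℂ} (h : MemDq q ψ) (l : ℕ) : MemLambda q l ψ :=
  ⟨contDiff_nat_of_top h.1 l, fun n _ => h.2 n⟩

theorem MemDq.of_forall_memLambda {q : ℝ} {ψ : ℂ → ℂ} (hc : ContDiff ℝ (⊤ : ℕ∞) ψ)
    (h : ∀ l, MemLambda q l ψ) : MemDq q ψ :=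
  ⟨hc, fun n => (h n).2 n le_rfl⟩

/-- The complex vector space of functions satisfying `MemDq q`. -/
def dqSubmodule (q : ℝ) : Submodule ℂ (ℂ → ℂ) where
  carrier := {ψ | MemDq q ψ}
  add_mem' h1 h2 := .of_forall_memLambda (h1.1.add h2.1) fun l => (h1.memLambda l).add (h2.memLambda l)
  zero_mem' := by
    refine ⟨contDiff_const, fun n => ?_⟩
    have : iteratedFDeriv ℝ n (0 : ℂ → ℂ) = 0 := iteratedFDeriv_fun_zero
    simp [this]
  smul_mem' c _ h := .of_forall_memLambda (contDiff_const.smul h.1) fun l => (h.memLambda l).const_smul c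

/-- A functional that kills the functions flat at finitely many points is a combination of
derivatives of Dirac masses at these points. -/
theorem WFunctional.exists_eq_sum_partialD {q : ℝ} {l : ℕ} {T : Dst} (hT : WFunctional q l T)
    {ι : Type*} [Fintype ι] (pts : ι → ℂ)
    (h : ∀ ψ, MemDq q ψ → (∀ j, FlatAt l (pts j) ψ) → T ψ = 0) :
    ∃ c : ι → ℕ → ℕ → ℂ, ∀ ψ : ℂ → ℂ, MemDq q ψ →
      T ψ = ∑ j : ι, ∑ a ∈ Finset.range (l + 1), ∑ b ∈ Finset.range (l + 1),
        c j a b * partialD a b ψ (pts j) := by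
  classical
  let K : dqSubmodule q →ₗ[ℂ] ℂ :=
    { toFun := fun ψ => T ψ
      map_add' := fun ψ φ => hT.map_add _ _ (MemDq.memLambda ψ.2 l) (MemDq.memLambda φ.2 l)
      map_smul' := fun c ψ => hT.map_smul c _ (MemDq.memLambda ψ.2 l) }
  let D : ι × Fin (l + 1) × Fin (l + 1) → dqSubmodule q →ₗ[ℂ] ℂ := fun i =>
    { toFun := fun ψ => partialD i.2.1 i.2.2 ψ (pts i.1)
      map_add' := fun ψ φ => congrFun (partialD_add ψ.2.1 φ.2.1 i.2.1 i.2.2) (pts i.1)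
      map_smul' := fun c ψ => congrFun (partialD_const_smul c ψ.2.1 i.2.1 i.2.2) (pts i.1) }
  have hK : ⨅ i, LinearMap.ker (D i) ≤ LinearMap.ker K := by
    intro ψ hψ
    rw [Submodule.mem_iInf] at hψ
    refine h ψ ψ.2 fun j n hn => iteratedFDeriv_eq_zero_of_partialD ψ.2.1 fun a b hab => ?_
    exact hψ (j, ⟨a, by omega⟩, ⟨b, by omega⟩)
  obtain ⟨c, hc⟩ := (Submodule.mem_span_range_iff_exists_fun ℂ).1 (mem_span_of_iInf_ker_le_ker hK)
  refine ⟨fun j a b => if h : a < l + 1 ∧ b < l + 1 then c (j, ⟨a, h.1⟩, ⟨b, h.2⟩) else 0,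
    fun ψ hψ => ?_⟩
  have h1 : T ψ = ∑ i, c i * D i ⟨ψ, hψ⟩ := by
    have := congrArg (fun f => f ⟨ψ, hψ⟩) hc
    simp only [LinearMap.sum_apply, LinearMap.smul_apply, smul_eq_mul] at this
    exact this.symm
  rw [h1, Fintype.sum_prod_type]
  refine Finset.sum_congr rfl fun j _ => ?_
  rw [Fintype.sum_prod_type, Finset.sum_range]
  refine Finset.sum_congr rfl fun a _ => ?_
  rw [Finset.sum_range]
  refine Finset.sum_congr rfl fun b _ => ?_
  simp only [a.2, b.2, and_self, dite_true]
  rfl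

/-- Entire functions of polynomial growth are polynomials. -/
theorem exists_eq_sum_pow_of_growth {F : ℂ → ℂ} (hF : Differentiable ℂ F) {C : ℝ} {m : ℕ}
    (h : ∀ s, ‖F s‖ ≤ C * (1 + ‖s‖) ^ m) :
    ∃ p : ℕ → ℂ, ∀ s, F s = ∑ k ∈ Finset.range (m + 1), p k * s ^ k := by
  have hC : 0 ≤ C := by simpa using (norm_nonneg _).trans (h 0)
  have hz : ∀ n, m < n → iteratedDeriv n F 0 = 0 := by
    intro n hn
    have hb : ∀ R : ℝ, 1 ≤ R → ‖iteratedDeriv n F 0‖ ≤ n.factorial * C * 2 ^ m / R := by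
      intro R hR
      have hR0 : 0 < R := by linarith
      refine (norm_iteratedDeriv_le_of_forall_mem_sphere_norm_le (C := C * (1 + R) ^ m) n hR0
        hF.diffContOnCl fun z hz => ?_).trans ?_
      · rw [mem_sphere_zero_iff_norm] at hz
        rw [← hz]
        exact h z
      · have h1 : (1 + R) ^ m ≤ (2 * R) ^ m := by gcongr; linarith
        have h2 : R ^ (m + 1) ≤ R ^ n := pow_le_pow_right₀ hR hn
        calc n.factorial * (C * (1 + R) ^ m) / R ^ n
            ≤ n.factorial * (C * (2 * R) ^ m) / R ^ (m + 1) := by gcongr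
          _ = n.factorial * C * 2 ^ m / R := by
            rw [mul_pow, pow_succ]; field_simp
    have ht : Tendsto (fun R : ℝ => n.factorial * C * 2 ^ m / R) atTop (nhds 0) :=
      tendsto_const_nhds.div_atTop tendsto_id
    refine norm_le_zero_iff.1 (ge_of_tendsto ht ?_)
    filter_upwards [eventually_ge_atTop 1] with R hR using hb R hR
  refine ⟨fun k => (k.factorial : ℂ)⁻¹ * iteratedDeriv k F 0, fun s => ?_⟩
  rw [← taylorSeries_eq_of_entire' (c := 0) (z := s) hF, tsum_eq_sum (s := Finset.range (m + 1))]
  · simp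
  · intro n hn
    rw [hz n (by simpa using hn)]
    simp

/-- A kernel all of whose matrices have rank at most `N` is separable with at most `N` terms. -/
theorem exists_separation_of_rank_le {G : ℂ → ℂ → ℂ} {N : ℕ}
    (h : ∀ (m : ℕ) (a b : Fin m → ℂ), (Matrix.of fun i j => G (a i) (b j)).rank ≤ N) :
    ∃ r ≤ N, ∃ a b : Fin r → ℂ, (Matrix.of fun i j => G (a i) (b j)).det ≠ 0 ∧
      ∀ x y, G x y = ∑ j, G x (b j) *
        ∑ i, (Matrix.of fun i j => G (a i) (b j))⁻¹ j i * G (a i) y := by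
  classical
  let P : ℕ → Prop := fun r => ∃ a b : Fin r → ℂ, (Matrix.of fun i j => G (a i) (b j)).det ≠ 0
  have hP0 : P 0 := ⟨Fin.elim0, Fin.elim0, by simp⟩
  have hPN : ∀ r, P r → r ≤ N := by
    rintro r ⟨a, b, hab⟩
    have := h r a b
    rwa [Matrix.rank_of_isUnit _ ((Matrix.isUnit_iff_isUnit_det _).2 hab.isUnit),
      Fintype.card_fin] at this
  set r := Nat.findGreatest P N with hr
  have hPr : P r := Nat.findGreatest_spec (Nat.zero_le N) hP0
  have hPr' : ¬ P (r + 1) := fun hp =>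
    absurd (Nat.le_findGreatest (hPN _ hp) hp) (by omega)
  obtain ⟨a, b, hab⟩ := hPr
  refine ⟨r, Nat.findGreatest_le N, a, b, hab, fun x y => ?_⟩
  set M := Matrix.of fun i j => G (a i) (b j) with hM
  let a' : Fin r ⊕ Unit → ℂ := Sum.elim a fun _ => x
  let b' : Fin r ⊕ Unit → ℂ := Sum.elim b fun _ => y
  let e : Fin (r + 1) ≃ Fin r ⊕ Unit :=
    Fintype.equivOfCardEq (by simp)
  have h0 : (Matrix.of fun i j => G (a' i) (b' j)).det = 0 := by
    by_contra hne
    refine hPr' ⟨a' ∘ e, b' ∘ e, ?_⟩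
    rw [← Matrix.det_submatrix_equiv_self e] at hne
    exact hne
  have h1 : (Matrix.of fun i j => G (a' i) (b' j)) = Matrix.fromBlocks M
      (Matrix.of fun i _ => G (a i) y) (Matrix.of fun _ j => G x (b j))
      (Matrix.of fun _ _ => G x y) := by
    ext i j
    rcases i with i | i <;> rcases j with j | j <;> rfl
  let := M.invertibleOfIsUnitDet hab.isUnit
  rw [h1, Matrix.det_fromBlocks₁₁, mul_eq_zero, or_iff_right hab, Matrix.det_unique,
    Matrix.invOf_eq_nonsing_inv, Matrix.sub_apply, sub_eq_zero] at h0
  rw [Matrix.mul_assoc] at h0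
  simpa [Matrix.mul_apply] using h0

theorem differentiable_matrix_det {n : Type*} [Fintype n] [DecidableEq n]
    {M : ℂ → Matrix n n ℂ} (h : ∀ i j, Differentiable ℂ fun s => M s i j) :
    Differentiable ℂ fun s => (M s).det := by
  simp only [Matrix.det_apply]
  exact Differentiable.fun_sum fun σ _ =>
    (Differentiable.fun_finsetProd fun i _ => h (σ i) i).const_smul _

/-- The determinants of translated evaluations of finitely many functions span the translates
of these functions, up to finitely many translates. -/
theorem exists_linearMap_translate {r : ℕ} (f : Fin r → ℂ → ℂ) (a : Fin r → ℂ)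
    (ha : (Matrix.of fun i j => f j (a i)).det ≠ 0) (s : ℂ) (j : Fin r) :
    ∃ Ξ : ((Fin r → ℂ) → ℂ) →ₗ[ℂ] (ℂ → ℂ),
      Ξ (fun x => (Matrix.of fun i j => f j (x i + s)).det) = (fun z => f j (z + s)) ∧
      ∀ σ, Ξ (fun x => (Matrix.of fun i j => f j (x i + σ)).det) ∈
        Submodule.span ℂ (Set.range fun i => fun z => f i (z + σ)) := by
  classical
  set M := Matrix.of fun i j => f j (a i) with hM
  let Ξ : ((Fin r → ℂ) → ℂ) →ₗ[ℂ] (ℂ → ℂ) :=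
    { toFun := fun g z => M.det⁻¹ * ∑ k, M k j * g (Function.update (fun i => a i - s) k z)
      map_add' := fun g g' => by
        funext z
        simp only [Pi.add_apply, mul_add, Finset.sum_add_distrib]
      map_smul' := fun c g => by
        funext z
        simp only [Pi.smul_apply, smul_eq_mul, RingHom.id_apply, Finset.mul_sum]
        exact Finset.sum_congr rfl fun k _ => by ring }
  have key : ∀ σ z, ∀ k, (Matrix.of fun i j =>
      f j (Function.update (fun i => a i - s) k z i + σ)).det =
      Matrix.cramer (Matrix.of fun i j => f j (a i - s + σ)).transpose
        (fun i => f i (z + σ)) k := by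
    intro σ z k
    rw [Matrix.cramer_transpose_apply]
    congr 1
    ext i j
    by_cases hik : i = k
    · subst hik; simp
    · simp [hik]
  refine ⟨Ξ, ?_, fun σ => ?_⟩
  · funext z
    change M.det⁻¹ * ∑ k, M k j * _ = _
    simp only [key, sub_add_cancel]
    have h1 := congrFun (Matrix.mulVec_cramer M.transpose (fun i => f i (z + s))) j
    simp only [Matrix.mulVec, dotProduct, Matrix.transpose_apply, Matrix.det_transpose,
      Pi.smul_apply, smul_eq_mul] at h1
    rw [← hM, h1, inv_mul_cancel_left₀ ha]
  · rw [Submodule.mem_span_range_iff_exists_fun]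
    refine ⟨fun i => M.det⁻¹ * ∑ k, M k j *
      (Matrix.of fun i j => f j (a i - s + σ)).transpose.adjugate k i, ?_⟩
    funext z
    change _ = M.det⁻¹ * ∑ k, M k j * _
    simp only [key, Matrix.cramer_eq_adjugate_mulVec, Matrix.mulVec, dotProduct, Finset.sum_apply,
      Pi.smul_apply, smul_eq_mul, Finset.mul_sum, Finset.sum_mul]
    rw [Finset.sum_comm]
    exact Finset.sum_congr rfl fun k _ => Finset.sum_congr rfl fun i _ => by ring

/-- If `G` is separable and has polynomial growth along the directions `(s, -s̄)`, then
small translates of `G(·, b j)` lie in a finite-dimensional space. -/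
theorem exists_finiteDimensional_translate {G : ℂ → ℂ → ℂ}
    (h1 : ∀ y, Differentiable ℂ fun x => G x y) {l : ℕ}
    (hb : ∀ c d, ∃ K : ℝ, ∀ s, ‖G (c + s) (d - (starRingEnd ℂ) s)‖ ≤ K * (1 + ‖s‖) ^ l)
    {r : ℕ} {a b : Fin r → ℂ} (hab : (Matrix.of fun i j => G (a i) (b j)).det ≠ 0)
    {c : Fin r → ℂ → ℂ} (hc : ∀ j, Differentiable ℂ (c j))
    (hcb : (Matrix.of fun j k => c j (b k)).det ≠ 0)
    (hG : ∀ x y, G x y = ∑ j, G x (b j) * c j y) :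
    ∃ U : Submodule ℂ (ℂ → ℂ), FiniteDimensional ℂ U ∧ ∃ Ω : Set ℂ, IsOpen Ω ∧ 0 ∈ Ω ∧
      ∀ s ∈ Ω, ∀ j, (fun z => G (z + s) (b j)) ∈ U := by
  classical
  let conj := starRingEnd ℂ
  let φ : ℂ → (Fin r → ℂ) → ℂ := fun s x => (Matrix.of fun i j => G (x i + s) (b j)).det
  let η : ℂ → ℂ := fun s => (Matrix.of fun j k => c j (b k + s)).det
  have hη : Differentiable ℂ η := differentiable_matrix_det fun j k =>
    (hc j).comp (differentiable_id.const_add (b k))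
  let H : ℂ → ℂ := fun s => conj (η (-conj s))
  have hH : Differentiable ℂ H := by
    have h3 : Differentiable ℂ fun s => η (-s) := hη.comp differentiable_neg
    intro s
    have := (h3 (conj s)).hasDerivAt.conj_conj
    rw [Complex.conj_conj] at this
    exact this.differentiableAt
  have hprod : ∀ s x, φ s x * η (-conj s) =
      (Matrix.of fun i k => G (x i + s) (b k - conj s)).det := by
    intro s x
    rw [← Matrix.det_mul]
    congr 1
    ext i k
    simp only [Matrix.mul_apply, Matrix.of_apply, sub_eq_add_neg]
    exact (hG _ _).symm
  have hpoly : ∀ x, ∃ p : ℕ → ℂ, ∀ s, φ s x * H s = ∑ k ∈ Finset.range (l * r + 1), p k * s ^ k := by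
    intro x
    choose K hK using fun i k => hb (x i) (b k)
    have hK0 : ∀ i k, 0 ≤ K i k := fun i k => by simpa using (norm_nonneg _).trans (hK i k 0)
    set A := ∑ i, ∑ k, K i k with hA
    have hAK : ∀ i k, K i k ≤ A := fun i k =>
      (Finset.single_le_sum (f := fun k => K i k) (fun k _ => hK0 i k) (Finset.mem_univ k)).trans
        (Finset.single_le_sum (f := fun i => ∑ k, K i k)
          (fun i _ => Finset.sum_nonneg fun k _ => hK0 i k) (Finset.mem_univ i))
    refine exists_eq_sum_pow_of_growth (C := r.factorial * A ^ r) ?_ fun s => ?_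
    · refine Differentiable.mul (differentiable_matrix_det fun i j => ?_) hH
      exact (h1 (b j)).comp (differentiable_id.const_add (x i))
    · have hn : ‖φ s x * H s‖ = ‖φ s x * η (-conj s)‖ := by
        rw [norm_mul, norm_mul, RCLike.norm_conj]
      have := Matrix.det_le (A := Matrix.of fun i k => G (x i + s) (b k - conj s))
        (abv := NormedField.toAbsoluteValue ℂ) (x := A * (1 + ‖s‖) ^ l) fun i k =>
          (hK i k s).trans (by gcongr; exact hAK i k)
      rw [hn, hprod]
      refine le_trans this (le_of_eq ?_)
      rw [Fintype.card_fin, nsmul_eq_mul, mul_pow, ← pow_mul, mul_assoc]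
  choose p hp using hpoly
  let Ω : Set ℂ := {s | H s ≠ 0}
  have hφ : ∀ s ∈ Ω, φ s ∈ Submodule.span ℂ
      (Set.range fun k : Fin (l * r + 1) => fun x => p x k) := by
    intro s hs
    rw [Submodule.mem_span_range_iff_exists_fun]
    refine ⟨fun k => s ^ (k : ℕ) * (H s)⁻¹, ?_⟩
    funext x
    have h4 := hp x s
    rw [Finset.sum_range] at h4
    rw [← eq_mul_inv_iff_mul_eq₀ hs, Finset.sum_mul] at h4
    simp only [Finset.sum_apply, Pi.smul_apply, smul_eq_mul, h4]
    exact Finset.sum_congr rfl fun k _ => by ring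
  have hfg : (Submodule.span ℂ (φ '' Ω)).FG := by
    have : FiniteDimensional ℂ (Submodule.span ℂ
        (Set.range fun k : Fin (l * r + 1) => fun x => p x k)) :=
      FiniteDimensional.span_of_finite ℂ (Set.finite_range _)
    have h5 : Submodule.span ℂ (φ '' Ω) ≤ Submodule.span ℂ
        (Set.range fun k : Fin (l * r + 1) => fun x => p x k) := by
      rw [Submodule.span_le]
      rintro _ ⟨s, hs, rfl⟩
      exact hφ s hs
    have := Submodule.finiteDimensional_of_le h5
    exact (Submodule.fg_iff_finiteDimensional _).2 this
  obtain ⟨t', ht', hspan⟩ := (Submodule.fg_span_iff_fg_span_finset_subset _).1 hfg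
  obtain ⟨t, ht, rfl⟩ := Finset.subset_set_image_iff.1 ht'
  let g : Fin r × t → ℂ → ℂ := fun i z => G (z + i.2) (b i.1)
  refine ⟨Submodule.span ℂ (Set.range g), FiniteDimensional.span_of_finite ℂ (Set.finite_range _),
    Ω, isOpen_ne_fun hH.continuous continuous_const, ?_, fun s hs j => ?_⟩
  · have : η 0 ≠ 0 := by simpa [η] using hcb
    simpa [Ω, H] using this
  · obtain ⟨Ξ, hΞ, hΞ'⟩ := exists_linearMap_translate (fun j x => G x (b j)) a hab s j
    rw [← hΞ]
    have h6 : φ s ∈ Submodule.span ℂ (φ '' Ω) := Submodule.subset_span ⟨s, hs, rfl⟩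
    rw [hspan] at h6
    have h7 : Submodule.span ℂ (↑(t.image φ) : Set ((Fin r → ℂ) → ℂ)) ≤
        (Submodule.span ℂ (Set.range g)).comap Ξ := by
      rw [Submodule.span_le]
      intro u hu
      obtain ⟨σ, hσ, rfl⟩ := Finset.mem_image.1 (Finset.mem_coe.1 hu)
      refine Submodule.span_mono ?_ (hΞ' σ)
      rintro _ ⟨i, rfl⟩
      exact ⟨(i, ⟨σ, hσ⟩), rfl⟩
    exact h7 h6

/-- A linear functional on an algebra containing a two-parameter exponential family `e`
with logarithmic derivatives `Z` and `Zb`. -/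
structure ExpFunctional {A : Type*} [CommRing A] [Algebra ℂ A] (τ : A →ₗ[ℂ] ℂ) (Z Zb : A)
    (e : ℂ → ℂ → A) : Prop where
  hasDerivAt_left : ∀ u x y, HasDerivAt (fun x => τ (u * e x y)) (τ (u * Z * e x y)) x
  hasDerivAt_right : ∀ u x y, HasDerivAt (fun y => τ (u * e x y)) (τ (u * Zb * e x y)) y

theorem mem_of_hasDerivAt_translate {U : Submodule ℂ (ℂ → ℂ)} [FiniteDimensional ℂ U] {Ω : Set ℂ}
    (hΩ : IsOpen Ω) {F F' : ℂ → ℂ} (hF : ∀ z, HasDerivAt F (F' z) z)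
    (h : ∀ s ∈ Ω, (fun z => F (z + s)) ∈ U) {s : ℂ} (hs : s ∈ Ω) :
    (fun z => F' (z + s)) ∈ U := by
  have hcl : IsClosed (U : Set (ℂ → ℂ)) := Submodule.closed_of_finiteDimensional U
  have ht : Tendsto (fun t : ℂ => t⁻¹ • ((fun z => F (z + (s + t))) - fun z => F (z + s)))
      (nhdsWithin 0 {0}ᶜ) (nhds fun z => F' (z + s)) := by
    rw [tendsto_pi_nhds]
    intro z
    have := (hF (z + s)).tendsto_slope_zero
    simpa [add_assoc] using this
  refine hcl.mem_of_tendsto ht ?_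
  have hev : ∀ᶠ t : ℂ in nhds 0, s + t ∈ Ω := by
    have hc : ContinuousAt (fun t : ℂ => s + t) 0 := by fun_prop
    exact hc.eventually_mem (hΩ.mem_nhds (by simpa using hs))
  filter_upwards [hev.filter_mono nhdsWithin_le_nhds] with t ht
  exact U.smul_mem _ (U.sub_mem (h _ ht) (h _ hs))

namespace ExpFunctional

variable {A : Type*} [CommRing A] [Algebra ℂ A] {τ : A →ₗ[ℂ] ℂ} {Z Zb : A} {e : ℂ → ℂ → A}

theorem separation_aeval (h : ExpFunctional τ Z Zb e) {r : ℕ} {b : Fin r → ℂ}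
    {c : Fin r → ℂ → ℂ} (hG : ∀ x y, τ (e x y) = ∑ j, τ (e x (b j)) * c j y)
    (p : Polynomial ℂ) (x y : ℂ) :
    τ (Polynomial.aeval Z p * e x y) = ∑ j, τ (Polynomial.aeval Z p * e x (b j)) * c j y := by
  have hpow : ∀ k x, τ (Z ^ k * e x y) = ∑ j, τ (Z ^ k * e x (b j)) * c j y := by
    intro k
    induction k with
    | zero => intro x; simpa using hG x y
    | succ k ih =>
      intro x
      have h1 := h.hasDerivAt_left (Z ^ k) x y
      have h2 : HasDerivAt (fun x => ∑ j, τ (Z ^ k * e x (b j)) * c j y)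
          (∑ j, τ (Z ^ k * Z * e x (b j)) * c j y) x :=
        HasDerivAt.fun_sum fun j _ => (h.hasDerivAt_left (Z ^ k) x (b j)).mul_const (c j y)
      rw [funext ih] at h1
      simpa [pow_succ] using h1.unique h2
  induction p using Polynomial.induction_on' with
  | add p q hp hq => simp only [map_add, add_mul, hp, hq, Finset.sum_add_distrib]
  | monomial n a =>
    simp only [Polynomial.aeval_monomial, Algebra.algebraMap_eq_smul_one, smul_mul_assoc, one_mul,
      map_smul, smul_eq_mul, hpow, Finset.mul_sum, mul_assoc]

/-- If translates of a separable `τ (e x y)` lie in a finite-dimensional space, then `τ` is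
annihilated by a nonzero polynomial in `Z`. -/
theorem exists_annihilator (h : ExpFunctional τ Z Zb e) {r : ℕ} {b : Fin r → ℂ}
    {c : Fin r → ℂ → ℂ} (hG : ∀ x y, τ (e x y) = ∑ j, τ (e x (b j)) * c j y)
    {U : Submodule ℂ (ℂ → ℂ)} [FiniteDimensional ℂ U] {Ω : Set ℂ} (hΩ : IsOpen Ω) (h0 : 0 ∈ Ω)
    (hU : ∀ s ∈ Ω, ∀ j, (fun z => τ (e (z + s) (b j))) ∈ U) :
    ∃ p : Polynomial ℂ, p ≠ 0 ∧ ∀ x y, τ (Polynomial.aeval Z p * e x y) = 0 := by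
  have hpow : ∀ k j, ∀ s ∈ Ω, (fun z => τ (Z ^ k * e (z + s) (b j))) ∈ U := by
    intro k j
    induction k with
    | zero => intro s hs; simpa using hU s hs j
    | succ k ih =>
      intro s hs
      simpa [pow_succ] using mem_of_hasDerivAt_translate hΩ
        (fun z => h.hasDerivAt_left (Z ^ k) z (b j)) ih hs
  have hmem : ∀ (p : Polynomial ℂ) j, (fun z => τ (Polynomial.aeval Z p * e z (b j))) ∈ U := by
    intro p j
    induction p using Polynomial.induction_on' with
    | add p q hp hq =>
      convert! U.add_mem hp hq using 1
      funext z
      simp [add_mul]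
    | monomial n a =>
      convert! U.smul_mem a (hpow n j 0 h0) using 1
      funext z
      simp [Polynomial.aeval_monomial, Algebra.algebraMap_eq_smul_one]
  let Φ : Polynomial ℂ →ₗ[ℂ] (Fin r → U) :=
    { toFun := fun p j => ⟨fun z => τ (Polynomial.aeval Z p * e z (b j)), hmem p j⟩
      map_add' := fun p q => by
        funext j; ext z; simp [add_mul]
      map_smul' := fun a p => by
        funext j; ext z; simp }
  have hΦ : ¬ Function.Injective Φ := fun hinj =>
    Polynomial.not_finite (Module.Finite.of_injective Φ hinj)
  rw [← LinearMap.ker_eq_bot, Submodule.eq_bot_iff] at hΦ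
  push Not at hΦ
  obtain ⟨p, hp, hp0⟩ := hΦ
  refine ⟨p, hp0, fun x y => ?_⟩
  rw [h.separation_aeval hG]
  refine Finset.sum_eq_zero fun j _ => ?_
  have h1 : Φ p j = 0 := congrFun hp j
  have h2 : τ (Polynomial.aeval Z p * e x (b j)) = 0 :=
    congrFun (congrArg Subtype.val h1) x
  rw [h2, zero_mul]

/-- The antiholomorphic moments of `τ` along `e 0 y`. -/
def moments (τ : A →ₗ[ℂ] ℂ) (Zb : A) (e : ℂ → ℂ → A) : A →ₗ[ℂ] (ℕ → ℂ → ℂ) where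
  toFun u k y := τ (u * Zb ^ k * e 0 y)
  map_add' u v := by funext k y; simp [add_mul]
  map_smul' a u := by funext k y; simp

/-- The shift operator on moments. -/
def momentShift : Module.End ℂ (ℕ → ℂ → ℂ) where
  toFun f k := f (k + 1)
  map_add' _ _ := rfl
  map_smul' _ _ := rfl

theorem momentShift_sub_pow_moments (c : ℂ) (n : ℕ) (u : A) :
    ((momentShift - algebraMap ℂ (Module.End ℂ (ℕ → ℂ → ℂ)) c) ^ n) (moments τ Zb e u) =
      moments τ Zb e (u * (Zb - algebraMap ℂ A c) ^ n) := by
  induction n generalizing u with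
  | zero => simp
  | succ n ih =>
    rw [pow_succ, Module.End.mul_apply]
    have : (momentShift - algebraMap ℂ (Module.End ℂ (ℕ → ℂ → ℂ)) c) (moments τ Zb e u) =
        moments τ Zb e (u * (Zb - algebraMap ℂ A c)) := by
      funext k y
      have hu : u * (Zb - algebraMap ℂ A c) * Zb ^ k * e 0 y =
          u * Zb ^ (k + 1) * e 0 y - c • (u * Zb ^ k * e 0 y) := by
        rw [Algebra.algebraMap_eq_smul_one, mul_sub, mul_smul_comm, mul_one, sub_mul, sub_mul,
          smul_mul_assoc, smul_mul_assoc, pow_succ']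
        ring
      change τ (u * Zb ^ (k + 1) * e 0 y) - c * τ (u * Zb ^ k * e 0 y) =
        τ (u * (Zb - algebraMap ℂ A c) * Zb ^ k * e 0 y)
      rw [hu, map_sub, map_smul, smul_eq_mul]
    rw [this, ih, mul_assoc, ← pow_succ']

theorem moments_eq_zero (h : ExpFunctional τ Z Zb e) {u : A} (hu : ∀ y, τ (u * e 0 y) = 0) :
    moments τ Zb e u = 0 := by
  have : ∀ k y, τ (u * Zb ^ k * e 0 y) = 0 := by
    intro k
    induction k with
    | zero => simpa using hu
    | succ k ih =>
      intro y
      have h1 := h.hasDerivAt_right (u * Zb ^ k) 0 y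
      rw [funext ih] at h1
      have := h1.unique (hasDerivAt_const y (0 : ℂ))
      rwa [pow_succ, ← mul_assoc]
  funext k y
  exact this k y

theorem eq_zero_of_eigen (h : ExpFunctional τ Z Zb e) {u : A} {ζ : ℂ}
    (hu : ∀ x y, τ (u * (Z - algebraMap ℂ A ζ) * e x y) = 0) (hu0 : ∀ y, τ (u * e 0 y) = 0)
    (x y : ℂ) : τ (u * e x y) = 0 := by
  have h1 : ∀ x, HasDerivAt (fun x => cexp (-ζ * x) * τ (u * e x y)) 0 x := by
    intro x
    have h2 : τ (u * Z * e x y) = ζ * τ (u * e x y) := by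
      have := hu x y
      rw [Algebra.algebraMap_eq_smul_one, mul_sub, mul_smul_comm, mul_one, sub_mul,
        smul_mul_assoc, map_sub, map_smul, sub_eq_zero] at this
      exact this
    have h3 : HasDerivAt (fun x => cexp (-ζ * x)) (cexp (-ζ * x) * -ζ) x := by
      simpa using ((hasDerivAt_id x).const_mul (-ζ)).cexp
    convert! h3.mul (h.hasDerivAt_left u x y) using 1
    rw [h2]
    ring
  have h4 := is_const_of_deriv_eq_zero (fun x => (h1 x).differentiableAt)
    (fun x => (h1 x).deriv) x 0
  simpa [hu0, exp_ne_zero] using h4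

/-- The annihilator of `τ` of least degree has at most `r` roots. -/
theorem exists_annihilator_card_roots_le (h : ExpFunctional τ Z Zb e) {r : ℕ} {b : Fin r → ℂ}
    {c : Fin r → ℂ → ℂ} (hG : ∀ x y, τ (e x y) = ∑ j, τ (e x (b j)) * c j y)
    (hp : ∃ p : Polynomial ℂ, p ≠ 0 ∧ ∀ x y, τ (Polynomial.aeval Z p * e x y) = 0)
    {n : ℕ} (hn : ∀ (u : A) (ζ : ℂ), (∀ x y, τ (u * (Z - algebraMap ℂ A ζ) * e x y) = 0) →
      ∀ v, τ (u * (Zb - algebraMap ℂ A ((starRingEnd ℂ) ζ)) ^ n * v) = 0) :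
    ∃ p : Polynomial ℂ, p ≠ 0 ∧ (∀ x y, τ (Polynomial.aeval Z p * e x y) = 0) ∧
      p.roots.toFinset.card ≤ r := by
  classical
  have hex : ∃ d, ∃ p : Polynomial ℂ, p ≠ 0 ∧ (∀ x y, τ (Polynomial.aeval Z p * e x y) = 0) ∧
      p.natDegree = d := by
    obtain ⟨p, h1, h2⟩ := hp
    exact ⟨_, p, h1, h2, rfl⟩
  obtain ⟨p, hp0, hpa, hd⟩ := Nat.find_spec hex
  have hmin : ∀ v : Polynomial ℂ, v ≠ 0 → v.natDegree < p.natDegree →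
      ¬ ∀ x y, τ (Polynomial.aeval Z v * e x y) = 0 := fun v hv hlt hva =>
    Nat.find_min hex (hlt.trans_eq hd) ⟨v, hv, hva, rfl⟩
  refine ⟨p, hp0, hpa, ?_⟩
  let v : p.roots.toFinset → Polynomial ℂ := fun ζ => p /ₘ (Polynomial.X - Polynomial.C ζ.1)
  have hv : ∀ ζ, (Polynomial.X - Polynomial.C ζ.1) * v ζ = p := fun ζ =>
    Polynomial.mul_divByMonic_eq_iff_isRoot.2 ((Polynomial.mem_roots hp0).1
      (Multiset.mem_toFinset.1 ζ.2))
  have hv0 : ∀ ζ, v ζ ≠ 0 := fun ζ h0 => hp0 (by rw [← hv ζ, h0, mul_zero])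
  have hvd : ∀ ζ, (v ζ).natDegree < p.natDegree := fun ζ => by
    conv_rhs => rw [← hv ζ, Polynomial.natDegree_mul (Polynomial.X_sub_C_ne_zero _) (hv0 ζ),
      Polynomial.natDegree_X_sub_C]
    omega
  let u : p.roots.toFinset → A := fun ζ => Polynomial.aeval Z (v ζ)
  have hu : ∀ ζ x y, τ (u ζ * (Z - algebraMap ℂ A ζ.1) * e x y) = 0 := fun ζ x y => by
    have huζ : u ζ * (Z - algebraMap ℂ A ζ.1) = Polynomial.aeval Z p := by
      conv_rhs => rw [← hv ζ]
      simp [u, mul_comm]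
    rw [huζ, hpa]
  have hne : ∀ ζ, moments τ Zb e (u ζ) ≠ 0 := fun ζ h0 =>
    hmin _ (hv0 ζ) (hvd ζ) (h.eq_zero_of_eigen (hu ζ) fun y => by
      simpa [moments, u] using congrFun (congrFun h0 0) y)
  have hmem : ∀ ζ, moments τ Zb e (u ζ) ∈
      Module.End.maxGenEigenspace momentShift ((starRingEnd ℂ) ζ.1) := fun ζ => by
    rw [Module.End.mem_maxGenEigenspace]
    refine ⟨n, ?_⟩
    have := momentShift_sub_pow_moments (τ := τ) (Zb := Zb) (e := e) ((starRingEnd ℂ) ζ.1) n (u ζ)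
    rw [Algebra.algebraMap_eq_smul_one] at this
    rw [this]
    exact h.moments_eq_zero fun y => hn _ _ (hu ζ) _
  have hli : LinearIndependent ℂ fun ζ => moments τ Zb e (u ζ) := by
    have hind := (Module.End.independent_maxGenEigenspace
      (momentShift)).comp (f := fun ζ : p.roots.toFinset => (starRingEnd ℂ) ζ.1)
        (fun ζ ξ hζ => Subtype.ext ((starRingEnd ℂ).injective hζ))
    exact hind.linearIndependent _ hmem hne
  have hli' : LinearIndependent ℂ fun ζ => fun j => τ (u ζ * e 0 (b j)) := by
    rw [Fintype.linearIndependent_iff] at hli ⊢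
    intro α hα
    refine hli α ?_
    have hsum : ∑ ζ, α ζ • u ζ = Polynomial.aeval Z (∑ ζ, α ζ • v ζ) := by
      simp [u]
    rw [← map_zero (moments τ Zb e), ← sub_eq_zero, map_zero, sub_zero]
    simp_rw [← map_smul]
    rw [← map_sum, hsum]
    refine h.moments_eq_zero fun y => ?_
    rw [h.separation_aeval hG, ← hsum]
    refine Finset.sum_eq_zero fun j _ => ?_
    have := congrFun hα j
    rw [Finset.sum_mul, map_sum]
    simp only [Finset.sum_apply, Pi.smul_apply, smul_eq_mul, Pi.zero_apply] at this
    rw [Finset.univ_eq_attach] at this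
    simp [this]
  have := hli'.fintype_card_le_finrank
  simpa using this

end ExpFunctional

/-- The algebra of smooth functions all of whose derivatives are of sub-Gaussian growth. -/
def subGaussianAlgebra : Subalgebra ℂ (ℂ → ℂ) where
  carrier := {u | SubGaussian u}
  mul_mem' h1 h2 := h1.mul h2
  add_mem' h1 h2 := h1.add h2
  algebraMap_mem' c := SubGaussian.const c

/-- The real-linear map `w ↦ a w + b w̄`. -/
def linForm (a b : ℂ) : ℂ →L[ℝ] ℂ :=
  a • ContinuousLinearMap.id ℝ ℂ + b • (conjCLE : ℂ →L[ℝ] ℂ)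

theorem linForm_apply (a b w : ℂ) : linForm a b w = a * w + b * (starRingEnd ℂ) w := by
  simp [linForm]

theorem exists_eq_linForm (L : ℂ →L[ℝ] ℂ) : ∃ a b, L = linForm a b := by
  refine ⟨(L 1 - Complex.I * L Complex.I) / 2, (L 1 + Complex.I * L Complex.I) / 2, ?_⟩
  ext w
  have hw : w = w.re • (1 : ℂ) + w.im • Complex.I := by simp
  have hw2 : (starRingEnd ℂ) w = w.re - w.im * Complex.I := by
    apply Complex.ext <;> simp
  have hL : L w = w.re * L 1 + w.im * L Complex.I := by
    conv_lhs => rw [hw, map_add, map_smul, map_smul]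
    simp
  rw [linForm_apply, hw2]
  linear_combination hL + (L 1 - Complex.I * L Complex.I) / 2 * re_add_im w +
    (w.im : ℂ) * L Complex.I * I_sq

/-- The exponentials `w ↦ exp (a w + b w̄)`. -/
def expElem (a b : ℂ) : subGaussianAlgebra :=
  ⟨fun w => cexp (linForm a b w), subGaussian_cexp _⟩

/-- The coordinate function. -/
def coordElem : subGaussianAlgebra :=
  ⟨fun w => w, subGaussian_linear (ContinuousLinearMap.id ℝ ℂ)⟩

/-- The conjugate coordinate function. -/
def conjElem : subGaussianAlgebra :=
  ⟨fun w => (starRingEnd ℂ) w, subGaussian_linear (conjCLE : ℂ →L[ℝ] ℂ)⟩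

theorem coe_aeval_coordElem (p : Polynomial ℂ) :
    ((Polynomial.aeval coordElem p : subGaussianAlgebra) : ℂ → ℂ) = fun w => p.eval w := by
  induction p using Polynomial.induction_on' with
  | add p q hp hq => funext w; simp [hp, hq]
  | monomial n a =>
    funext w
    simp [Polynomial.aeval_monomial, coordElem]

/-- The restriction of a weighted functional to the algebra of sub-Gaussian functions. -/
def WFunctional.toLinearMap {q : ℝ} (hq : 0 < q) {l : ℕ} {S : Dst} (hS : WFunctional q l S) :
    subGaussianAlgebra →ₗ[ℂ] ℂ where
  toFun u := S u
  map_add' u v := hS.map_add _ _ (SubGaussian.memLambda u.2 hq l) (SubGaussian.memLambda v.2 hq l)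
  map_smul' c u := hS.map_smul c _ (SubGaussian.memLambda u.2 hq l)

theorem WFunctional.expFunctional {q : ℝ} (hq : 0 < q) {l : ℕ} {S : Dst}
    (hS : WFunctional q l S) :
    ExpFunctional (hS.toLinearMap hq) coordElem conjElem expElem where
  hasDerivAt_left u x y := by
    have hu := SubGaussian.mul u.2 (expElem 0 y).2
    convert! hS.hasDerivAt_exp hq hu (ContinuousLinearMap.id ℝ ℂ) x using 1
    · funext t
      refine congrArg S ?_
      funext w
      simp [expElem, linForm_apply, exp_add]
      ring
    · refine congrArg S ?_
      funext w
      simp [expElem, linForm_apply, coordElem, exp_add]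
      ring
  hasDerivAt_right u x y := by
    have hu := SubGaussian.mul u.2 (expElem x 0).2
    convert! hS.hasDerivAt_exp hq hu (conjCLE : ℂ →L[ℝ] ℂ) y using 1
    · funext t
      refine congrArg S ?_
      funext w
      simp [expElem, linForm_apply, exp_add]
      ring
    · refine congrArg S ?_
      funext w
      simp [expElem, linForm_apply, conjElem, exp_add]
      ring

theorem norm_iteratedFDeriv_cexp_le (L : ℂ →L[ℝ] ℂ) (n : ℕ) (w : ℂ) :
    ‖iteratedFDeriv ℝ n (fun w => cexp (L w)) w‖ ≤ ‖L‖ ^ n * ‖cexp (L w)‖ := by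
  refine ContinuousMultilinearMap.opNorm_le_bound (by positivity) fun m => ?_
  rw [iteratedFDeriv_cexp_comp_apply, norm_mul, norm_prod, mul_comm (‖L‖ ^ n), mul_assoc]
  refine mul_le_mul_of_nonneg_left ?_ (norm_nonneg _)
  refine (Finset.prod_le_prod (fun i _ => norm_nonneg _) fun i _ => L.le_opNorm (m i)).trans ?_
  rw [Finset.prod_mul_distrib, Finset.prod_const, Finset.card_univ, Fintype.card_fin]

theorem WFunctional.exists_growth_bound {q : ℝ} (hq : 0 < q) {l : ℕ} {S : Dst}
    (hS : WFunctional q l S) (c d : ℂ) : ∃ K : ℝ, ∀ s,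
      ‖hS.toLinearMap hq (expElem (c + s) (d - (starRingEnd ℂ) s))‖ ≤ K * (1 + ‖s‖) ^ l := by
  obtain ⟨C, hC0, hC⟩ := (hS.mul_left hq (expElem c d).2).bound
  refine ⟨C * 2 ^ l, fun s => ?_⟩
  have hs := subGaussian_cexp (linForm s (-(starRingEnd ℂ) s))
  have hL : ‖linForm s (-(starRingEnd ℂ) s)‖ ≤ 2 * (1 + ‖s‖) := by
    refine ContinuousLinearMap.opNorm_le_bound _ (by positivity) fun w => ?_
    rw [linForm_apply]
    refine (norm_add_le _ _).trans ?_
    rw [norm_mul, norm_mul, norm_neg, RCLike.norm_conj, RCLike.norm_conj]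
    nlinarith [norm_nonneg w, norm_nonneg s]
  have h1 : ∀ w, ‖cexp (linForm s (-(starRingEnd ℂ) s) w)‖ = 1 := fun w => by
    rw [linForm_apply, Complex.norm_exp]
    simp [mul_comm]
  have hw : WBound (q / 2) l (fun w => cexp (linForm s (-(starRingEnd ℂ) s) w))
      ((2 * (1 + ‖s‖)) ^ l) := by
    intro n hn w
    have h2 : 1 ≤ Real.exp (q / 2 * ‖w‖ ^ 2) := Real.one_le_exp (by positivity)
    calc _ ≤ ‖linForm s (-(starRingEnd ℂ) s)‖ ^ n * ‖cexp (linForm s (-(starRingEnd ℂ) s) w)‖ :=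
          norm_iteratedFDeriv_cexp_le _ n w
      _ ≤ (2 * (1 + ‖s‖)) ^ n * 1 := by rw [h1]; gcongr
      _ ≤ (2 * (1 + ‖s‖)) ^ l * Real.exp (q / 2 * ‖w‖ ^ 2) := by
          gcongr
          nlinarith [norm_nonneg s]
  have := hC _ _ (hs.memLambda (half_pos hq) l) hw
  rw [mul_pow, ← mul_assoc] at this
  convert! this using 2
  refine congrArg S ?_
  funext w
  simp only [expElem, linForm_apply, ← exp_add]
  ring_nf

theorem flatAt_pow {f : ℂ → ℂ} (hf : ContDiff ℝ (⊤ : ℕ∞) f) {z : ℂ} (hz : f z = 0) (l : ℕ) :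
    FlatAt l z (fun w => f w ^ (l + 1)) := by
  induction l with
  | zero =>
    intro n hn
    obtain rfl : n = 0 := by omega
    ext m
    simp [hz]
  | succ l ih =>
    intro n hn
    simp_rw [pow_succ' _ (l + 1)]
    have := norm_iteratedFDeriv_mul_le (contDiff_nat_of_top hf n)
      (contDiff_nat_of_top (hf.pow (l + 1)) n) z le_rfl
    refine norm_le_zero_iff.1 (this.trans (Finset.sum_nonpos fun i _ => ?_))
    rcases Nat.eq_zero_or_pos i with rfl | hi
    · simp [hz]
    · rw [ih (n - i) (by omega), norm_zero, mul_zero]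

theorem WFunctional.eq_zero_of_annihilator {q : ℝ} (hq : 0 < q) {l : ℕ} {S : Dst}
    (hS : WFunctional q l S) {p : Polynomial ℂ} (hp : p ≠ 0)
    (h : ∀ x y, S (fun w => p.eval w * (expElem x y).1 w) = 0) {ψ : ℂ → ℂ}
    (hψ : ContDiff ℝ (⊤ : ℕ∞) ψ) (hψ' : MemLambda q l ψ)
    (hF : ∀ z, p.IsRoot z → FlatAt l z ψ) : S ψ = 0 := by
  refine hS.eq_zero_of_flatAt hq hp ?_ (fun L => ?_) hψ hψ' hF
  · rw [← coe_aeval_coordElem]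
    exact (Polynomial.aeval coordElem p).2
  · obtain ⟨a, b, rfl⟩ := exists_eq_linForm L
    exact h a b

theorem WFunctional.conj_nilpotent {q : ℝ} (hq : 0 < q) {l : ℕ} {S : Dst}
    (hS : WFunctional q l S) (u : subGaussianAlgebra) (ζ : ℂ)
    (h : ∀ x y, hS.toLinearMap hq
      (u * (coordElem - algebraMap ℂ subGaussianAlgebra ζ) * expElem x y) = 0)
    (v : subGaussianAlgebra) : hS.toLinearMap hq
      (u * (conjElem - algebraMap ℂ subGaussianAlgebra ((starRingEnd ℂ) ζ)) ^ (l + 1) * v) = 0 := by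
  set g := conjElem - algebraMap ℂ subGaussianAlgebra ((starRingEnd ℂ) ζ) with hg
  have hgζ : (g : ℂ → ℂ) ζ = 0 := by
    simp [hg, conjElem]
  have hflat : FlatAt l ζ (fun w => v.1 w * g.1 w ^ (l + 1)) :=
    (flatAt_pow (SubGaussian.smooth g.2) hgζ l).mul_left
      (contDiff_nat_of_top (SubGaussian.smooth v.2) l)
      (contDiff_nat_of_top ((SubGaussian.smooth g.2).pow (l + 1)) l)
  have hmem : SubGaussian (fun w => v.1 w * g.1 w ^ (l + 1)) := (v * g ^ (l + 1)).2
  have := (hS.mul_left hq u.2).eq_zero_of_annihilator (half_pos hq)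
    (Polynomial.X_sub_C_ne_zero ζ) (fun x y => ?_) hmem.smooth (hmem.memLambda (half_pos hq) l)
    (fun z hz => ?_)
  · rw [← this]
    refine congrArg S ?_
    funext w
    simp
    ring
  · rw [← h x y]
    refine congrArg S ?_
    funext w
    simp [coordElem]
    ring
  · rw [Polynomial.root_X_sub_C] at hz
    rwa [← hz]

theorem rank_le_of_matK {T : Dst} {N : ℕ} (hK : ∀ zs : ℕ → ℂ, InfRankLE (matK T zs) N)
    (m : ℕ) (a b : Fin m → ℂ) :
    (Matrix.of fun i j => T (expElem (a i) (b j)).1).rank ≤ N := by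
  let zs : ℕ → ℂ := fun k => if h : k < m then (starRingEnd ℂ) (a ⟨k, h⟩) else
    if h : k - m < m then b ⟨k - m, h⟩ else 0
  convert! hK zs m (fun i => i) (fun j => m + j) using 2
  ext i j
  simp only [Matrix.of_apply, matK, toeplitzForm]
  refine congrArg T ?_
  funext w
  simp [zs, repKer, expElem, linForm_apply, exp_add, ← exp_conj, mul_comm]

theorem ExpFunctional.exists_annihilator_of_rank_le {A : Type*} [CommRing A] [Algebra ℂ A]
    {τ : A →ₗ[ℂ] ℂ} {Z Zb : A} {e : ℂ → ℂ → A} (h : ExpFunctional τ Z Zb e) {N l n : ℕ}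
    (hrank : ∀ (m : ℕ) (a b : Fin m → ℂ), (Matrix.of fun i j => τ (e (a i) (b j))).rank ≤ N)
    (hb : ∀ c d, ∃ K : ℝ, ∀ s, ‖τ (e (c + s) (d - (starRingEnd ℂ) s))‖ ≤ K * (1 + ‖s‖) ^ l)
    (hn : ∀ (u : A) (ζ : ℂ), (∀ x y, τ (u * (Z - algebraMap ℂ A ζ) * e x y) = 0) →
      ∀ v, τ (u * (Zb - algebraMap ℂ A ((starRingEnd ℂ) ζ)) ^ n * v) = 0) :
    ∃ p : Polynomial ℂ, p ≠ 0 ∧ (∀ x y, τ (Polynomial.aeval Z p * e x y) = 0) ∧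
      p.roots.toFinset.card ≤ N := by
  obtain ⟨r, hr, a, b, hab, hG⟩ := exists_separation_of_rank_le (G := fun x y => τ (e x y)) hrank
  set M := Matrix.of fun i j => τ (e (a i) (b j)) with hM
  have h1 : ∀ y, Differentiable ℂ fun x => τ (e x y) := fun y x => by
    simpa using (h.hasDerivAt_left 1 x y).differentiableAt
  have h2 : ∀ x, Differentiable ℂ fun y => τ (e x y) := fun x y => by
    simpa using (h.hasDerivAt_right 1 x y).differentiableAt
  let c : Fin r → ℂ → ℂ := fun j y => ∑ i, M⁻¹ j i * τ (e (a i) y)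
  have hc : ∀ j, Differentiable ℂ (c j) := fun j =>
    Differentiable.fun_sum fun i _ => (h2 (a i)).const_mul _
  have hcb : (Matrix.of fun j k => c j (b k)).det ≠ 0 := by
    have : (Matrix.of fun j k => c j (b k)) = M⁻¹ * M := by
      ext j k
      simp [c, Matrix.mul_apply, hM]
    rw [this, Matrix.nonsing_inv_mul _ hab.isUnit, Matrix.det_one]
    exact one_ne_zero
  obtain ⟨U, hU, Ω, hΩ, h0, hUΩ⟩ := exists_finiteDimensional_translate
    (G := fun x y => τ (e x y)) h1 hb hab hc hcb hG
  obtain ⟨p, hp, hpa, hpr⟩ := h.exists_annihilator_card_roots_le (c := c) hG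
    (h.exists_annihilator (c := c) hG hΩ h0 hUΩ) hn
  exact ⟨p, hp, hpa, hpr.trans hr⟩

/-- **Finite rank theorem for Toeplitz operators with distributional symbols.**
If `𝐅 = ωF ∈ Λ'_{q,l}` (here `T` is the pairing of `𝐅`, so that the Toeplitz form is
`𝐭_F(u,v) = ⟨𝐅, u v̄⟩ = T (u v̄)`), and the infinite matrices `𝔓(F)` and `𝔎(F)` (the
latter for every sequence of points) have rank at most `N`, then `𝐅` is a finite
combination of at most `N` Dirac δ-distributions and their derivatives. -/
theorem finite_rank_toeplitz_distribution
    (q : ℝ) (hq : 0 < q) (l N : ℕ) (T : Dst) (hT : MemLambdaDual q l T)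
    (hP : InfRankLE (matP T) N)
    (hK : ∀ zs : ℕ → ℂ, InfRankLE (matK T zs) N) :
    ∃ N₀ : ℕ, N₀ ≤ N ∧
      ∃ (pts : Fin N₀ → ℂ) (M : ℕ) (c : Fin N₀ → ℕ → ℕ → ℂ),
        ∀ ψ : ℂ → ℂ, MemDq q ψ →
          T ψ = ∑ j : Fin N₀, ∑ a ∈ Finset.range (M + 1), ∑ b ∈ Finset.range (M + 1),
            c j a b * partialD a b ψ (pts j) := by
  have hS := hT.wFunctional
  obtain ⟨p, hp, hpa, hcard⟩ := (hS.expFunctional hq).exists_annihilator_of_rank_le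
    (rank_le_of_matK hK) (hS.exists_growth_bound hq) (hS.conj_nilpotent hq)
  let pts : Fin p.roots.toFinset.card → ℂ := fun j => p.roots.toFinset.equivFin.symm j
  obtain ⟨c, hc⟩ := hS.exists_eq_sum_partialD pts fun ψ hψ hflat => by
    refine hS.eq_zero_of_annihilator hq hp (fun x y => ?_) hψ.1 (hψ.memLambda l) fun z hz => ?_
    · rw [← hpa x y]
      refine congrArg T ?_
      funext w
      rw [← congrFun (coe_aeval_coordElem p) w]
      rfl
    · have := hflat (p.roots.toFinset.equivFin ⟨z, by simpa [hp] using hz⟩)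
      simpa [pts] using this
  exact ⟨_, hcard, pts, l, c, hc⟩
end
end

section
/- Suppose 𝐟 is a distribution on ℂ with compact support (𝐟 ∈ 𝓔'(ℂ)). Then the following two properties are equivalent: (a) there exists a distribution 𝐠 ∈ 𝓔'(ℂ) with ∂̄𝐠 = 𝐟, whose support is contained in the complement of the unbounded connected component of the complement of the support of 𝐟; (b) 𝐟 vanishes on all analytic polynomials of z, i.e., ⟨𝐟, z^k⟩ = 0 for all k ∈ ℤ₊. -/
open MeasureTheory Filter Complex Metric

noncomputable section

/-- Membership in `𝓔'(ℂ)`: a linear functional on smooth functions which has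
compact support and is continuous (bounded by a `C^n`-seminorm on a compact set). -/
def MemEprime (T : Dst) : Prop :=
  (∀ ψ φ, ContDiff ℝ (⊤ : ℕ∞) ψ → ContDiff ℝ (⊤ : ℕ∞) φ → T (ψ + φ) = T ψ + T φ) ∧
  (∀ (c : ℂ) (ψ), ContDiff ℝ (⊤ : ℕ∞) ψ → T (c • ψ) = c * T ψ) ∧
  ∃ (K : Set ℂ) (n : ℕ) (C : ℝ), IsCompact K ∧
    (∀ ψ, ContDiff ℝ (⊤ : ℕ∞) ψ → Disjoint (tsupport ψ) K → T ψ = 0) ∧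
    ∀ ψ, ContDiff ℝ (⊤ : ℕ∞) ψ →
      ‖T ψ‖ ≤ C * sSup {r : ℝ | ∃ m ≤ n, ∃ z ∈ K, r = ‖iteratedFDeriv ℝ m ψ z‖}

/-- The support of a distribution: `z` lies in the support iff every open
neighbourhood of `z` carries a smooth test function on which `T` is nonzero. -/
def distSupport (T : Dst) : Set ℂ :=
  {z : ℂ | ∀ U : Set ℂ, IsOpen U → z ∈ U →
      ∃ ψ : ℂ → ℂ, ContDiff ℝ (⊤ : ℕ∞) ψ ∧ tsupport ψ ⊆ U ∧ T ψ ≠ 0}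

theorem dbarFun_eq_polar (v : ℂ → ℂ) (z : ℂ) (θ : ℝ) :
    Complex.exp (-(θ * Complex.I)) * dbarFun v z =
      (fderiv ℝ v z (Complex.exp (θ * Complex.I)) +
        Complex.I * fderiv ℝ v z (Complex.I * Complex.exp (θ * Complex.I))) / 2 := by
  have h1 : Complex.exp (θ * Complex.I) =
      Real.cos θ • (1 : ℂ) + Real.sin θ • Complex.I := by
    rw [Complex.exp_mul_I]; simp
  have h2 : Complex.I * Complex.exp (θ * Complex.I) =
      Real.cos θ • Complex.I - Real.sin θ • (1 : ℂ) := by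
    rw [Complex.exp_mul_I]
    simp only [Complex.real_smul, mul_one, Complex.ofReal_cos, Complex.ofReal_sin]
    linear_combination Complex.sin θ * Complex.I_mul_I
  rw [h2, h1, ← neg_mul, Complex.exp_mul_I]
  simp only [map_add, map_sub, map_smul]
  simp only [Complex.real_smul, dbarFun, Complex.cos_neg,
    Complex.sin_neg, Complex.ofReal_cos, Complex.ofReal_sin]
  linear_combination (-(Complex.sin θ * fderiv ℝ v z Complex.I / 2)) * Complex.I_mul_I

theorem integrableOn_polar_target {G : ℝ × ℝ → ℂ} (hG : Continuous G) {ρ : ℝ}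
    (hρ : ∀ p : ℝ × ℝ, ρ < p.1 → G p = 0) :
    IntegrableOn G (Set.Ioi (0 : ℝ) ×ˢ Set.Ioo (-Real.pi) Real.pi) := by
  have h1 : IntegrableOn G (Set.Icc (0 : ℝ) ρ ×ˢ Set.Icc (-Real.pi) Real.pi) :=
    hG.continuousOn.integrableOn_compact (isCompact_Icc.prod isCompact_Icc)
  refine h1.of_forall_sdiff_eq_zero (measurableSet_Ioi.prod measurableSet_Ioo) ?_
  rintro ⟨r, θ⟩ ⟨⟨h2, h3⟩, h4⟩
  refine hρ _ ?_
  by_contra h5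
  exact h4 ⟨⟨le_of_lt h2, not_lt.1 h5⟩, ⟨h3.1.le, h3.2.le⟩⟩

/-- The function `w ↦ 1/w` is, up to the factor `π`, a fundamental solution of `∂̄`. -/
theorem integral_inv_mul_dbarFun {v : ℂ → ℂ} (hv : ContDiff ℝ 1 v) (hc : HasCompactSupport v) :
    ∫ w : ℂ, w⁻¹ * dbarFun v w = -(Real.pi * v 0) := by
  have hd : Continuous (fderiv ℝ v) := hv.continuous_fderiv one_ne_zero
  obtain ⟨ρ, hρ⟩ := hc.isCompact.isBounded.subset_closedBall 0
  have hv0 : ∀ z : ℂ, ρ < ‖z‖ → v z = 0 := fun z hz => by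
    by_contra h
    have := hρ (subset_tsupport _ h)
    simp only [mem_closedBall, dist_zero_right] at this
    linarith
  have hf0 : ∀ z : ℂ, ρ < ‖z‖ → fderiv ℝ v z = 0 := fun z hz => by
    by_contra h
    have := hρ (support_fderiv_subset ℝ h)
    simp only [mem_closedBall, dist_zero_right] at this
    linarith
  set E : ℝ → ℂ := fun θ => Complex.exp (θ * Complex.I) with hE
  have hEc : Continuous E := by fun_prop
  have hEn : ∀ θ, ‖E θ‖ = 1 := fun θ => Complex.norm_exp_ofReal_mul_I θ
  have hEd : ∀ θ, HasDerivAt E (Complex.I * E θ) θ := fun θ => by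
    have := ((Complex.ofRealCLM.hasDerivAt (x := θ)).mul_const Complex.I).cexp
    simpa [hE, mul_comm] using this
  set A : ℝ × ℝ → ℂ := fun p => fderiv ℝ v (p.1 * E p.2) (E p.2) with hA
  set B : ℝ × ℝ → ℂ := fun p => fderiv ℝ v (p.1 * E p.2) (Complex.I * E p.2) with hB
  have hp : Continuous fun p : ℝ × ℝ => (p.1 : ℂ) * E p.2 := by fun_prop
  have hAc : Continuous A := (hd.comp hp).clm_apply (by fun_prop)
  have hBc : Continuous B := (hd.comp hp).clm_apply (by fun_prop)
  have hn : ∀ p : ℝ × ℝ, ρ < p.1 → fderiv ℝ v (p.1 * E p.2) = 0 := fun p h => hf0 _ <| by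
    rw [norm_mul, hEn, mul_one, Complex.norm_real]
    exact h.trans_le (le_abs_self _)
  have hAi := integrableOn_polar_target hAc (ρ := ρ) fun p h => by simp [hA, hn p h]
  have hBi := integrableOn_polar_target hBc (ρ := ρ) fun p h => by simp [hB, hn p h]
  have e1 : ∫ w : ℂ, w⁻¹ * dbarFun v w =
      ∫ p in Set.Ioi (0 : ℝ) ×ˢ Set.Ioo (-Real.pi) Real.pi, (A p + Complex.I * B p) / 2 := by
    rw [← Complex.integral_comp_polarCoord_symm]
    refine setIntegral_congr_fun (measurableSet_Ioi.prod measurableSet_Ioo) ?_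
    rintro ⟨r, θ⟩ ⟨h1, -⟩
    have hr : (r : ℂ) ≠ 0 := by exact_mod_cast (ne_of_gt h1)
    have e : Complex.polarCoord.symm (r, θ) = r * E θ := by
      simp [hE, Complex.exp_mul_I]
    simp only [e, hA, hB, hE]
    rw [← dbarFun_eq_polar, Complex.real_smul, Complex.exp_neg, mul_inv]
    field_simp
  have e2 : ∫ p in Set.Ioi (0 : ℝ) ×ˢ Set.Ioo (-Real.pi) Real.pi, A p =
      -(2 * Real.pi * v 0) := by
    rw [Measure.volume_eq_prod, ← setIntegral_prod_swap,
      setIntegral_prod (fun p : ℝ × ℝ => A p.swap) hAi.swap]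
    have : ∀ θ ∈ Set.Ioo (-Real.pi) Real.pi,
        ∫ r in Set.Ioi (0 : ℝ), A (Prod.swap (θ, r)) = -v 0 := fun θ _ => by
      have hder : ∀ r ∈ Set.Ici (0 : ℝ),
          HasDerivAt (fun r : ℝ => v (r * E θ)) (A (r, θ)) r := fun r _ => by
        have h1 : HasDerivAt (fun r : ℝ => (r : ℂ) * E θ) (E θ) r := by
          simpa using (Complex.ofRealCLM.hasDerivAt (x := r)).mul_const (E θ)
        exact ((hv.differentiable one_ne_zero _).hasFDerivAt).comp_hasDerivAt r h1
      have hz : ∀ r : ℝ, ρ < r → v (r * E θ) = 0 := fun r h => hv0 _ <| by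
        rw [norm_mul, hEn, mul_one, Complex.norm_real]
        exact h.trans_le (le_abs_self _)
      have hi : IntegrableOn (fun r : ℝ => A (r, θ)) (Set.Ioi 0) := by
        have : IntegrableOn (fun r : ℝ => A (r, θ)) (Set.Icc 0 ρ) :=
          Continuous.integrableOn_Icc (by fun_prop)
        refine this.of_forall_sdiff_eq_zero measurableSet_Ioi ?_
        rintro r ⟨h1, h2⟩
        have : ρ < r := by
          by_contra h5
          exact h2 ⟨le_of_lt h1, not_lt.1 h5⟩
        simp [hA, hn (r, θ) this]
      have ht : Tendsto (fun r : ℝ => v (r * E θ)) atTop (nhds 0) :=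
        tendsto_const_nhds.congr' <| (eventually_gt_atTop ρ).mono fun r h => (hz r h).symm
      have := integral_Ioi_of_hasDerivAt_of_tendsto' hder hi ht
      simpa using this
    rw [setIntegral_congr_fun measurableSet_Ioo this]
    rw [setIntegral_const, Measure.real, Real.volume_Ioo,
      ENNReal.toReal_ofReal (by linarith [Real.pi_pos]), Complex.real_smul]
    push_cast
    ring
  have e3 : ∫ p in Set.Ioi (0 : ℝ) ×ˢ Set.Ioo (-Real.pi) Real.pi, B p = 0 := by
    rw [Measure.volume_eq_prod, setIntegral_prod _ hBi]
    have : ∀ r ∈ Set.Ioi (0 : ℝ),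
        ∫ θ in Set.Ioo (-Real.pi) Real.pi, B (r, θ) = 0 := fun r hr => by
      have hr : (r : ℂ) ≠ 0 := by exact_mod_cast (ne_of_gt hr)
      rw [← integral_Ioc_eq_integral_Ioo,
        ← intervalIntegral.integral_of_le (by linarith [Real.pi_pos])]
      have hder : ∀ θ ∈ Set.uIcc (-Real.pi) Real.pi,
          HasDerivAt (fun θ : ℝ => (r : ℂ)⁻¹ * v (r * E θ)) (B (r, θ)) θ := fun θ _ => by
        have h1 : HasDerivAt (fun θ : ℝ => (r : ℂ) * E θ) (r * (Complex.I * E θ)) θ :=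
          (hEd θ).const_mul _
        have h2 := (((hv.differentiable one_ne_zero _).hasFDerivAt).comp_hasDerivAt θ
          h1).const_mul (r : ℂ)⁻¹
        refine h2.congr_deriv ?_
        rw [← Complex.real_smul (x := r) (z := Complex.I * E θ), map_smul, Complex.real_smul,
          inv_mul_cancel_left₀ hr]
      rw [intervalIntegral.integral_eq_sub_of_hasDerivAt hder
        (Continuous.intervalIntegrable (by fun_prop) _ _)]
      have : E Real.pi = E (-Real.pi) := by
        simp [hE, Complex.exp_neg]
      simp [this]
    rw [setIntegral_congr_fun measurableSet_Ioi this]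
    simp
  rw [e1, integral_div, integral_add hAi (hBi.const_mul _), integral_const_mul, e2, e3]
  ring

open scoped Convolution

/-- The Cauchy kernel `w ↦ 1/(πw)`. -/
def cauchyKernel (w : ℂ) : ℂ := (Real.pi * w)⁻¹

/-- The Cauchy transform, i.e. the convolution with the Cauchy kernel. -/
def cauchyTransform (u : ℂ → ℂ) : ℂ → ℂ :=
  cauchyKernel ⋆[ContinuousLinearMap.mul ℝ ℂ, volume] u

theorem locallyIntegrable_cauchyKernel : LocallyIntegrable cauchyKernel (volume : Measure ℂ) := by
  refine locallyIntegrable_of_norm_le_rpow (μ := volume) (f := cauchyKernel) (C := Real.pi⁻¹)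
    (α := 1) ?_ ?_ ?_ ?_
  · simp
  · norm_num
  · filter_upwards with w
    simp [cauchyKernel, abs_of_pos Real.pi_pos, Real.rpow_neg_one, mul_comm]
  · exact (by unfold cauchyKernel; fun_prop : Measurable cauchyKernel).aestronglyMeasurable

theorem contDiff_cauchyTransform {u : ℂ → ℂ} (hu : ContDiff ℝ (⊤ : ℕ∞) u)
    (hc : HasCompactSupport u) : ContDiff ℝ (⊤ : ℕ∞) (cauchyTransform u) :=
  hc.contDiff_convolution_right _ locallyIntegrable_cauchyKernel hu

theorem cauchyTransform_apply (u : ℂ → ℂ) (z : ℂ) :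
    cauchyTransform u z = ∫ w, cauchyKernel w * u (z - w) := rfl

theorem cauchyTransform_zero : cauchyTransform 0 = 0 := by
  ext z
  simp [cauchyTransform_apply]

theorem cauchyTransform_smul (c : ℂ) (u : ℂ → ℂ) :
    cauchyTransform (c • u) = c • cauchyTransform u := by
  ext z
  simp only [cauchyTransform_apply, Pi.smul_apply, smul_eq_mul, ← integral_const_mul]
  congr 1 with w
  ring

theorem cauchyTransform_add {u v : ℂ → ℂ} (hu : Continuous u) (hv : Continuous v)
    (hcu : HasCompactSupport u) (hcv : HasCompactSupport v) :
    cauchyTransform (u + v) = cauchyTransform u + cauchyTransform v := by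
  have key : ∀ {u : ℂ → ℂ}, Continuous u → HasCompactSupport u →
      ConvolutionExists cauchyKernel u (ContinuousLinearMap.mul ℝ ℂ) volume := fun h1 h2 =>
    h2.convolutionExists_right _ locallyIntegrable_cauchyKernel h1
  exact (key hu hcu).distrib_add (key hv hcv)

/-- The Cauchy transform solves the inhomogeneous `∂̄`-equation. -/
theorem dbarFun_cauchyTransform {u : ℂ → ℂ} (hu : ContDiff ℝ 1 u) (hc : HasCompactSupport u) :
    dbarFun (cauchyTransform u) = u := by
  ext z
  have h := (hc.hasFDerivAt_convolution_right (ContinuousLinearMap.mul ℝ ℂ)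
    locallyIntegrable_cauchyKernel hu z).fderiv
  have hex : ConvolutionExists cauchyKernel (fderiv ℝ u)
      ((ContinuousLinearMap.mul ℝ ℂ).precompR ℂ) volume :=
    (hc.fderiv ℝ).convolutionExists_right _ locallyIntegrable_cauchyKernel
      (hu.continuous_fderiv one_ne_zero)
  have hint : ∀ y : ℂ, fderiv ℝ (cauchyTransform u) z y =
      ∫ w, cauchyKernel w * fderiv ℝ u (z - w) y := fun y => by
    rw [cauchyTransform, h, convolution, ContinuousLinearMap.integral_apply (hex z)]
    rfl
  have hint' : ∀ y : ℂ, Integrable fun w => cauchyKernel w * fderiv ℝ u (z - w) y := fun y =>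
    ContinuousLinearMap.integrable_comp (ContinuousLinearMap.apply ℝ ℂ y) (hex z)
  set v : ℂ → ℂ := fun w => u (z - w) with hv
  have hv1 : ContDiff ℝ 1 v := hu.comp (contDiff_const.sub contDiff_id)
  have hvc : HasCompactSupport v := hc.comp_homeomorph (Homeomorph.subLeft z)
  have hvd : ∀ w, dbarFun v w = -dbarFun u (z - w) := fun w => by
    have : fderiv ℝ v w = -fderiv ℝ u (z - w) := by
      have h1 := ((hu.differentiable one_ne_zero (z - w)).hasFDerivAt).comp w
        ((hasFDerivAt_id (𝕜 := ℝ) w).const_sub z)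
      rw [show v = u ∘ fun w => z - w from rfl, h1.fderiv]
      ext y
      simp
    simp only [dbarFun, this, neg_apply]
    ring
  have key := integral_inv_mul_dbarFun hv1 hvc
  have hpi : (Real.pi : ℂ) ≠ 0 := by exact_mod_cast Real.pi_ne_zero
  have e : dbarFun (cauchyTransform u) z = -(Real.pi : ℂ)⁻¹ * ∫ w : ℂ, w⁻¹ * dbarFun v w := by
    rw [dbarFun, hint, hint, ← integral_const_mul, ← integral_const_mul,
      ← integral_add (hint' 1) ((hint' Complex.I).const_mul _), ← integral_div]
    congr 1 with w
    rw [hvd, dbarFun, cauchyKernel, mul_inv]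
    ring
  rw [e, key]
  simp [hv, hpi]

theorem norm_iteratedFDeriv_convolution_le {ρ σ : ℝ} (m : ℕ) :
    ∀ {E F : Type} [NormedAddCommGroup E] [NormedSpace ℝ E] [NormedAddCommGroup F]
      [NormedSpace ℝ F] (L : ℂ →L[ℝ] E →L[ℝ] F) {u : ℂ → E} {M : ℝ},
      ContDiff ℝ (⊤ : ℕ∞) u → tsupport u ⊆ closedBall 0 σ →
      (∀ y, ‖iteratedFDeriv ℝ m u y‖ ≤ M) → ∀ x ∈ closedBall (0 : ℂ) ρ,
      ‖iteratedFDeriv ℝ m (cauchyKernel ⋆[L, volume] u) x‖ ≤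
        ‖L‖ * (∫ w in closedBall (0 : ℂ) (ρ + σ), ‖cauchyKernel w‖) * M := by
  induction m with
  | zero =>
    intro E F _ _ _ _ L u M hu hs hM x hx
    simp only [norm_iteratedFDeriv_zero] at hM ⊢
    have hi : IntegrableOn cauchyKernel (closedBall (0 : ℂ) (ρ + σ)) :=
      locallyIntegrable_cauchyKernel.integrableOn_isCompact (isCompact_closedBall _ _)
    have hsub : ∀ t ∉ closedBall (0 : ℂ) (ρ + σ), L (cauchyKernel t) (u (x - t)) = 0 := by
      intro t ht
      have : u (x - t) = 0 := by
        by_contra h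
        have h1 := hs (subset_tsupport _ h)
        simp only [mem_closedBall, dist_zero_right] at h1 hx ht
        have := norm_sub_le x (x - t)
        rw [sub_sub_cancel] at this
        linarith
      simp [this]
    rw [convolution, ← setIntegral_eq_integral_of_forall_compl_eq_zero hsub]
    have hM0 : 0 ≤ M := (norm_nonneg _).trans (hM 0)
    rw [mul_right_comm, ← integral_const_mul]
    refine norm_integral_le_of_norm_le (hi.norm.const_mul _) ?_
    filter_upwards with t
    calc ‖L (cauchyKernel t) (u (x - t))‖ ≤ ‖L‖ * ‖cauchyKernel t‖ * ‖u (x - t)‖ :=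
          L.le_opNorm₂ _ _
      _ ≤ ‖L‖ * ‖cauchyKernel t‖ * M := by gcongr; exact hM _
      _ = ‖L‖ * M * ‖cauchyKernel t‖ := by ring
  | succ m ih =>
    intro E F _ _ _ _ L u M hu hs hM x hx
    have hc : HasCompactSupport u :=
      (isCompact_closedBall (0 : ℂ) σ).of_isClosed_subset (isClosed_tsupport _) hs
    have hf : fderiv ℝ (cauchyKernel ⋆[L, volume] u) =
        cauchyKernel ⋆[L.precompR ℂ, volume] fderiv ℝ u := by
      ext1 y
      exact (hc.hasFDerivAt_convolution_right L locallyIntegrable_cauchyKernel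
        (hu.of_le (by exact_mod_cast le_top)) y).fderiv
    rw [← norm_iteratedFDeriv_fderiv, hf]
    have hM0 : 0 ≤ M := (norm_nonneg _).trans (hM 0)
    refine (ih (L.precompR ℂ) (M := M) (hu.fderiv_right (by simp))
      ((tsupport_fderiv_subset ℝ).trans hs) (fun y => ?_) x hx).trans ?_
    · rw [norm_iteratedFDeriv_fderiv]
      exact hM y
    · gcongr
      exact ContinuousLinearMap.norm_precompR_le _ _

theorem exists_smooth_cutoff {s U : Set ℂ} (hs : IsClosed s) (hU : IsOpen U) (h : s ⊆ U) :
    ∃ η : ℂ → ℂ, ContDiff ℝ (⊤ : ℕ∞) η ∧ (∀ᶠ z in nhdsSet s, η z = 1) ∧ tsupport η ⊆ U := by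
  obtain ⟨t, ht, hst, htU⟩ := normal_exists_closure_subset hs hU h
  obtain ⟨η, h1, h0, -⟩ := exists_contMDiffMap_one_nhds_of_subset_interior
    (modelWithCornersSelf ℝ ℂ) (n := (⊤ : ℕ∞)) hs (t := t) (by rwa [ht.interior_eq])
  refine ⟨fun z => (η z : ℂ), Complex.ofRealCLM.contDiff.comp η.contMDiff.contDiff, ?_, ?_⟩
  · filter_upwards [h1] with z hz
    simp [hz]
  · refine (closure_mono fun z hz => ?_).trans htU
    by_contra hzt
    exact hz (by simp [h0 z hzt])

theorem contDiff_mul_of_tsupport_subset {η h : ℂ → ℂ} {U : Set ℂ} (hU : IsOpen U)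
    (hη : ContDiff ℝ (⊤ : ℕ∞) η) (hηU : tsupport η ⊆ U) (hh : ContDiffOn ℝ (⊤ : ℕ∞) h U) :
    ContDiff ℝ (⊤ : ℕ∞) (fun z => η z * h z) := by
  rw [contDiff_iff_contDiffAt]
  intro z
  by_cases hz : z ∈ tsupport η
  · exact hη.contDiffAt.mul (hh.contDiffAt (hU.mem_nhds (hηU hz)))
  · refine (contDiffAt_const (c := (0 : ℂ))).congr_of_eventuallyEq ?_
    filter_upwards [notMem_tsupport_iff_eventuallyEq.1 hz] with w hw
    simp [hw]

namespace MemEprime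

variable {f : Dst}

theorem map_zero (hf : MemEprime f) : f 0 = 0 := by
  simpa using hf.2.1 0 0 contDiff_const

theorem map_sub (hf : MemEprime f) {ψ φ : ℂ → ℂ} (hψ : ContDiff ℝ (⊤ : ℕ∞) ψ)
    (hφ : ContDiff ℝ (⊤ : ℕ∞) φ) : f (ψ - φ) = f ψ - f φ := by
  have h1 : ContDiff ℝ (⊤ : ℕ∞) ((-1 : ℂ) • φ) := contDiff_const.smul hφ
  have h := hf.1 ψ ((-1 : ℂ) • φ) hψ h1
  rw [hf.2.1 _ _ hφ] at h
  rw [show ψ - φ = ψ + (-1 : ℂ) • φ by ext z; simp [sub_eq_add_neg], h]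
  ring

theorem map_sum_eq_zero (hf : MemEprime f) {ι : Type*} (s : Finset ι) {ψ : ι → ℂ → ℂ}
    (hψ : ∀ i, ContDiff ℝ (⊤ : ℕ∞) (ψ i)) (h0 : ∀ i, f (ψ i) = 0) :
    f (fun z => ∑ i ∈ s, ψ i z) = 0 := by
  classical
  induction s using Finset.induction_on with
  | empty => exact (by simpa only [Finset.sum_empty] using! hf.map_zero)
  | insert a s ha ih =>
    have := hf.1 (ψ a) (fun z => ∑ i ∈ s, ψ i z) (hψ a) (ContDiff.sum fun i _ => hψ i)
    rw [ih, h0, add_zero] at this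
    simp only [Finset.sum_insert ha]
    exact this

theorem exists_bound (hf : MemEprime f) : ∃ (K : Set ℂ) (n : ℕ) (C : ℝ), IsCompact K ∧ 0 ≤ C ∧
    (∀ ψ, ContDiff ℝ (⊤ : ℕ∞) ψ → Disjoint (tsupport ψ) K → f ψ = 0) ∧
    ∀ ψ, ContDiff ℝ (⊤ : ℕ∞) ψ → ∀ M, 0 ≤ M →
      (∀ m ≤ n, ∀ z ∈ K, ‖iteratedFDeriv ℝ m ψ z‖ ≤ M) → ‖f ψ‖ ≤ C * M := by
  obtain ⟨-, -, K, n, C, hK, h0, hb⟩ := hf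
  refine ⟨K, n, |C|, hK, abs_nonneg _, h0, fun ψ hψ M hM h => (hb ψ hψ).trans ?_⟩
  have h1 : sSup {r : ℝ | ∃ m ≤ n, ∃ z ∈ K, r = ‖iteratedFDeriv ℝ m ψ z‖} ≤ M := by
    refine Real.sSup_le ?_ hM
    rintro r ⟨m, hm, z, hz, rfl⟩
    exact h m hm z hz
  have h2 : 0 ≤ sSup {r : ℝ | ∃ m ≤ n, ∃ z ∈ K, r = ‖iteratedFDeriv ℝ m ψ z‖} := by
    refine Real.sSup_nonneg ?_
    rintro r ⟨m, hm, z, hz, rfl⟩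
    exact norm_nonneg _
  calc C * _ ≤ |C| * _ := mul_le_mul_of_nonneg_right (le_abs_self C) h2
    _ ≤ |C| * M := by gcongr

end MemEprime

theorem isClosed_distSupport (T : Dst) : IsClosed (distSupport T) := by
  rw [← isOpen_compl_iff, isOpen_iff_forall_mem_open]
  intro z hz
  simp only [distSupport, Set.mem_compl_iff, Set.mem_ofPred_eq, not_forall] at hz
  obtain ⟨U, hU, hzU, h⟩ := hz
  exact ⟨U, fun w hw hwS => h (hwS U hU hw), hU, hzU⟩

namespace MemEprime

variable {f : Dst}

theorem isCompact_distSupport (hf : MemEprime f) : IsCompact (distSupport f) := by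
  obtain ⟨K, n, C, hK, -, h0, -⟩ := hf.exists_bound
  refine hK.of_isClosed_subset (isClosed_distSupport f) fun z hz => ?_
  by_contra hzK
  obtain ⟨ψ, hψ, hs, hne⟩ := hz _ hK.isClosed.isOpen_compl hzK
  exact hne (h0 ψ hψ (Set.subset_compl_iff_disjoint_right.1 hs))

theorem exists_open_of_disjoint_distSupport (hf : MemEprime f) {L : Set ℂ} (hL : IsCompact L)
    (hd : Disjoint L (distSupport f)) : ∃ V, IsOpen V ∧ L ⊆ V ∧
      ∀ ψ, ContDiff ℝ (⊤ : ℕ∞) ψ → HasCompactSupport ψ → tsupport ψ ⊆ V → f ψ = 0 := by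
  refine hL.induction_on (p := fun L => ∃ V, IsOpen V ∧ L ⊆ V ∧
    ∀ ψ, ContDiff ℝ (⊤ : ℕ∞) ψ → HasCompactSupport ψ → tsupport ψ ⊆ V → f ψ = 0) ?_ ?_ ?_ ?_
  · refine ⟨∅, isOpen_empty, subset_rfl, fun ψ _ _ h => ?_⟩
    rw [tsupport_eq_empty_iff.1 (Set.subset_empty_iff.1 h), hf.map_zero]
  · rintro s t hst ⟨V, hV, htV, h⟩
    exact ⟨V, hV, hst.trans htV, h⟩
  · rintro s t ⟨V, hV, hsV, h⟩ ⟨W, hW, htW, h'⟩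
    refine ⟨V ∪ W, hV.union hW, Set.union_subset_union hsV htW, fun ψ hψ hc hsup => ?_⟩
    obtain ⟨η, hη, hη1, hηV⟩ := exists_smooth_cutoff
      (s := tsupport ψ \ W) ((isClosed_tsupport ψ).sdiff hW) hV
      (fun z hz => (hsup hz.1).resolve_right hz.2)
    have hηψ : ContDiff ℝ (⊤ : ℕ∞) (η * ψ) := hη.mul hψ
    have hηψ' : ContDiff ℝ (⊤ : ℕ∞) ((1 - η) * ψ) := (contDiff_const.sub hη).mul hψ
    have h1 : f (η * ψ) = 0 :=
      h _ hηψ hc.mul_left ((tsupport_mul_subset_left).trans hηV)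
    have h2 : f ((1 - η) * ψ) = 0 := by
      refine h' _ hηψ' hc.mul_left fun z hz => ?_
      by_contra hzW
      refine absurd hz (notMem_tsupport_iff_eventuallyEq.2 ?_)
      filter_upwards [(eventually_nhdsSet_iff_forall.1 hη1) z
        ⟨tsupport_mul_subset_right hz, hzW⟩] with w hw
      simp [hw]
    have h3 := hf.1 _ _ hηψ hηψ'
    rw [show η * ψ + (1 - η) * ψ = ψ by ring, h1] at h3
    rw [h3, zero_add]
    exact h2
  · intro z hz
    have : z ∉ distSupport f := Set.disjoint_left.1 hd hz
    simp only [distSupport, Set.mem_ofPred_eq, not_forall] at this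
    obtain ⟨U, hU, hzU, hn⟩ := this
    push Not at hn
    exact ⟨U, mem_nhdsWithin_of_mem_nhds (hU.mem_nhds hzU), U, hU, subset_rfl,
      fun ψ hψ _ hsup => hn ψ hψ hsup⟩

/-- A compactly supported distribution vanishes on functions that are zero near its support. -/
theorem eq_zero_of_eventually (hf : MemEprime f) {ψ : ℂ → ℂ} (hψ : ContDiff ℝ (⊤ : ℕ∞) ψ)
    (h : ∀ᶠ z in nhdsSet (distSupport f), ψ z = 0) : f ψ = 0 := by
  obtain ⟨K, n, C, hK, -, h0, -⟩ := hf.exists_bound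
  obtain ⟨r, hr⟩ := hK.isBounded.subset_ball 0
  obtain ⟨χ, hχ, hχ1, hχs⟩ := exists_smooth_cutoff hK.isClosed isOpen_ball hr
  have hc : HasCompactSupport χ := (isCompact_closedBall (0 : ℂ) r).of_isClosed_subset
    (isClosed_tsupport _) (hχs.trans ball_subset_closedBall)
  have hχψ : ContDiff ℝ (⊤ : ℕ∞) (χ * ψ) := hχ.mul hψ
  have hχψ' : ContDiff ℝ (⊤ : ℕ∞) ((1 - χ) * ψ) := (contDiff_const.sub hχ).mul hψ
  have h1 : f ((1 - χ) * ψ) = 0 := by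
    refine h0 _ hχψ' (Set.disjoint_right.2 fun z hz => ?_)
    refine notMem_tsupport_iff_eventuallyEq.2 ?_
    filter_upwards [(eventually_nhdsSet_iff_forall.1 hχ1) z hz] with w hw
    simp [hw]
  have hd : Disjoint (tsupport (χ * ψ)) (distSupport f) := by
    refine Set.disjoint_right.2 fun z hz => ?_
    refine notMem_tsupport_iff_eventuallyEq.2 ?_
    filter_upwards [(eventually_nhdsSet_iff_forall.1 h) z hz] with w hw
    simp [hw]
  have hc' : HasCompactSupport (χ * ψ) := hc.mul_right
  obtain ⟨V, -, hV, hfV⟩ := hf.exists_open_of_disjoint_distSupport hc' hd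
  have h2 := hf.1 _ _ hχψ hχψ'
  rwa [show χ * ψ + (1 - χ) * ψ = ψ by ring, h1, hfV _ hχψ hc' hV, add_zero] at h2

theorem congr_of_eventually (hf : MemEprime f) {ψ φ : ℂ → ℂ} (hψ : ContDiff ℝ (⊤ : ℕ∞) ψ)
    (hφ : ContDiff ℝ (⊤ : ℕ∞) φ) (h : ∀ᶠ z in nhdsSet (distSupport f), ψ z = φ z) :
    f ψ = f φ := by
  rw [← sub_eq_zero, ← hf.map_sub hψ hφ]
  refine hf.eq_zero_of_eventually (hψ.sub hφ) ?_
  filter_upwards [h] with z hz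
  simp [hz]

end MemEprime

theorem norm_iteratedFDeriv_le_of_differentiableOn {h : ℂ → ℂ} {U : Set ℂ} (hU : IsOpen U)
    (hh : DifferentiableOn ℂ h U) {z : ℂ} {δ ε : ℝ} (hδ : 0 < δ) (hz : closedBall z δ ⊆ U)
    (hε : ∀ w ∈ U, ‖h w‖ ≤ ε) (m : ℕ) :
    ‖iteratedFDeriv ℝ m h z‖ ≤ m.factorial * ε / δ ^ m := by
  have hzU : z ∈ U := hz (mem_closedBall_self hδ.le)
  have hc : ContDiffAt ℂ m h z := (hh.analyticAt (hU.mem_nhds hzU)).contDiffAt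
  rw [← hc.restrictScalars_iteratedFDeriv (𝕜 := ℝ), Function.comp_apply,
    ContinuousMultilinearMap.norm_restrictScalars, norm_iteratedFDeriv_eq_norm_iteratedDeriv]
  refine Complex.norm_iteratedDeriv_le_of_forall_mem_sphere_norm_le m hδ ?_
    fun w hw => hε w (hz (sphere_subset_closedBall hw))
  exact (hh.mono ((closure_ball_subset_closedBall).trans hz)).diffContOnCl

theorem DifferentiableOn.contDiffOn_real {h : ℂ → ℂ} {U : Set ℂ} (hh : DifferentiableOn ℂ h U)
    (hU : IsOpen U) : ContDiffOn ℝ (⊤ : ℕ∞) h U :=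
  (hh.contDiffOn hU).restrict_scalars ℝ

/-- For a fixed cutoff `η`, the pairing with `η h` is continuous in the holomorphic function `h`
with respect to uniform convergence. -/
theorem MemEprime.exists_bound_holomorphic {f : Dst} (hf : MemEprime f) {η : ℂ → ℂ} {U : Set ℂ}
    (hU : IsOpen U) (hη : ContDiff ℝ (⊤ : ℕ∞) η) (hc : HasCompactSupport η)
    (hηU : tsupport η ⊆ U) :
    ∃ C : ℝ, ∀ h : ℂ → ℂ, DifferentiableOn ℂ h U → ∀ ε : ℝ, 0 ≤ ε → (∀ z ∈ U, ‖h z‖ ≤ ε) →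
      ‖f (fun z => η z * h z)‖ ≤ C * ε := by
  obtain ⟨K, n, C, hK, hC, -, hb⟩ := hf.exists_bound
  obtain ⟨δ, hδ, hδU⟩ := hc.isCompact.exists_cthickening_subset_open hU hηU
  have hA : ∀ i : ℕ, ∃ A : ℝ, ∀ z ∈ tsupport η, ‖iteratedFDeriv ℝ i η z‖ ≤ A := fun i =>
    hc.isCompact.exists_bound_of_continuousOn
      (hη.continuous_iteratedFDeriv (by exact_mod_cast le_top)).continuousOn
  choose A hA using hA
  set B : ℕ → ℝ := fun m => ∑ i ∈ Finset.range (m + 1),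
    (m.choose i : ℝ) * |A i| * ((m - i).factorial / δ ^ (m - i)) with hB
  have hB0 : ∀ m, 0 ≤ B m := fun m => Finset.sum_nonneg fun i _ => by positivity
  refine ⟨C * ∑ m ∈ Finset.range (n + 1), B m, fun h hh ε hε hhε => ?_⟩
  have hhs := hh.contDiffOn_real hU
  rw [mul_assoc]
  refine hb _ (contDiff_mul_of_tsupport_subset hU hη hηU hhs) _
    (mul_nonneg (Finset.sum_nonneg fun m _ => hB0 m) hε) fun m hm z _ => ?_
  have hm' : B m ≤ ∑ m ∈ Finset.range (n + 1), B m :=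
    Finset.single_le_sum (fun i _ => hB0 i) (Finset.mem_range.2 (by omega))
  refine le_trans ?_ (mul_le_mul_of_nonneg_right hm' hε)
  by_cases hz : z ∈ tsupport η
  · have hzU := hηU hz
    have hball : closedBall z δ ⊆ U := (closedBall_subset_cthickening hz δ).trans hδU
    rw [← iteratedFDerivWithin_of_isOpen m hU hzU]
    refine (norm_iteratedFDerivWithin_mul_le hη.contDiffOn hhs hU.uniqueDiffOn hzU
      (by exact_mod_cast le_top)).trans ?_
    rw [hB, Finset.sum_mul]
    refine Finset.sum_le_sum fun i _ => ?_
    rw [iteratedFDerivWithin_of_isOpen _ hU hzU, iteratedFDerivWithin_of_isOpen _ hU hzU]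
    have h1 := norm_iteratedFDeriv_le_of_differentiableOn hU hh hδ hball hhε (m - i)
    have h2 := (hA i z hz).trans (le_abs_self _)
    calc _ ≤ (m.choose i : ℝ) * |A i| * ((m - i).factorial * ε / δ ^ (m - i)) := by gcongr
      _ = _ := by ring
  · have h0 : z ∉ Function.support (iteratedFDeriv ℝ m fun z => η z * h z) := fun hz' =>
      hz (tsupport_mul_subset_left (support_iteratedFDeriv_subset m hz'))
    rw [Function.notMem_support.1 h0, norm_zero]
    exact mul_nonneg (hB0 m) hε

/-- `f` vanishes on every smooth function that agrees with `h` near the support of `f`. -/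
def AnnihilatesGerm (f : Dst) (h : ℂ → ℂ) : Prop :=
  ∀ ψ : ℂ → ℂ, ContDiff ℝ (⊤ : ℕ∞) ψ → (∀ᶠ z in nhdsSet (distSupport f), ψ z = h z) → f ψ = 0

theorem AnnihilatesGerm.congr {f : Dst} {h h' : ℂ → ℂ} (hh : AnnihilatesGerm f h)
    (he : ∀ᶠ z in nhdsSet (distSupport f), h' z = h z) : AnnihilatesGerm f h' := fun ψ hψ hev =>
  hh ψ hψ (by filter_upwards [hev, he] with z h1 h2 using h1.trans h2)

namespace MemEprime

variable {f : Dst}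

/-- If `f` annihilates all powers of a holomorphic function `t`, then it annihilates every
holomorphic function of `t`. -/
theorem annihilatesGerm_comp (hf : MemEprime f) {U : Set ℂ} (hU : IsOpen U)
    (hS : distSupport f ⊆ U) {t F : ℂ → ℂ} (ht : DifferentiableOn ℂ t U) {r R : ℝ} (hr : 0 < r)
    (hrR : r < R) (htr : ∀ z ∈ U, ‖t z‖ < r) (hFc : ContinuousOn F (closedBall 0 R))
    (hFd : ∀ z ∈ ball (0 : ℂ) R \ {0}, DifferentiableAt ℂ F z)
    (hk : ∀ k : ℕ, AnnihilatesGerm f fun z => t z ^ k) : AnnihilatesGerm f fun z => F (t z) := by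
  intro ψ hψ hev
  lift R to NNReal using (hr.trans hrR).le
  lift r to NNReal using hr.le
  obtain ⟨ρ, hρ⟩ := hf.isCompact_distSupport.isBounded.subset_ball 0
  obtain ⟨η, hη, hη1, hηs⟩ := exists_smooth_cutoff (isClosed_distSupport f)
    (hU.inter isOpen_ball) (Set.subset_inter hS hρ)
  have hηU := hηs.trans Set.inter_subset_left
  have hc : HasCompactSupport η := (isCompact_closedBall (0 : ℂ) ρ).of_isClosed_subset
    (isClosed_tsupport _) ((hηs.trans Set.inter_subset_right).trans ball_subset_closedBall)
  have hp := Complex.hasFPowerSeriesOnBall_of_differentiable_off_countable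
    (Set.countable_singleton (0 : ℂ)) hFc hFd (by exact_mod_cast hr.trans hrR)
  set p := cauchyPowerSeries F 0 R
  have hFt : DifferentiableOn ℂ (fun z => F (t z)) U := by
    refine hp.differentiableOn.comp ht fun z hz => ?_
    rw [Metric.eball_coe]
    exact mem_ball_zero_iff.2 ((htr z hz).trans hrR)
  have hsm : ∀ {h : ℂ → ℂ}, DifferentiableOn ℂ h U →
      ContDiff ℝ (⊤ : ℕ∞) fun z => η z * h z := fun hh =>
    contDiff_mul_of_tsupport_subset hU hη hηU (hh.contDiffOn_real hU)
  have hψη : f ψ = f fun z => η z * F (t z) := by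
    refine hf.congr_of_eventually hψ (hsm hFt) ?_
    filter_upwards [hev, hη1] with z h1 h2
    rw [h1, h2, one_mul]
  have hpow : ∀ N : ℕ, f (fun z => η z * p.partialSum N (t z)) = 0 := by
    intro N
    have h1 : (fun z => η z * p.partialSum N (t z)) =
        fun z => ∑ k ∈ Finset.range N, (p.coeff k • fun z => η z * t z ^ k) z := by
      ext z
      simp only [FormalMultilinearSeries.partialSum, Finset.mul_sum,
        FormalMultilinearSeries.apply_eq_pow_smul_coeff, Pi.smul_apply, smul_eq_mul]
      exact Finset.sum_congr rfl fun k _ => by ring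
    rw [h1]
    have hsk : ∀ k, ContDiff ℝ (⊤ : ℕ∞) fun z => η z * t z ^ k := fun k => hsm (ht.pow k)
    refine hf.map_sum_eq_zero _ (fun k => contDiff_const.smul (hsk k)) fun k => ?_
    rw [hf.2.1 _ _ (hsk k), hk k _ (hsk k), mul_zero]
    filter_upwards [hη1] with z hz
    rw [hz, one_mul]
  have hpd : ∀ N : ℕ, DifferentiableOn ℂ (fun z => p.partialSum N (t z)) U := by
    intro N
    simp only [FormalMultilinearSeries.partialSum, FormalMultilinearSeries.apply_eq_pow_smul_coeff]
    exact DifferentiableOn.fun_sum fun k _ => (ht.pow k).smul_const _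
  obtain ⟨C, hC⟩ := hf.exists_bound_holomorphic hU hη hc hηU
  have hlim := hp.tendstoUniformlyOn' (r' := r) (by exact_mod_cast hrR)
  rw [Metric.tendstoUniformlyOn_iff] at hlim
  by_contra hne
  have hpos : 0 < ‖f ψ‖ := norm_pos_iff.2 hne
  obtain ⟨N, hN⟩ := (hlim (‖f ψ‖ / (2 * (|C| + 1))) (by positivity)).exists
  have hd : DifferentiableOn ℂ (fun z => F (t z) - p.partialSum N (t z)) U := hFt.sub (hpd N)
  have h2 := hC _ hd (‖f ψ‖ / (2 * (|C| + 1))) (by positivity) fun z hz => by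
    have := (hN (t z) (mem_ball_zero_iff.2 (htr z hz))).le
    rwa [dist_eq_norm, sub_zero] at this
  have h3 : f (fun z => η z * (F (t z) - p.partialSum N (t z))) = f ψ := by
    rw [hψη, ← sub_zero (f fun z => η z * F (t z)), ← hpow N, ← hf.map_sub (hsm hFt) (hsm (hpd N))]
    congr 1
    ext z
    simp [mul_sub]
  rw [h3] at h2
  have h4 : C * (‖f ψ‖ / (2 * (|C| + 1))) ≤ ‖f ψ‖ / 2 := by
    calc C * (‖f ψ‖ / (2 * (|C| + 1))) ≤ (|C| + 1) * (‖f ψ‖ / (2 * (|C| + 1))) := by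
          gcongr
          linarith [le_abs_self C]
      _ = ‖f ψ‖ / 2 := by field_simp
  linarith

/-- A distribution annihilating the powers of `z` annihilates every function holomorphic on a disc
that contains its support. -/
theorem annihilatesGerm_of_differentiableOn_ball (hf : MemEprime f)
    (h0 : ∀ k : ℕ, f (fun z => z ^ k) = 0) {R : ℝ} (hR : distSupport f ⊆ ball 0 R) {h : ℂ → ℂ}
    (hh : DifferentiableOn ℂ h (ball 0 R)) : AnnihilatesGerm f h := by
  have hk : ∀ k : ℕ, AnnihilatesGerm f fun z => z ^ k := fun k ψ hψ hev => by
    rw [hf.congr_of_eventually hψ (contDiff_id.pow k) hev]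
    exact h0 k
  rcases (distSupport f).eq_empty_or_nonempty with he | hne
  · intro ψ hψ _
    exact hf.eq_zero_of_eventually hψ (by simp [he])
  have hR0 : 0 < R := pos_of_mem_ball (hR hne.some_mem)
  obtain ⟨r, hr, hrS⟩ := exists_pos_lt_subset_ball hR0 (isClosed_distSupport f) hR
  obtain ⟨R', hrR', hR'⟩ := exists_between hr.2
  exact hf.annihilatesGerm_comp isOpen_ball hrS (t := fun z => z) differentiableOn_id hr.1 hrR'
    (fun z hz => mem_ball_zero_iff.1 hz)
    (hh.continuousOn.mono (closedBall_subset_ball hR'))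
    (fun z hz => hh.differentiableAt (isOpen_ball.mem_nhds (ball_subset_ball hR'.le hz.1))) hk

end MemEprime

/-- The points at which all Cauchy kernels are annihilated by `f`. -/
def cauchyAnnihilated (f : Dst) : Set ℂ :=
  {w | w ∉ distSupport f ∧ ∀ k : ℕ, AnnihilatesGerm f fun z => (z - w)⁻¹ ^ k}

namespace MemEprime

variable {f : Dst}

theorem mem_cauchyAnnihilated_of_le_norm (hf : MemEprime f)
    (h0 : ∀ k : ℕ, f (fun z => z ^ k) = 0) {R : ℝ} (hR : distSupport f ⊆ ball 0 R) {w : ℂ}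
    (hw : R ≤ ‖w‖) : w ∈ cauchyAnnihilated f := by
  have hne : ∀ z ∈ ball (0 : ℂ) R, z - w ≠ 0 := fun z hz h => by
    rw [sub_eq_zero.1 h, mem_ball_zero_iff] at hz
    exact absurd hw hz.not_ge
  refine ⟨fun hwS => hne w (hR hwS) (sub_self w), fun k => ?_⟩
  refine hf.annihilatesGerm_of_differentiableOn_ball h0 hR fun z hz => ?_
  have := hne z hz
  exact (by fun_prop (disch := assumption) :
    DifferentiableAt ℂ (fun z => (z - w)⁻¹ ^ k) z).differentiableWithinAt

theorem annihilatesGerm_comp_inv (hf : MemEprime f) {w : ℂ} (hw : w ∈ cauchyAnnihilated f)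
    {ρ r : ℝ} (hr : 0 < r) (hrρ : r < ρ) (hρ : Disjoint (ball w ρ) (distSupport f)) {F : ℂ → ℂ}
    (hFc : ContinuousOn F (ball 0 r⁻¹))
    (hFd : ∀ z ∈ ball (0 : ℂ) r⁻¹ \ {0}, DifferentiableAt ℂ F z) :
    AnnihilatesGerm f fun z => F (z - w)⁻¹ := by
  obtain ⟨a, hra, haρ⟩ := exists_between hrρ
  obtain ⟨b, hrb, hba⟩ := exists_between hra
  have hb : 0 < b := hr.trans hrb
  have ha : 0 < a := hb.trans hba
  have hsub : closedBall (0 : ℂ) b⁻¹ ⊆ ball 0 r⁻¹ := closedBall_subset_ball (by gcongr)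
  refine hf.annihilatesGerm_comp (U := (closedBall w a)ᶜ) isClosed_closedBall.isOpen_compl
    (fun z hz hza => ?_) (t := fun z => (z - w)⁻¹) (fun z hz => ?_) (inv_pos.2 ha)
    (R := b⁻¹) (by gcongr) (fun z hz => ?_) (hFc.mono hsub)
    (fun z hz => hFd z ⟨hsub (ball_subset_closedBall hz.1), hz.2⟩) hw.2
  · exact Set.disjoint_left.1 hρ (closedBall_subset_ball haρ hza) hz
  · have : z - w ≠ 0 := fun h => hz (by rw [sub_eq_zero.1 h]; exact mem_closedBall_self ha.le)
    exact (by fun_prop (disch := assumption) :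
      DifferentiableAt ℂ (fun z => (z - w)⁻¹) z).differentiableWithinAt
  · rw [Set.mem_compl_iff, mem_closedBall, not_le, dist_eq_norm] at hz
    rw [norm_inv]
    gcongr

theorem ball_subset_cauchyAnnihilated (hf : MemEprime f) {w : ℂ} (hw : w ∈ cauchyAnnihilated f)
    {ρ : ℝ} (hρ : Disjoint (ball w ρ) (distSupport f)) : ball w ρ ⊆ cauchyAnnihilated f := by
  intro v hv
  refine ⟨Set.disjoint_left.1 hρ hv, fun k => ?_⟩
  obtain ⟨r, hvr, hrρ⟩ := exists_between (mem_ball.1 hv)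
  have hr : 0 < r := dist_nonneg.trans_lt hvr
  rw [dist_eq_norm] at hvr
  have hne : ∀ s ∈ ball (0 : ℂ) r⁻¹, 1 - s * (v - w) ≠ 0 := by
    intro s hs h
    rw [mem_ball_zero_iff] at hs
    have h1 : ‖s * (v - w)‖ = 1 := by rw [← sub_eq_zero.1 h, norm_one]
    rw [norm_mul] at h1
    have : ‖s‖ * ‖v - w‖ < r⁻¹ * r :=
      mul_lt_mul'' hs hvr (norm_nonneg _) (norm_nonneg _)
    rw [h1, inv_mul_cancel₀ hr.ne'] at this
    exact lt_irrefl _ this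
  have hd : ∀ s ∈ ball (0 : ℂ) r⁻¹,
      DifferentiableAt ℂ (fun s : ℂ => (s / (1 - s * (v - w))) ^ k) s := fun s hs => by
    have := hne s hs
    fun_prop (disch := assumption)
  refine (hf.annihilatesGerm_comp_inv hw hr hrρ hρ
    (fun s hs => (hd s hs).continuousAt.continuousWithinAt) fun s hs => hd s hs.1).congr ?_
  have hopen : (closedBall w r)ᶜ ∈ nhdsSet (distSupport f) :=
    isClosed_closedBall.isOpen_compl.mem_nhdsSet.2 fun z hz hzr =>
      Set.disjoint_left.1 hρ (closedBall_subset_ball hrρ hzr) hz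
  filter_upwards [hopen] with z hz
  have h1 : z - w ≠ 0 := fun h => hz (by rw [sub_eq_zero.1 h]; exact mem_closedBall_self hr.le)
  congr 1
  have h2 : 1 - (z - w)⁻¹ * (v - w) = (z - v) / (z - w) := by field_simp; ring
  rw [h2]
  by_cases h3 : z - v = 0
  · simp [h3]
  · field_simp

theorem isOpen_cauchyAnnihilated (hf : MemEprime f) : IsOpen (cauchyAnnihilated f) := by
  refine Metric.isOpen_iff.2 fun w hw => ?_
  obtain ⟨ρ, hρ, h⟩ := Metric.isOpen_iff.1 (isClosed_distSupport f).isOpen_compl w hw.1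
  exact ⟨ρ, hρ, hf.ball_subset_cauchyAnnihilated hw (Set.subset_compl_iff_disjoint_right.1 h)⟩

theorem closure_cauchyAnnihilated_inter (hf : MemEprime f) :
    closure (cauchyAnnihilated f) ∩ (distSupport f)ᶜ ⊆ cauchyAnnihilated f := by
  rintro w ⟨hw, hwS⟩
  obtain ⟨ρ, hρ, h⟩ := Metric.isOpen_iff.1 (isClosed_distSupport f).isOpen_compl w hwS
  obtain ⟨v, hv, hvw⟩ := Metric.mem_closure_iff.1 hw (ρ / 2) (half_pos hρ)
  refine hf.ball_subset_cauchyAnnihilated hv (ρ := ρ / 2) (Set.subset_compl_iff_disjoint_right.1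
    ((ball_subset_ball' ?_).trans h)) (mem_ball.2 hvw)
  rw [dist_comm]
  linarith

/-- `f` annihilates the Cauchy kernels at all points of the unbounded components of the complement
of its support. -/
theorem mem_cauchyAnnihilated_of_not_isBounded (hf : MemEprime f)
    (h0 : ∀ k : ℕ, f (fun z => z ^ k) = 0) {z : ℂ} (hz : z ∉ distSupport f)
    (hb : ¬ Bornology.IsBounded (connectedComponentIn (distSupport f)ᶜ z)) :
    z ∈ cauchyAnnihilated f := by
  obtain ⟨R, hR⟩ := hf.isCompact_distSupport.isBounded.subset_ball 0
  obtain ⟨w, hw, hwR⟩ : ∃ w ∈ connectedComponentIn (distSupport f)ᶜ z, R ≤ ‖w‖ := by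
    by_contra! h
    exact hb (isBounded_ball.subset fun w hw => mem_ball_zero_iff.2 (h w hw))
  refine isPreconnected_connectedComponentIn.subset_of_closure_inter_subset
    hf.isOpen_cauchyAnnihilated ⟨w, hw, hf.mem_cauchyAnnihilated_of_le_norm h0 hR hwR⟩
    (fun v hv => hf.closure_cauchyAnnihilated_inter
      ⟨hv.1, connectedComponentIn_subset _ _ hv.2⟩) (mem_connectedComponentIn hz)

end MemEprime

theorem dbarFun_eq_zero {h : ℂ → ℂ} {z : ℂ} (hh : DifferentiableAt ℂ h z) : dbarFun h z = 0 := by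
  rw [dbarFun, (differentiableAt_complex_iff_differentiableAt_real.1 hh).2, smul_eq_mul,
    ← mul_assoc, I_mul_I]
  ring

theorem differentiableAt_of_dbarFun_eq_zero {h : ℂ → ℂ} {z : ℂ} (hh : DifferentiableAt ℝ h z)
    (h0 : dbarFun h z = 0) : DifferentiableAt ℂ h z := by
  refine differentiableAt_complex_iff_differentiableAt_real.2 ⟨hh, ?_⟩
  have h1 : fderiv ℝ h z 1 + I * fderiv ℝ h z I = 0 := by
    simpa [dbarFun] using h0
  rw [smul_eq_mul]
  linear_combination (-I) * h1 + fderiv ℝ h z I * I_mul_I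

theorem tendsto_cauchyTransform_cobounded {u : ℂ → ℂ} (hu : Continuous u)
    (hc : HasCompactSupport u) : Tendsto (cauchyTransform u) (Bornology.cobounded ℂ) (nhds 0) := by
  obtain ⟨σ, hσ⟩ := hc.isCompact.isBounded.subset_closedBall 0
  have hlim : Tendsto (fun z : ℂ => (Real.pi * (‖z‖ - σ))⁻¹ * ∫ y, ‖u y‖)
      (Bornology.cobounded ℂ) (nhds 0) := by
    rw [← zero_mul (∫ y, ‖u y‖)]
    refine Tendsto.mul_const _ (tendsto_inv_atTop_zero.comp ?_)
    exact (tendsto_atTop_add_const_right _ _ tendsto_norm_cobounded_atTop).const_mul_atTop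
      Real.pi_pos
  refine squeeze_zero_norm' ?_ hlim
  filter_upwards [tendsto_norm_cobounded_atTop.eventually_gt_atTop σ] with z hz
  rw [cauchyTransform, convolution_eq_swap, ← integral_const_mul]
  refine norm_integral_le_of_norm_le ((hu.integrable_of_hasCompactSupport hc).norm.const_mul _)
    (Eventually.of_forall fun y => ?_)
  by_cases hy : y ∈ tsupport u
  · have h1 : ‖y‖ ≤ σ := mem_closedBall_zero_iff.1 (hσ hy)
    have h2 : ‖z‖ - σ ≤ ‖z - y‖ := by linarith [norm_sub_norm_le z y]
    have h3 : 0 < ‖z‖ - σ := sub_pos.2 hz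
    have h4 := Real.pi_pos
    rw [ContinuousLinearMap.mul_apply', norm_mul, cauchyKernel, norm_inv, norm_mul, norm_real,
      Real.norm_of_nonneg Real.pi_pos.le]
    gcongr
  · simp [image_eq_zero_of_notMem_tsupport hy]

theorem le_sSup_norm_iteratedFDeriv {K : Set ℂ} (hK : IsCompact K) {ψ : ℂ → ℂ}
    (hψ : ContDiff ℝ (⊤ : ℕ∞) ψ) {m n : ℕ} (hm : m ≤ n) {z : ℂ} (hz : z ∈ K) :
    ‖iteratedFDeriv ℝ m ψ z‖ ≤
      sSup {r : ℝ | ∃ m ≤ n, ∃ z ∈ K, r = ‖iteratedFDeriv ℝ m ψ z‖} := by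
  have hb : ∀ i : ℕ, ∃ b : ℝ, ∀ z ∈ K, ‖iteratedFDeriv ℝ i ψ z‖ ≤ b := fun i =>
    hK.exists_bound_of_continuousOn
      (hψ.continuous_iteratedFDeriv (by exact_mod_cast le_top)).continuousOn
  choose b hb using hb
  refine le_csSup ⟨∑ i ∈ Finset.range (n + 1), |b i|, ?_⟩ ⟨m, hm, z, hz, rfl⟩
  rintro r ⟨i, hi, w, hw, rfl⟩
  exact ((hb i w hw).trans (le_abs_self _)).trans
    (Finset.single_le_sum (f := fun i => |b i|) (fun j _ => abs_nonneg _)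
      (Finset.mem_range.2 (by omega)))

/-- Multiplication by a compactly supported smooth function is bounded for `C^n`-seminorms. -/
theorem exists_bound_iteratedFDeriv_mul {χ : ℂ → ℂ} {K : Set ℂ} (hχ : ContDiff ℝ (⊤ : ℕ∞) χ)
    (hK : IsCompact K) (hχK : tsupport χ ⊆ K) (n : ℕ) :
    ∃ B : ℝ, 0 ≤ B ∧ ∀ φ : ℂ → ℂ, ContDiff ℝ (⊤ : ℕ∞) φ → ∀ M : ℝ, 0 ≤ M →
      (∀ m ≤ n, ∀ z ∈ K, ‖iteratedFDeriv ℝ m φ z‖ ≤ M) →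
      ∀ m ≤ n, ∀ z, ‖iteratedFDeriv ℝ m (χ * φ) z‖ ≤ B * M := by
  have hA : ∀ i : ℕ, ∃ A : ℝ, ∀ z ∈ K, ‖iteratedFDeriv ℝ i χ z‖ ≤ A := fun i =>
    hK.exists_bound_of_continuousOn
      (hχ.continuous_iteratedFDeriv (by exact_mod_cast le_top)).continuousOn
  choose A hA using hA
  set B : ℕ → ℝ := fun m => ∑ i ∈ Finset.range (m + 1), (m.choose i : ℝ) * |A i| with hB
  have hB0 : ∀ m, 0 ≤ B m := fun m => Finset.sum_nonneg fun i _ => by positivity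
  refine ⟨∑ m ∈ Finset.range (n + 1), B m, Finset.sum_nonneg fun m _ => hB0 m,
    fun φ hφ M hM h m hm z => ?_⟩
  have hm' : B m ≤ ∑ m ∈ Finset.range (n + 1), B m :=
    Finset.single_le_sum (fun i _ => hB0 i) (Finset.mem_range.2 (by omega))
  refine le_trans ?_ (mul_le_mul_of_nonneg_right hm' hM)
  by_cases hz : z ∈ tsupport χ
  · refine (norm_iteratedFDeriv_mul_le hχ hφ z (by exact_mod_cast le_top)).trans ?_
    rw [hB, Finset.sum_mul]
    refine Finset.sum_le_sum fun i _ => ?_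
    have h1 := h (m - i) (by omega) z (hχK hz)
    have h2 := (hA i z (hχK hz)).trans (le_abs_self _)
    gcongr
  · have h0 : z ∉ Function.support (iteratedFDeriv ℝ m (χ * φ)) := fun hz' =>
      hz (tsupport_mul_subset_left (support_iteratedFDeriv_subset m hz'))
    rw [Function.notMem_support.1 h0, norm_zero]
    exact mul_nonneg (hB0 m) hM

/-- The candidate solution `φ ↦ -⟨f, C(χ φ)⟩` of the equation `∂̄g = f`, with `C` the Cauchy
transform and `χ` a cutoff function. -/
def cutoffPotential (f : Dst) (χ : ℂ → ℂ) : Dst := fun φ => -f (cauchyTransform (χ * φ))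

namespace MemEprime

variable {f : Dst}

theorem memEprime_cutoffPotential (hf : MemEprime f) {χ : ℂ → ℂ} (hχ : ContDiff ℝ (⊤ : ℕ∞) χ)
    {σ : ℝ} (hσ : tsupport χ ⊆ closedBall 0 σ) : MemEprime (cutoffPotential f χ) := by
  have hc : HasCompactSupport χ := (isCompact_closedBall (0 : ℂ) σ).of_isClosed_subset
    (isClosed_tsupport _) hσ
  have hs : ∀ {φ : ℂ → ℂ}, ContDiff ℝ (⊤ : ℕ∞) φ → ContDiff ℝ (⊤ : ℕ∞) (χ * φ) := fun h => hχ.mul h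
  have hC : ∀ {φ : ℂ → ℂ}, ContDiff ℝ (⊤ : ℕ∞) φ →
      ContDiff ℝ (⊤ : ℕ∞) (cauchyTransform (χ * φ)) := fun h =>
    contDiff_cauchyTransform (hs h) hc.mul_right
  refine ⟨fun ψ φ hψ hφ => ?_, fun c ψ hψ => ?_, ?_⟩
  · simp only [cutoffPotential]
    rw [mul_add, cauchyTransform_add (hs hψ).continuous (hs hφ).continuous hc.mul_right
      hc.mul_right, hf.1 _ _ (hC hψ) (hC hφ), neg_add]
  · simp only [cutoffPotential]
    rw [mul_smul_comm, cauchyTransform_smul, hf.2.1 _ _ (hC hψ), mul_neg]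
  · obtain ⟨K, n, C, hK, hC0, -, hb⟩ := hf.exists_bound
    obtain ⟨ρ, hρ⟩ := hK.isBounded.subset_closedBall 0
    obtain ⟨B, hB0, hB⟩ := exists_bound_iteratedFDeriv_mul hχ (isCompact_closedBall 0 σ) hσ n
    set A : ℝ := ‖ContinuousLinearMap.mul ℝ ℂ‖ *
      ∫ w in closedBall (0 : ℂ) (ρ + σ), ‖cauchyKernel w‖
    refine ⟨closedBall 0 σ, n, C * (A * B), isCompact_closedBall 0 σ, fun φ hφ hd => ?_,
      fun φ hφ => ?_⟩
    · have h0 : χ * φ = 0 := by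
        ext z
        by_cases hz : z ∈ tsupport φ
        · have : z ∉ tsupport χ := fun h => Set.disjoint_left.1 hd hz (hσ h)
          simp [image_eq_zero_of_notMem_tsupport this]
        · simp [image_eq_zero_of_notMem_tsupport hz]
      simp only [cutoffPotential]
      rw [h0, cauchyTransform_zero, hf.map_zero, neg_zero]
    · set s := sSup {r : ℝ | ∃ m ≤ n, ∃ z ∈ closedBall (0 : ℂ) σ, r = ‖iteratedFDeriv ℝ m φ z‖}
      have hs0 : 0 ≤ s := by
        refine Real.sSup_nonneg ?_
        rintro r ⟨m, hm, z, hz, rfl⟩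
        exact norm_nonneg _
      have hA0 : 0 ≤ A :=
        mul_nonneg (ContinuousLinearMap.opNorm_nonneg _) (integral_nonneg fun w => norm_nonneg _)
      rw [cutoffPotential, norm_neg, mul_assoc]
      refine hb _ (hC hφ) _ (by positivity) fun m hm z hz => ?_
      rw [mul_assoc]
      refine norm_iteratedFDeriv_convolution_le m (ContinuousLinearMap.mul ℝ ℂ) (hs hφ)
        ((tsupport_mul_subset_left).trans hσ) (fun y => ?_) z (hρ hz)
      exact hB φ hφ s hs0
        (fun i hi w hw => le_sSup_norm_iteratedFDeriv (isCompact_closedBall 0 σ) hφ hi hw) m hm y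

theorem neg_cutoffPotential_dbarFun (hf : MemEprime f)
    (h0 : ∀ k : ℕ, f (fun z => z ^ k) = 0) {R : ℝ}
    (hR : distSupport f ⊆ ball 0 R) {χ : ℂ → ℂ} (hχ : ContDiff ℝ (⊤ : ℕ∞) χ)
    (hc : HasCompactSupport χ) (hχ1 : ∀ z ∈ ball (0 : ℂ) R, χ z = 1) {ψ : ℂ → ℂ}
    (hψ : ContDiff ℝ (⊤ : ℕ∞) ψ) : -cutoffPotential f χ (dbarFun ψ) = f ψ := by
  have hψ' : ContDiff ℝ (⊤ : ℕ∞) (fderiv ℝ ψ) := hψ.fderiv_right le_rfl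
  have hd : ContDiff ℝ (⊤ : ℕ∞) (dbarFun ψ) :=
    ((hψ'.clm_apply contDiff_const).add
      (contDiff_const.mul (hψ'.clm_apply contDiff_const))).div_const _
  have hu : ContDiff ℝ (⊤ : ℕ∞) (χ * dbarFun ψ) := hχ.mul hd
  have hC := contDiff_cauchyTransform hu hc.mul_right
  have hne : ((⊤ : ℕ∞) : WithTop ℕ∞) ≠ 0 := by simp
  have hhol : DifferentiableOn ℂ (cauchyTransform (χ * dbarFun ψ) - ψ) (ball 0 R) := by
    intro z hz
    have h1 := (hC.differentiable hne).differentiableAt (x := z)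
    have h2 := (hψ.differentiable hne).differentiableAt (x := z)
    refine (differentiableAt_of_dbarFun_eq_zero (h1.sub h2) ?_).differentiableWithinAt
    have h3 := congrFun (dbarFun_cauchyTransform (hu.of_le (by exact_mod_cast le_top))
      hc.mul_right) z
    simp only [Pi.mul_apply, hχ1 z hz, one_mul, dbarFun] at h3 ⊢
    rw [fderiv_sub h1 h2]
    simp only [_root_.sub_apply]
    linear_combination h3
  have h4 : f (cauchyTransform (χ * dbarFun ψ) - ψ) = 0 :=
    hf.annihilatesGerm_of_differentiableOn_ball h0 hR hhol _ (hC.sub hψ)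
    (Eventually.of_forall fun _ => rfl)
  rw [hf.map_sub hC hψ, sub_eq_zero] at h4
  rw [cutoffPotential, neg_neg, h4]

/-- A distribution annihilating all Cauchy kernels at `w` annihilates the Cauchy transform of any
function supported near `w`. -/
theorem annihilatesGerm_cauchyTransform (hf : MemEprime f) {w : ℂ}
    (hw : w ∈ cauchyAnnihilated f) {ρ r : ℝ} (hr : 0 < r) (hrρ : r < ρ)
    (hρ : Disjoint (ball w ρ) (distSupport f)) {u : ℂ → ℂ} (hu : ContDiff ℝ (⊤ : ℕ∞) u)
    (hur : tsupport u ⊆ ball w r) : AnnihilatesGerm f (cauchyTransform u) := by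
  have hc : HasCompactSupport u := (isCompact_closedBall w r).of_isClosed_subset
    (isClosed_tsupport _) (hur.trans ball_subset_closedBall)
  have hC := contDiff_cauchyTransform hu hc
  have hd : ∀ s ∈ ball (0 : ℂ) r⁻¹ \ {0}, DifferentiableAt ℂ
      (Function.update (fun s => cauchyTransform u (w + s⁻¹)) 0 0) s := by
    rintro s ⟨hs, hs0⟩
    have hs0 : s ≠ 0 := hs0
    have hsu : w + s⁻¹ ∉ tsupport u := fun h => by
      have h1 := hur h
      rw [mem_ball_zero_iff] at hs
      rw [mem_ball, dist_eq_norm, add_sub_cancel_left, norm_inv] at h1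
      exact absurd hs ((inv_lt_comm₀ (norm_pos_iff.2 hs0) hr).1 h1).not_gt
    have h2 : DifferentiableAt ℂ (cauchyTransform u) (w + s⁻¹) := by
      refine differentiableAt_of_dbarFun_eq_zero
        ((hC.differentiable (by simp)).differentiableAt) ?_
      rw [dbarFun_cauchyTransform (hu.of_le (by exact_mod_cast le_top)) hc]
      exact image_eq_zero_of_notMem_tsupport hsu
    have h3 : DifferentiableAt ℂ (fun s : ℂ => w + s⁻¹) s := by fun_prop (disch := assumption)
    refine (h2.comp s h3).congr_of_eventuallyEq ?_
    filter_upwards [isOpen_ne.mem_nhds hs0] with v hv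
    simp [Function.update_of_ne hv]
  refine (hf.annihilatesGerm_comp_inv hw hr hrρ hρ (fun s hs => ?_) hd).congr ?_
  · rcases eq_or_ne s 0 with rfl | hs0
    · refine (continuousAt_update_same.2 ?_).continuousWithinAt
      refine (tendsto_cauchyTransform_cobounded hu.continuous hc).comp ?_
      exact (tendsto_const_add_cobounded w).comp tendsto_inv₀_nhdsNE_zero
    · exact (hd s ⟨hs, hs0⟩).continuousAt.continuousWithinAt
  · filter_upwards [isOpen_ne.mem_nhdsSet.2 fun z hz (h : z = w) => hw.1 (h ▸ hz)] with z hz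
    rw [Function.update_of_ne (inv_ne_zero (sub_ne_zero.2 hz)), inv_inv, add_sub_cancel]

end MemEprime

/-- **The `∂̄`-equation for compactly supported distributions.** For `𝐟 ∈ 𝓔'(ℂ)`,
the existence of `𝐠 ∈ 𝓔'(ℂ)` with `∂̄𝐠 = 𝐟` whose support avoids the unbounded
connected component of the complement of `supp 𝐟` is equivalent to `𝐟`
annihilating all analytic polynomials. -/
theorem dbar_compact_support_iff_orthogonal
    (f : Dst) (hf : MemEprime f) :
    (∃ g : Dst, MemEprime g ∧
        (∀ ψ : ℂ → ℂ, ContDiff ℝ (⊤ : ℕ∞) ψ → -g (dbarFun ψ) = f ψ) ∧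
        ∀ z ∈ distSupport g, z ∉ distSupport f →
          Bornology.IsBounded (connectedComponentIn (distSupport f)ᶜ z)) ↔
      (∀ k : ℕ, f (fun z => z ^ k) = 0) := by
  constructor
  · rintro ⟨g, hg, hgf, -⟩ k
    have hk : ContDiff ℝ (⊤ : ℕ∞) fun z : ℂ => z ^ k := contDiff_id.pow k
    rw [← hgf _ hk, show dbarFun (fun z => z ^ k) = 0 from
      funext fun z => dbarFun_eq_zero (by fun_prop), hg.map_zero, neg_zero]
  · intro h0
    obtain ⟨R, hR⟩ := hf.isCompact_distSupport.isBounded.subset_ball 0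
    obtain ⟨χ, hχ, hχ1, hχs⟩ := exists_smooth_cutoff (isClosed_closedBall (x := (0 : ℂ)) (ε := R))
      isOpen_ball (closedBall_subset_ball (lt_add_one R))
    have hχs' := hχs.trans ball_subset_closedBall
    have hc : HasCompactSupport χ := (isCompact_closedBall (0 : ℂ) (R + 1)).of_isClosed_subset
      (isClosed_tsupport _) hχs'
    refine ⟨cutoffPotential f χ, hf.memEprime_cutoffPotential hχ hχs',
      fun ψ hψ => hf.neg_cutoffPotential_dbarFun h0 hR hχ hc
        (fun z hz => hχ1.self_of_nhdsSet z (ball_subset_closedBall hz)) hψ, fun z hz hzS => ?_⟩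
    by_contra hb
    have hzN := hf.mem_cauchyAnnihilated_of_not_isBounded h0 hzS hb
    obtain ⟨ρ, hρ, h⟩ := Metric.isOpen_iff.1 (isClosed_distSupport f).isOpen_compl z hzS
    obtain ⟨φ, hφ, hφs, hne⟩ := hz _ isOpen_ball (mem_ball_self (half_pos hρ))
    have hχφ : ContDiff ℝ (⊤ : ℕ∞) (χ * φ) := hχ.mul hφ
    refine hne (neg_eq_zero.2 ?_)
    exact hf.annihilatesGerm_cauchyTransform hzN (half_pos hρ) (half_lt_self hρ)
      (Set.subset_compl_iff_disjoint_right.1 h) hχφ (tsupport_mul_subset_right.trans hφs) _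
      (contDiff_cauchyTransform hχφ hc.mul_right) (Eventually.of_forall fun _ => rfl)
end
end
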